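/- Let (u, π, v, θ) be a smooth solution of the stationary 3D tropical climate model. Suppose p ∈ [3, 9/2], q ∈ [2, 2p′) where p′ = p/(p−1), r ∈ [1, 2), α ∈ [0, 3/p − 2/3], β ∈ [0, 3/q − 1/2], γ ∈ [0, 3/r − 1/2], and the inequalities α + ((4p−6)q/((6−q)p))·β ≤ 1, α + ((4p−6)r/((6−r)p))·γ ≤ 1, and β + (2r/(6−r))·γ ≤ (6−q)/(2q) hold. Assume there exists a sequence R_j → +∞ such that X_{α,p,R_j} → 0 as j → ∞ and the limits lim_{j→∞} Y_{β,q,R_j} and lim_{j→∞} Z_{γ,r,R_j} exist and are finite. Then u = 0, v = 0 and θ = 0 identically on ℝ³. -/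

import Mathlib

open MeasureTheory Filter Metric

noncomputable section

abbrev R3 : Type := EuclideanSpace ℝ (Fin 3)

/-- Partial derivative of `f` in the `j`-th coordinate direction. -/
def pd (f : R3 → ℝ) (j : Fin 3) (x : R3) : ℝ :=
  fderiv ℝ f x (EuclideanSpace.single j 1)

/-- Laplacian of `f`. -/
def lap (f : R3 → ℝ) (x : R3) : ℝ := ∑ j, pd (pd f j) j x

/-- The stationary 3D tropical climate model:
`-Δu + (u·∇)u + ∇π + div(v⊗v) = 0`, `-Δv + (u·∇)v + ∇θ + (v·∇)u = 0`,
`-Δθ + u·∇θ + div v = 0`, `div u = 0`. -/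
def TCM (u v : R3 → R3) (pr θ : R3 → ℝ) : Prop :=
  (∀ i x, -lap (fun y => u y i) x + (∑ j, u x j * pd (fun y => u y i) j x)
      + pd pr i x + (∑ j, pd (fun y => v y j * v y i) j x) = 0) ∧
  (∀ i x, -lap (fun y => v y i) x + (∑ j, u x j * pd (fun y => v y i) j x)
      + pd θ i x + (∑ j, v x j * pd (fun y => u y i) j x) = 0) ∧
  (∀ x, -lap θ x + (∑ j, u x j * pd θ j x) + (∑ j, pd (fun y => v y j) j x) = 0) ∧
  (∀ x, (∑ j, pd (fun y => u y j) j x) = 0)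

/-- The annulus `B_{2R} \ B_R`. -/
def annulus (R : ℝ) : Set R3 := ball (0 : R3) (2 * R) \ ball 0 R

/-- `L^p` norm of a scalar function on a set `E`. -/
def lpS (g : R3 → ℝ) (p : ℝ) (E : Set R3) : ℝ := (∫ x in E, |g x| ^ p) ^ (1 / p)

/-- `X_{α,p,R} = R^{-α} ‖f‖_{L^p(B_{2R} \ B_R)}` for a vector field `f`. -/
def XnV (f : R3 → R3) (a p R : ℝ) : ℝ := R ^ (-a) * lpS (fun x => ‖f x‖) p (annulus R)

/-- `X_{α,p,R} = R^{-α} ‖f‖_{L^p(B_{2R} \ B_R)}` for a scalar function `f`. -/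
def XnS (f : R3 → ℝ) (a p R : ℝ) : ℝ := R ^ (-a) * lpS f p (annulus R)

lemma psi_eps_convex (m ε ζ k K : ℝ) (hm : 1 ≤ m) (hε : 0 < ε) (hk : k ^ 2 = 1) (hK : 4 * m ≤ K) :
    ConvexOn ℝ Set.univ (fun x : ℝ =>
      (K * x ^ 2 + (ζ + k * x) ^ 2 + ε) ^ m - 2 * ((ζ + k * x) ^ 2 + ε) ^ m) := by
  have hQ : ∀ x : ℝ, HasDerivAt (fun x : ℝ => K * x ^ 2 + (ζ + k * x) ^ 2 + ε)
      (2 * K * x + 2 * k * (ζ + k * x)) x := by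
    intro x
    have h1 := ((hasDerivAt_id x).pow 2).const_mul K
    have h2 := ((((hasDerivAt_id x).const_mul k).const_add ζ).pow 2)
    refine (((h1.add h2).add_const ε)).congr_deriv ?_
    simp; ring
  have hz : ∀ x : ℝ, HasDerivAt (fun x : ℝ => (ζ + k * x) ^ 2 + ε)
      (2 * k * (ζ + k * x)) x := by
    intro x
    have h2 := ((((hasDerivAt_id x).const_mul k).const_add ζ).pow 2)
    refine (((h2).add_const ε)).congr_deriv ?_
    simp; ring
  have hK0 : 0 ≤ K := by linarith
  have hzp : ∀ x : ℝ, 0 < (ζ + k * x) ^ 2 + ε := fun x => by positivity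
  have hQp : ∀ x : ℝ, 0 < K * x ^ 2 + (ζ + k * x) ^ 2 + ε := fun x => by positivity
  have hf' : ∀ x : ℝ, HasDerivAt (fun x : ℝ =>
      (K * x ^ 2 + (ζ + k * x) ^ 2 + ε) ^ m - 2 * ((ζ + k * x) ^ 2 + ε) ^ m)
      ((2 * K * x + 2 * k * (ζ + k * x)) * m * (K * x ^ 2 + (ζ + k * x) ^ 2 + ε) ^ (m - 1)
        - 2 * ((2 * k * (ζ + k * x)) * m * ((ζ + k * x) ^ 2 + ε) ^ (m - 1))) x := by
    intro x
    exact ((hQ x).rpow_const (Or.inl (hQp x).ne')).sub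
      (((hz x).rpow_const (Or.inl (hzp x).ne')).const_mul 2)
  have hl1 : ∀ x : ℝ, HasDerivAt (fun x : ℝ => (2 * K * x + 2 * k * (ζ + k * x)) * m)
      ((2 * K + 2 * k ^ 2) * m) x := by
    intro x
    have h1 := ((hasDerivAt_id x).const_mul (2 * K)).add
      ((((hasDerivAt_id x).const_mul k).const_add ζ).const_mul (2 * k))
    refine (h1.mul_const m).congr_deriv ?_
    ring
  have hl2 : ∀ x : ℝ, HasDerivAt (fun x : ℝ => (2 * k * (ζ + k * x)) * m)
      ((2 * k ^ 2) * m) x := by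
    intro x
    have h1 := ((((hasDerivAt_id x).const_mul k).const_add ζ).const_mul (2 * k))
    refine (h1.mul_const m).congr_deriv ?_
    ring
  have hf'' : ∀ x : ℝ, HasDerivAt (fun x : ℝ =>
      ((2 * K * x + 2 * k * (ζ + k * x)) * m * (K * x ^ 2 + (ζ + k * x) ^ 2 + ε) ^ (m - 1)
        - 2 * ((2 * k * (ζ + k * x)) * m * ((ζ + k * x) ^ 2 + ε) ^ (m - 1))))
      ((((2 * K + 2 * k ^ 2) * m) * (K * x ^ 2 + (ζ + k * x) ^ 2 + ε) ^ (m - 1)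
        + (2 * K * x + 2 * k * (ζ + k * x)) * m * ((2 * K * x + 2 * k * (ζ + k * x)) * (m - 1)
          * (K * x ^ 2 + (ζ + k * x) ^ 2 + ε) ^ (m - 1 - 1)))
      - 2 * (((2 * k ^ 2) * m) * ((ζ + k * x) ^ 2 + ε) ^ (m - 1)
        + (2 * k * (ζ + k * x)) * m * ((2 * k * (ζ + k * x)) * (m - 1)
          * ((ζ + k * x) ^ 2 + ε) ^ (m - 1 - 1)))) x := by
    intro x
    exact ((hl1 x).mul ((hQ x).rpow_const (Or.inl (hQp x).ne'))).sub
      (((hl2 x).mul ((hz x).rpow_const (Or.inl (hzp x).ne'))).const_mul 2)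
  have hd1 : deriv (fun x : ℝ =>
      (K * x ^ 2 + (ζ + k * x) ^ 2 + ε) ^ m - 2 * ((ζ + k * x) ^ 2 + ε) ^ m) = _ :=
    funext fun x => (hf' x).deriv
  refine convexOn_univ_of_deriv2_nonneg (fun x => (hf' x).differentiableAt) ?_ ?_
  · rw [hd1]; exact fun x => (hf'' x).differentiableAt
  · intro x
    simp only [Function.iterate_succ, Function.iterate_zero, Function.comp_apply, id_eq]
    rw [hd1, (hf'' x).deriv]
    set z := ζ + k * x
    set Q := K * x ^ 2 + z ^ 2 + ε with hQd
    have e1 : (z ^ 2 + ε) ^ (m - 1) = (z ^ 2 + ε) ^ (m - 1 - 1) * (z ^ 2 + ε) := by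
      rw [← Real.rpow_add_one (hzp x).ne']; congr 1; ring
    have e2 : (z ^ 2 + ε) ^ (m - 1) ≤ Q ^ (m - 1) :=
      Real.rpow_le_rpow (hzp x).le (by rw [hQd]; nlinarith [sq_nonneg x]) (by linarith)
    have h0 : 0 ≤ (2 * K * x + 2 * k * z) * m * ((2 * K * x + 2 * k * z) * (m - 1)
          * Q ^ (m - 1 - 1)) := by
      have : 0 ≤ Q ^ (m - 1 - 1) := Real.rpow_nonneg (hQp x).le _
      have h3 : 0 ≤ (2 * K * x + 2 * k * z)^2 * m * (m - 1) * Q ^ (m - 1 - 1) := by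
        have : 0 ≤ m - 1 := by linarith
        positivity
      calc _ ≤ _ := h3
        _ = _ := by ring
    have h1 : (2 * k * z) * m * ((2 * k * z) * (m - 1) * (z ^ 2 + ε) ^ (m - 1 - 1))
        ≤ 4 * m * (m - 1) * (z ^ 2 + ε) ^ (m - 1) := by
      have h4 : 0 ≤ (z ^ 2 + ε) ^ (m - 1 - 1) := Real.rpow_nonneg (hzp x).le _
      have h5 : (2 * k * z) * m * ((2 * k * z) * (m - 1) * (z ^ 2 + ε) ^ (m - 1 - 1))
        = 4 * m * (m - 1) * ((z ^ 2 + ε) ^ (m - 1 - 1) * (k ^ 2 * z ^ 2)) := by ring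
      rw [h5, hk, e1, one_mul]
      have : 0 ≤ m - 1 := by linarith
      gcongr
      linarith
    rw [hk]
    have h6 : 0 ≤ (z ^ 2 + ε) ^ (m - 1) := Real.rpow_nonneg (hzp x).le _
    have h7 : (2 * 1 * m + 4 * m * (m - 1)) * 2 * (z ^ 2 + ε) ^ (m - 1) ≤
      ((2 * K + 2 * 1) * m) * Q ^ (m - 1) := by
      apply mul_le_mul _ e2 h6
      · nlinarith
      · nlinarith
    nlinarith

lemma psi_conv (m ζ k K : ℝ) (hm : 1 ≤ m) (hk : k ^ 2 = 1) (hK : 4 * m ≤ K) (a b s t : ℝ)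
    (hs : 0 ≤ s) (ht : 0 ≤ t) (hst : s + t = 1) :
    (K * (s*a+t*b) ^ 2 + (ζ + k * (s*a+t*b)) ^ 2) ^ m - 2 * ((ζ + k * (s*a+t*b)) ^ 2) ^ m ≤
    s * ((K * a ^ 2 + (ζ + k * a) ^ 2) ^ m - 2 * ((ζ + k * a) ^ 2) ^ m) +
    t * ((K * b ^ 2 + (ζ + k * b) ^ 2) ^ m - 2 * ((ζ + k * b) ^ 2) ^ m) := by
  have hc : ∀ x : ℝ, Tendsto (fun ε : ℝ =>
      (K * x ^ 2 + (ζ + k * x) ^ 2 + ε) ^ m - 2 * ((ζ + k * x) ^ 2 + ε) ^ m) (nhdsWithin 0 (Set.Ioi 0))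
      (nhds ((K * x ^ 2 + (ζ + k * x) ^ 2) ^ m - 2 * ((ζ + k * x) ^ 2) ^ m)) := by
    intro x
    have : Continuous (fun ε : ℝ =>
      (K * x ^ 2 + (ζ + k * x) ^ 2 + ε) ^ m - 2 * ((ζ + k * x) ^ 2 + ε) ^ m) := by
      refine Continuous.sub ?_ (continuous_const.mul ?_)
      · exact (continuous_const.add continuous_id).rpow_const (fun _ => Or.inr (by linarith))
      · exact (continuous_const.add continuous_id).rpow_const (fun _ => Or.inr (by linarith))
    have h := (this.tendsto 0).mono_left (nhdsWithin_le_nhds (s := Set.Ioi 0))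
    simpa using h
  refine le_of_tendsto_of_tendsto (hc (s*a+t*b)) (((hc a).const_mul s).add ((hc b).const_mul t)) ?_
  filter_upwards [self_mem_nhdsWithin] with ε hε
  have := (psi_eps_convex m ε ζ k K hm hε hk hK).2 (Set.mem_univ a) (Set.mem_univ b) hs ht hst
  simpa only [smul_eq_mul] using this

/-- Bellman function. -/
lemma bellman (p : ℝ) (hp : 2 ≤ p) : ∃ B : ℝ → ℝ → ℝ, ∃ C : ℝ, 0 < C ∧
    Continuous (fun z : ℝ × ℝ => B z.1 z.2) ∧ (∀ x y, 0 ≤ B x y) ∧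
    (∀ x y, B x y ≤ C * (|x| ^ p + |y| ^ (p / (p - 1)))) ∧
    (∀ x₁ y₁ x₂ y₂, B ((x₁ + x₂) / 2) ((y₁ + y₂) / 2) + |x₁ - x₂| * |y₁ - y₂| / 4 ≤
      (B x₁ y₁ + B x₂ y₂) / 2) := by
  set m := p / 2 with hmdef
  have hm : 1 ≤ m := by rw [hmdef]; linarith
  set K := 4 * m with hKdef
  have hK : 4 * m ≤ K := le_refl _
  have hK0 : 0 < K := by linarith
  set N : ℝ → ℝ → ℝ := fun x z => (K * x ^ 2 + z ^ 2) ^ m - 2 * (z ^ 2) ^ m with hN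
  have hpow : ∀ z : ℝ, (z ^ 2) ^ m = |z| ^ p := by
    intro z
    rw [← sq_abs, ← Real.rpow_natCast, ← Real.rpow_mul (abs_nonneg z)]
    congr 1
    rw [hmdef]; push_cast; ring
  obtain ⟨δ, hδ0, hδ⟩ : ∃ δ : ℝ, 0 < δ ∧ (1 + δ) ^ m ≤ 3 / 2 := by
    have hc : Tendsto (fun δ : ℝ => (1 + δ) ^ m) (nhdsWithin 0 (Set.Ioi 0)) (nhds 1) := by
      have : Continuous (fun δ : ℝ => (1 + δ) ^ m) :=
        (continuous_const.add continuous_id).rpow_const (fun _ => Or.inr (by linarith))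
      have h := (this.tendsto 0).mono_left (nhdsWithin_le_nhds (s := Set.Ioi 0))
      simpa using h
    have h1 := hc.eventually (gt_mem_nhds (show (1:ℝ) < 3/2 by norm_num))
    obtain ⟨δ, h2, h3⟩ := (h1.and self_mem_nhdsWithin).exists
    exact ⟨δ, h3, h2.le⟩
  set C1 := (K + K / δ) ^ m with hC1
  have hC10 : 0 ≤ C1 := Real.rpow_nonneg (by positivity) _
  have hb1 : ∀ x z : ℝ, (K * x ^ 2 + z ^ 2) ^ m ≤ 3 / 2 * |z| ^ p + C1 * |x| ^ p := by
    intro x z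
    rw [← hpow, ← hpow]
    rcases le_total (K * x ^ 2) (δ * z ^ 2) with h | h
    · calc (K * x ^ 2 + z ^ 2) ^ m ≤ ((1 + δ) * z ^ 2) ^ m :=
            Real.rpow_le_rpow (by positivity) (by linarith) (by linarith)
        _ = (1 + δ) ^ m * (z ^ 2) ^ m := Real.mul_rpow (by positivity) (by positivity)
        _ ≤ 3 / 2 * (z ^ 2) ^ m := by gcongr
        _ ≤ _ := by
          have : 0 ≤ C1 * (x ^ 2) ^ m := by positivity
          linarith
    · calc (K * x ^ 2 + z ^ 2) ^ m ≤ ((K + K / δ) * x ^ 2) ^ m := by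
            refine Real.rpow_le_rpow (by positivity) ?_ (by linarith)
            have : z ^ 2 ≤ K / δ * x ^ 2 := by
              rw [div_mul_eq_mul_div, le_div_iff₀ hδ0]; linarith
            linarith
        _ = C1 * (x ^ 2) ^ m := Real.mul_rpow (by positivity) (by positivity)
        _ ≤ _ := by
          have : 0 ≤ 3 / 2 * (z ^ 2) ^ m := by positivity
          linarith
  have hconj : p.HolderConjugate (p / (p - 1)) :=
    (Real.holderConjugate_iff_eq_conjExponent (by linarith)).2 rfl
  have hq1 : 1 < p / (p - 1) := hconj.symm.lt
  have hb2 : ∀ y z : ℝ, y * z ≤ 1 / 2 * |z| ^ p + |y| ^ (p / (p - 1)) := by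
    intro y z
    have h1 := Real.young_inequality_of_nonneg (abs_nonneg z) (abs_nonneg y) hconj
    have h2 : y * z ≤ |z| * |y| := by rw [← abs_mul, mul_comm]; exact le_abs_self _
    have h3 : |z| ^ p / p ≤ 1 / 2 * |z| ^ p := by
      rw [div_eq_inv_mul]
      gcongr
      rw [one_div]; exact inv_anti₀ (by norm_num) hp
    have h4 : |y| ^ (p / (p - 1)) / (p / (p - 1)) ≤ |y| ^ (p / (p - 1)) :=
      div_le_self (by positivity) hq1.le
    linarith
  have hbd : ∀ x y z : ℝ, y * z + N x z ≤ (C1 + 1) * (|x| ^ p + |y| ^ (p / (p - 1))) := by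
    intro x y z
    have h1 := hb1 x z
    have h2 := hb2 y z
    have h3 : 0 ≤ |x| ^ p := by positivity
    have h4 : 0 ≤ C1 * |y| ^ (p / (p - 1)) := by positivity
    simp only [hN]
    rw [hpow]
    linarith
  have hBdd : ∀ x y : ℝ, BddAbove (Set.range fun z => y * z + N x z) := by
    intro x y
    refine ⟨(C1 + 1) * (|x| ^ p + |y| ^ (p / (p - 1))), ?_⟩
    rintro _ ⟨z, rfl⟩
    exact hbd x y z
  set B : ℝ → ℝ → ℝ := fun x y => ⨆ z, (y * z + N x z) with hB
  have hkey : ∀ k : ℝ, k ^ 2 = 1 → ∀ x₁ y₁ x₂ y₂ s t : ℝ, 0 ≤ s → 0 ≤ t → s + t = 1 →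
      B (s * x₁ + t * x₂) (s * y₁ + t * y₂) - k * (s * x₁ + t * x₂) * (s * y₁ + t * y₂) ≤
      s * (B x₁ y₁ - k * x₁ * y₁) + t * (B x₂ y₂ - k * x₂ * y₂) := by
    intro k hk x₁ y₁ x₂ y₂ s t hs ht hst
    rw [sub_le_iff_le_add]
    refine ciSup_le fun z => ?_
    have h1 := psi_conv m (z - k * (s * x₁ + t * x₂)) k K hm hk hK x₁ x₂ s t hs ht hst
    set ζ := z - k * (s * x₁ + t * x₂) with hζ
    have h2 : y₁ * (ζ + k * x₁) + N x₁ (ζ + k * x₁) ≤ B x₁ y₁ := le_ciSup (hBdd x₁ y₁) _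
    have h3 : y₂ * (ζ + k * x₂) + N x₂ (ζ + k * x₂) ≤ B x₂ y₂ := le_ciSup (hBdd x₂ y₂) _
    have hz : z = ζ + k * (s * x₁ + t * x₂) := by rw [hζ]; ring
    have h2' := mul_le_mul_of_nonneg_left h2 hs
    have h3' := mul_le_mul_of_nonneg_left h3 ht
    simp only [hN] at h2' h3' ⊢
    rw [hz]
    linarith
  have hconv : ConvexOn ℝ Set.univ (fun z : ℝ × ℝ => B z.1 z.2) := by
    refine ⟨convex_univ, ?_⟩
    rintro ⟨x₁, y₁⟩ - ⟨x₂, y₂⟩ - s t hs ht hst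
    have h1 := hkey 1 (by norm_num) x₁ y₁ x₂ y₂ s t hs ht hst
    have h2 := hkey (-1) (by norm_num) x₁ y₁ x₂ y₂ s t hs ht hst
    simp only [Prod.smul_mk, Prod.mk_add_mk, smul_eq_mul]
    linarith
  refine ⟨B, C1 + 1, by positivity, hconv.locallyLipschitz.continuous, ?_, ?_, ?_⟩
  · intro x y
    have h : y * 0 + N x 0 ≤ B x y := le_ciSup (hBdd x y) 0
    have h2 : 0 ≤ N x 0 := by
      simp only [hN]
      rw [hpow 0]
      simp only [abs_zero]
      rw [Real.zero_rpow (by linarith)]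
      have : 0 ≤ (K * x ^ 2 + 0 ^ 2) ^ m := by positivity
      linarith
    linarith
  · intro x y
    exact ciSup_le fun z => hbd x y z
  · intro x₁ y₁ x₂ y₂
    have h1 := hkey 1 (by norm_num) x₁ y₁ x₂ y₂ (1/2) (1/2) (by norm_num) (by norm_num) (by norm_num)
    have h2 := hkey (-1) (by norm_num) x₁ y₁ x₂ y₂ (1/2) (1/2) (by norm_num) (by norm_num) (by norm_num)
    have e1 : (1/2 * x₁ + 1/2 * x₂ : ℝ) = (x₁ + x₂)/2 := by ring
    have e2 : (1/2 * y₁ + 1/2 * y₂ : ℝ) = (y₁ + y₂)/2 := by ring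
    rw [e1, e2] at h1 h2
    rw [← abs_mul]
    rcases abs_cases ((x₁ - x₂) * (y₁ - y₂)) with ⟨h, _⟩ | ⟨h, _⟩ <;> rw [h] <;> nlinarith

def PP (e : R3) (F : R3 → ℝ) (x : R3) : ℝ := (F (x + e) + F (x - e)) / 2
def DD (e : R3) (F : R3 → ℝ) (x : R3) : ℝ := F (x + e) - F (x - e)

def CC (F : R3 → ℝ) : Prop := Continuous F ∧ HasCompactSupport F

lemma CC.integrable {F : R3 → ℝ} (h : CC F) : Integrable F :=
  h.1.integrable_of_hasCompactSupport h.2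

lemma CC.shift {F : R3 → ℝ} (h : CC F) (e : R3) : CC (fun x => F (x + e)) :=
  ⟨h.1.comp (continuous_id.add continuous_const), h.2.comp_homeomorph (Homeomorph.addRight e)⟩

lemma CC.shift' {F : R3 → ℝ} (h : CC F) (e : R3) : CC (fun x => F (x - e)) := by
  simpa [sub_eq_add_neg] using h.shift (-e)

lemma CC.comp2 {f g : R3 → ℝ} (hf : CC f) (hg : CC g) (B : ℝ → ℝ → ℝ)
    (hB : Continuous (fun z : ℝ × ℝ => B z.1 z.2)) (h0 : B 0 0 = 0) :
    CC (fun x => B (f x) (g x)) :=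
  ⟨hB.comp (hf.1.prodMk hg.1), hf.2.comp₂_left hg.2 h0⟩

lemma CC.mul {f g : R3 → ℝ} (hf : CC f) (hg : CC g) : CC (fun x => f x * g x) :=
  hf.comp2 hg (fun a b => a * b) (by fun_prop) (by simp)
lemma CC.add {f g : R3 → ℝ} (hf : CC f) (hg : CC g) : CC (fun x => f x + g x) :=
  hf.comp2 hg (fun a b => a + b) (by fun_prop) (by simp)
lemma CC.sub {f g : R3 → ℝ} (hf : CC f) (hg : CC g) : CC (fun x => f x - g x) :=
  hf.comp2 hg (fun a b => a - b) (by fun_prop) (by simp)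
lemma CC.PP {f : R3 → ℝ} (hf : CC f) (e : R3) : CC (PP e f) :=
  (hf.shift e).comp2 (hf.shift' e) (fun a b => (a + b) / 2) (by fun_prop) (by simp)
lemma CC.DD {f : R3 → ℝ} (hf : CC f) (e : R3) : CC (DD e f) := (hf.shift e).sub (hf.shift' e)
lemma CC.absmul {f g : R3 → ℝ} (hf : CC f) (hg : CC g) : CC (fun x => |f x| * |g x|) :=
  hf.comp2 hg (fun a b => |a| * |b|) (by fun_prop) (by simp)

lemma int_shift (F : R3 → ℝ) (e : R3) : ∫ x, F (x + e) = ∫ x, F x := integral_add_right_eq_self F e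
lemma int_shift' (F : R3 → ℝ) (e : R3) : ∫ x, F (x - e) = ∫ x, F x := integral_sub_right_eq_self F e

/-- Bellman-type functions. -/
def IsB (B : ℝ → ℝ → ℝ) : Prop := Continuous (fun z : ℝ × ℝ => B z.1 z.2) ∧ (∀ x y, 0 ≤ B x y) ∧
    B 0 0 = 0 ∧
    (∀ x₁ y₁ x₂ y₂, B ((x₁ + x₂) / 2) ((y₁ + y₂) / 2) + |x₁ - x₂| * |y₁ - y₂| / 4 ≤
      (B x₁ y₁ + B x₂ y₂) / 2)

lemma bstep {B : ℝ → ℝ → ℝ} (hB : IsB B) {f g : R3 → ℝ} (hf : CC f) (hg : CC g) (e : R3) :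
    (∫ x, B (PP e f x) (PP e g x)) + (∫ x, |DD e f x| * |DD e g x|) / 4 ≤ ∫ x, B (f x) (g x) := by
  obtain ⟨h1, h2, h3, h4⟩ := hB
  have hi := (hf.comp2 hg B h1 h3)
  have e1 : ∫ x, B (f x) (g x) =
      ∫ x, (B (f (x + e)) (g (x + e)) + B (f (x - e)) (g (x - e))) / 2 := by
    rw [integral_div, integral_add (hi.shift e).integrable (hi.shift' e).integrable,
      int_shift (fun x => B (f x) (g x)), int_shift' (fun x => B (f x) (g x))]
    ring
  have hd := ((hf.DD e).absmul (hg.DD e)).integrable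
  rw [e1, ← integral_div, ← integral_add ((hf.PP e).comp2 (hg.PP e) B h1 h3).integrable
    (hd.div_const 4)]
  refine integral_mono (((hf.PP e).comp2 (hg.PP e) B h1 h3).integrable.add (hd.div_const 4))
    (((hi.shift e).integrable.add (hi.shift' e).integrable).div_const 2) ?_
  intro x
  exact h4 _ _ _ _

def SS (a b c : R3) (F : R3 → ℝ) : R3 → ℝ := PP c (PP b (PP a F))

lemma CC.SS {f : R3 → ℝ} (hf : CC f) (a b c : R3) : CC (SS a b c f) := ((hf.PP a).PP b).PP c

lemma CC.SSn {f : R3 → ℝ} (hf : CC f) (a b c : R3) (n : ℕ) : CC ((_root_.SS a b c)^[n] f) := by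
  induction n with
  | zero => simpa
  | succ n ih => rw [Function.iterate_succ_apply']; exact ih.SS a b c

lemma bsum {B : ℝ → ℝ → ℝ} (hB : IsB B) {f g : R3 → ℝ} (hf : CC f) (hg : CC g) (a b c : R3) (N : ℕ) :
    ∑ n ∈ Finset.range N, (∫ x, |DD a ((SS a b c)^[n] f) x| * |DD a ((SS a b c)^[n] g) x|) / 4
      + (∫ x, B ((SS a b c)^[N] f x) ((SS a b c)^[N] g x)) ≤ ∫ x, B (f x) (g x) := by
  induction N with
  | zero => simp
  | succ N ih =>
    rw [Finset.sum_range_succ, Function.iterate_succ_apply', Function.iterate_succ_apply']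
    have hfN := hf.SSn a b c N
    have hgN := hg.SSn a b c N
    set F := (SS a b c)^[N] f
    set G := (SS a b c)^[N] g
    have s1 := bstep hB hfN hgN a
    have s2 := bstep hB (hfN.PP a) (hgN.PP a) b
    have s3 := bstep hB ((hfN.PP a).PP b) ((hgN.PP a).PP b) c
    have n2 : 0 ≤ ∫ x, |DD b (PP a F) x| * |DD b (PP a G) x| := integral_nonneg fun x => by positivity
    have n3 : 0 ≤ ∫ x, |DD c (PP b (PP a F)) x| * |DD c (PP b (PP a G)) x| :=
      integral_nonneg fun x => by positivity
    simp only [SS] at *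
    linarith

lemma PP_comm (a b : R3) (F : R3 → ℝ) : PP a (PP b F) = PP b (PP a F) := by
  funext x
  simp only [PP]
  have e1 : x + a + b = x + b + a := by abel
  have e2 : x + a - b = x - b + a := by abel
  have e3 : x - a + b = x + b - a := by abel
  have e4 : x - a - b = x - b - a := by abel
  rw [e1, e2, e3, e4]; ring

lemma PP_DD_comm (a b : R3) (F : R3 → ℝ) : PP a (DD b F) = DD b (PP a F) := by
  funext x
  simp only [PP, DD]
  have e1 : x + a + b = x + b + a := by abel
  have e2 : x + a - b = x - b + a := by abel
  have e3 : x - a + b = x + b - a := by abel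
  have e4 : x - a - b = x - b - a := by abel
  rw [e1, e2, e3, e4]; ring

lemma PP_symm {f g : R3 → ℝ} (hf : CC f) (hg : CC g) (e : R3) :
    ∫ x, PP e f x * g x = ∫ x, f x * PP e g x := by
  have h1 : ∫ x, f (x + e) * g x = ∫ x, f x * g (x - e) := by
    rw [← int_shift' (fun x => f (x + e) * g x) e]; simp
  have h2 : ∫ x, f (x - e) * g x = ∫ x, f x * g (x + e) := by
    rw [← int_shift (fun x => f (x - e) * g x) e]; simp
  have e1 : ∀ x, PP e f x * g x = (f (x + e) * g x + f (x - e) * g x) / 2 := fun x => by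
    simp only [PP]; ring
  have e2 : ∀ x, f x * PP e g x = (f x * g (x - e) + f x * g (x + e)) / 2 := fun x => by
    simp only [PP]; ring
  simp_rw [e1, e2]
  rw [integral_div, integral_div, integral_add, integral_add, h1, h2]
  · exact (hf.mul (hg.shift' e)).integrable
  · exact (hf.mul (hg.shift e)).integrable
  · exact ((hf.shift e).mul hg).integrable
  · exact ((hf.shift' e).mul hg).integrable

lemma DD_anti {f g : R3 → ℝ} (hf : CC f) (hg : CC g) (e : R3) :
    ∫ x, DD e f x * g x = - ∫ x, f x * DD e g x := by
  have h1 : ∫ x, f (x + e) * g x = ∫ x, f x * g (x - e) := by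
    rw [← int_shift' (fun x => f (x + e) * g x) e]; simp
  have h2 : ∫ x, f (x - e) * g x = ∫ x, f x * g (x + e) := by
    rw [← int_shift (fun x => f (x - e) * g x) e]; simp
  have e1 : ∀ x, DD e f x * g x = (f (x + e) * g x - f (x - e) * g x) := fun x => by
    simp only [DD]; ring
  have e2 : ∀ x, f x * DD e g x = (f x * g (x + e) - f x * g (x - e)) := fun x => by
    simp only [DD]; ring
  simp_rw [e1, e2]
  rw [integral_sub, integral_sub, h1, h2]
  · ring
  · exact (hf.mul (hg.shift e)).integrable
  · exact (hf.mul (hg.shift' e)).integrable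
  · exact ((hf.shift e).mul hg).integrable
  · exact ((hf.shift' e).mul hg).integrable

lemma SS_DD_comm (a b c e : R3) (F : R3 → ℝ) : SS a b c (DD e F) = DD e (SS a b c F) := by
  simp only [SS, PP_DD_comm]

lemma SS_symm {f g : R3 → ℝ} (hf : CC f) (hg : CC g) (a b c : R3) :
    ∫ x, SS a b c f x * g x = ∫ x, f x * SS a b c g x := by
  simp only [SS]
  rw [PP_symm ((hf.PP a).PP b) hg, PP_symm (hf.PP a) (hg.PP c), PP_symm hf ((hg.PP c).PP b)]
  have : PP a (PP b (PP c g)) = PP c (PP b (PP a g)) := by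
    rw [PP_comm b c, PP_comm a c, PP_comm a b]
  rw [this]

lemma SS_sub (a b c : R3) (F G : R3 → ℝ) :
    SS a b c (fun x => F x - G x) = fun x => SS a b c F x - SS a b c G x := by
  funext x; simp only [SS, PP]; ring

lemma SSn_sub (a b c : R3) (F G : R3 → ℝ) (n : ℕ) :
    (SS a b c)^[n] (fun x => F x - G x) = fun x => (SS a b c)^[n] F x - (SS a b c)^[n] G x := by
  induction n with
  | zero => rfl
  | succ n ih => rw [Function.iterate_succ_apply', ih, SS_sub, Function.iterate_succ_apply',
      Function.iterate_succ_apply']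

lemma isB_quad : IsB (fun x y => (x ^ 2 + y ^ 2) / 2) := by
  refine ⟨by fun_prop, fun x y => by positivity, by simp, ?_⟩
  intro x₁ y₁ x₂ y₂
  rw [← abs_mul]
  rcases abs_cases ((x₁ - x₂) * (y₁ - y₂)) with ⟨h, _⟩ | ⟨h, _⟩ <;> rw [h] <;>
    nlinarith [sq_nonneg (x₁ - x₂ - (y₁ - y₂)), sq_nonneg (x₁ - x₂ + (y₁ - y₂))]

lemma abs_int_le {f g : R3 → ℝ} : |∫ x, f x * g x| ≤ ∫ x, |f x| * |g x| := by
  simpa [abs_mul] using abs_integral_le_integral_abs (f := fun x => f x * g x) (μ := volume)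

lemma tele {f g : R3 → ℝ} (hf : CC f) (hg : CC g) (a b c : R3) (N : ℕ) :
    ∫ x, DD a f x * DD a g x = ∑ n ∈ Finset.range N,
      (∫ x, DD a ((SS a b c)^[n] (fun x => f x - SS a b c (SS a b c f) x)) x
        * DD a ((SS a b c)^[n] g) x)
      + ∫ x, DD a ((SS a b c)^[N] f) x * DD a ((SS a b c)^[N] g) x := by
  induction N with
  | zero => simp
  | succ N ih =>
    rw [ih, Finset.sum_range_succ, add_assoc]
    congr 1
    rw [Function.iterate_succ_apply', Function.iterate_succ_apply', SSn_sub]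
    have hfN := hf.SSn a b c N
    have hgN := hg.SSn a b c N
    have e0 : (SS a b c)^[N] (SS a b c (SS a b c f)) = SS a b c (SS a b c ((SS a b c)^[N] f)) := by
      rw [← Function.iterate_succ_apply, ← Function.iterate_succ_apply,
        Function.iterate_succ_apply', Function.iterate_succ_apply']
    rw [e0]
    set F := (SS a b c)^[N] f
    set G := (SS a b c)^[N] g
    have e1 : ∫ x, DD a (SS a b c F) x * DD a (SS a b c G) x =
        ∫ x, DD a (SS a b c (SS a b c F)) x * DD a G x := by
      rw [← SS_DD_comm a b c a G, ← SS_symm ((hfN.SS a b c).DD a) (hgN.DD a), SS_DD_comm]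
    rw [e1, ← integral_add]
    · congr 1; funext x; simp only [DD]; ring
    · exact ((hfN.sub ((hfN.SS a b c).SS a b c)).DD a).mul (hgN.DD a) |>.integrable
    · exact (((hfN.SS a b c).SS a b c).DD a).mul (hgN.DD a) |>.integrable

lemma main_h {B : ℝ → ℝ → ℝ} (hB : IsB B) {f g : R3 → ℝ} (hf : CC f) (hg : CC g) (a b c : R3) :
    |∫ x, DD a (DD a f) x * g x| ≤ 4 * ∫ x, B (f x - SS a b c (SS a b c f) x) (g x) := by
  rw [DD_anti (hf.DD a) hg, abs_neg]
  set h : R3 → ℝ := fun x => f x - SS a b c (SS a b c f) x with hh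
  have hhc : CC h := hf.sub ((hf.SS a b c).SS a b c)
  have hlim : Tendsto (fun N => ∫ x, DD a ((SS a b c)^[N] f) x * DD a ((SS a b c)^[N] g) x)
      atTop (nhds 0) := by
    have hs : Summable (fun n => (∫ x, |DD a ((SS a b c)^[n] f) x| * |DD a ((SS a b c)^[n] g) x|) / 4) := by
      refine summable_of_sum_range_le (c := ∫ x, ((f x) ^ 2 + (g x) ^ 2) / 2) ?_ ?_
      · intro n
        have : 0 ≤ ∫ x, |DD a ((SS a b c)^[n] f) x| * |DD a ((SS a b c)^[n] g) x| :=
          integral_nonneg fun x => by positivity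
        positivity
      · intro N
        have := bsum isB_quad hf hg a b c N
        have h2 : 0 ≤ ∫ x, ((((SS a b c)^[N] f x) ^ 2 + ((SS a b c)^[N] g x) ^ 2)) / 2 :=
          integral_nonneg fun x => by positivity
        linarith
    have h3 := (hs.tendsto_atTop_zero).const_mul 4
    rw [mul_zero] at h3
    refine squeeze_zero_norm (fun n => ?_) h3
    rw [Real.norm_eq_abs]
    refine abs_int_le.trans (le_of_eq ?_)
    ring
  have hle : ∀ N, |∫ x, DD a f x * DD a g x| ≤ 4 * (∫ x, B (h x) (g x))
      + |∫ x, DD a ((SS a b c)^[N] f) x * DD a ((SS a b c)^[N] g) x| := by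
    intro N
    rw [tele hf hg a b c N]
    refine (abs_add_le _ _).trans (add_le_add_left ?_ _)
    refine (Finset.abs_sum_le_sum_abs _ _).trans ?_
    have h1 := bsum hB hhc hg a b c N
    have h2 : 0 ≤ ∫ x, B ((SS a b c)^[N] h x) ((SS a b c)^[N] g x) :=
      integral_nonneg fun x => hB.2.1 _ _
    have h3 : ∑ n ∈ Finset.range N, |∫ x, DD a ((SS a b c)^[n] h) x * DD a ((SS a b c)^[n] g) x| ≤
        4 * ∑ n ∈ Finset.range N, (∫ x, |DD a ((SS a b c)^[n] h) x| * |DD a ((SS a b c)^[n] g) x|) / 4 := by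
      rw [Finset.mul_sum]
      refine Finset.sum_le_sum fun n _ => abs_int_le.trans (le_of_eq ?_)
      ring
    linarith
  have h4 := (hlim.abs.const_add (4 * (∫ x, B (h x) (g x))))
  rw [abs_zero, add_zero] at h4
  exact ge_of_tendsto' h4 hle

abbrev Sm (F : R3 → ℝ) : Prop := ContDiff ℝ (⊤ : ℕ∞) F

def dv (b : R3) (F : R3 → ℝ) (x : R3) : ℝ := fderiv ℝ F x b

lemma Sm.dv {F : R3 → ℝ} (h : Sm F) (b : R3) : Sm (dv b F) := by
  have h1 : ContDiff ℝ (⊤ : ℕ∞) (fderiv ℝ F) := h.fderiv_right (m := (⊤ : ℕ∞)) (by simp)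
  exact h1.clm_apply contDiff_const

lemma Sm.diff {F : R3 → ℝ} (h : Sm F) : Differentiable ℝ F := h.differentiable (by simp)

lemma hcs_dv {F : R3 → ℝ} (h : HasCompactSupport F) (b : R3) : HasCompactSupport (dv b F) :=
  h.fderiv_apply (𝕜 := ℝ) b

lemma Sm.cc {F : R3 → ℝ} (h : Sm F) (hc : HasCompactSupport F) : CC F := ⟨h.continuous, hc⟩

lemma CC.bdd {F : R3 → ℝ} (h : CC F) : ∃ M, 0 ≤ M ∧ ∀ x, |F x| ≤ M := by
  obtain ⟨C, hC⟩ := h.2.exists_bound_of_continuous h.1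
  exact ⟨|C|, abs_nonneg _, fun x => (hC x).trans (le_abs_self C)⟩

lemma CC.ball {F : R3 → ℝ} (h : CC F) : ∃ r, 0 < r ∧ ∀ x, r ≤ ‖x‖ → F x = 0 := by
  obtain ⟨r, hr⟩ := h.2.isCompact.isBounded.subset_ball (0 : R3)
  refine ⟨max r 1, by positivity, fun x hx => ?_⟩
  by_contra hne
  have := hr (subset_tsupport _ (Function.mem_support.2 hne))
  rw [mem_ball_zero_iff] at this
  exact absurd (le_max_left r 1) (by linarith)

lemma hasDerivAt_line {F : R3 → ℝ} (h : Sm F) (x b : R3) (s : ℝ) :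
    HasDerivAt (fun s : ℝ => F (x + s • b)) (dv b F (x + s • b)) s := by
  have h1 : HasFDerivAt F (fderiv ℝ F (x + s • b)) (x + s • b) := (h.diff _).hasFDerivAt
  have h2 : HasDerivAt (fun s : ℝ => x + s • b) b s := by
    simpa using ((hasDerivAt_id s).smul_const b).const_add x
  exact h1.comp_hasDerivAt s h2

lemma second_diff {F : R3 → ℝ} (h : Sm F) (x b : R3) (t : ℝ) (ht : 0 < t) :
    ∃ ξ : ℝ, |ξ| ≤ t ∧ F (x + t • b) + F (x - t • b) - 2 * F x = t ^ 2 * dv b (dv b F) (x + ξ • b) := by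
  have hl : ∀ s : ℝ, HasDerivAt (fun s : ℝ => F (x + s • b) + F (x + s • (-b)))
      (dv b F (x + s • b) + dv (-b) F (x + s • (-b))) s := fun s =>
    (hasDerivAt_line h x b s).add (hasDerivAt_line h x (-b) s)
  obtain ⟨ξ, hξ, e⟩ := exists_ratio_hasDerivAt_eq_ratio_slope
    (fun s : ℝ => F (x + s • b) + F (x + s • (-b))) _ ht
    (fun s _ => (hl s).continuousAt.continuousWithinAt) (fun s _ => hl s)
    (fun s : ℝ => s ^ 2) (fun s => 2 * s) (by fun_prop)
    (fun s _ => by simpa using hasDerivAt_pow 2 s)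
  have hd : ∀ s : ℝ, HasDerivAt (fun s : ℝ => dv b F (x + s • b)) (dv b (dv b F) (x + s • b)) s :=
    fun s => hasDerivAt_line (h.dv b) x b s
  have hneg : -ξ < ξ := by linarith [hξ.1]
  obtain ⟨ζ, hζ, e2⟩ := exists_hasDerivAt_eq_slope (fun s : ℝ => dv b F (x + s • b)) _ hneg
    (fun s _ => (hd s).continuousAt.continuousWithinAt) (fun s _ => hd s)
  refine ⟨ζ, abs_le.2 ⟨by linarith [hζ.1, hξ.2], by linarith [hζ.2, hξ.2]⟩, ?_⟩
  have hξ0 : ξ ≠ 0 := hξ.1.ne'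
  have e3 : dv (-b) F (x + ξ • (-b)) = - dv b F (x + (-ξ) • b) := by
    simp [dv]
  rw [e3] at e
  have h5 : (ξ - -ξ) ≠ 0 := by linarith [hξ.1] |> fun h : 0 < ξ - -ξ => h.ne'
  rw [eq_div_iff h5] at e2
  simp only [zero_smul, add_zero, smul_neg, ← sub_eq_add_neg, sub_zero] at e
  have : (2 * ξ) * (F (x + t • b) + F (x - t • b) - 2 * F x) =
      (2 * ξ) * (t ^ 2 * dv b (dv b F) (x + ζ • b)) := by
    linear_combination -e - t ^ 2 * e2
  exact mul_left_cancel₀ (by simpa using hξ0) this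

def CV (F : ℕ → R3 → ℝ) (L : R3 → ℝ) : Prop :=
  ∀ (y : ℕ → R3) (x : R3), Tendsto y atTop (nhds x) → Tendsto (fun n => F n (y n)) atTop (nhds (L x))

lemma CV.PP {F : ℕ → R3 → ℝ} {L : R3 → ℝ} (h : CV F L) {e : ℕ → R3} (he : Tendsto e atTop (nhds 0)) :
    CV (fun n => PP (e n) (F n)) L := by
  intro y x hy
  have h1 := h (fun n => y n + e n) x (by simpa using hy.add he)
  have h2 := h (fun n => y n - e n) x (by simpa using hy.sub he)
  have := (h1.add h2).div_const 2
  simpa [_root_.PP] using this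

lemma cv_second {F : R3 → ℝ} (h : Sm F) (b : R3) {t : ℕ → ℝ} (ht : ∀ n, 0 < t n)
    (ht0 : Tendsto t atTop (nhds 0)) :
    CV (fun n x => (F (x + t n • b) + F (x - t n • b) - 2 * F x) / (t n) ^ 2) (dv b (dv b F)) := by
  intro y x hy
  choose ξ hξ e using fun n => second_diff h (y n) b (t n) (ht n)
  have h1 : Tendsto ξ atTop (nhds 0) := squeeze_zero_norm (fun n => hξ n) ht0
  have h2 : Tendsto (fun n => y n + ξ n • b) atTop (nhds x) := by
    simpa using hy.add (h1.smul_const b)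
  have h3 := (((h.dv b).dv b).continuous.tendsto x).comp h2
  refine h3.congr fun n => ?_
  have := (ht n).ne'
  simp only [Function.comp]
  rw [e n]; field_simp

/-- data for the iterated averages -/
def TT (F : R3 → ℝ) (h : ℕ → ℝ) (G : ℕ → R3 → ℝ) (L : R3 → ℝ) : Prop :=
  CV (fun n x => (G n x - F x) / (h n) ^ 2) L ∧
  (∃ M, 0 ≤ M ∧ ∀ n x, |(G n x - F x) / (h n) ^ 2| ≤ M) ∧
  (∃ r, ∀ n x, r ≤ ‖x‖ → G n x = 0)

lemma TT.step {F : R3 → ℝ} (hF : Sm F) (hc : HasCompactSupport F) {h : ℕ → ℝ} (hh : ∀ n, 0 < h n)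
    (hh1 : ∀ n, h n ≤ 1)
    (hh0 : Tendsto h atTop (nhds 0)) {G : ℕ → R3 → ℝ} {L : R3 → ℝ} (T : TT F h G L) (b : R3) :
    TT F h (fun n => PP (h n • b) (G n)) (fun x => L x + dv b (dv b F) x / 2) := by
  obtain ⟨h1, ⟨M, hM0, hM⟩, r, hr⟩ := T
  have key : ∀ n x, (PP (h n • b) (G n) x - F x) / (h n) ^ 2 =
      PP (h n • b) (fun x => (G n x - F x) / (h n) ^ 2) x +
      ((F (x + h n • b) + F (x - h n • b) - 2 * F x) / (h n) ^ 2) / 2 := by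
    intro n x; simp only [_root_.PP]; have := (hh n).ne'; field_simp; ring
  refine ⟨?_, ?_, ?_⟩
  · simp_rw [key]
    have he : Tendsto (fun n => h n • b) atTop (nhds 0) := by simpa using hh0.smul_const b
    intro y x hy
    exact (h1.PP he y x hy).add ((cv_second hF b hh hh0 y x hy).div_const 2)
  · obtain ⟨M2, hM20, hM2⟩ := (((hF.dv b).dv b).cc (hcs_dv (hcs_dv hc b) b)).bdd
    refine ⟨M + M2 / 2, by positivity, fun n x => ?_⟩
    rw [key]
    refine (abs_add_le _ _).trans (add_le_add ?_ ?_)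
    · simp only [_root_.PP]
      rw [abs_div, abs_two]
      have := (abs_add_le ((G n (x + h n • b) - F (x + h n • b)) / (h n) ^ 2) ((G n (x - h n • b) - F (x - h n • b)) / (h n) ^ 2))
      have := hM n (x + h n • b)
      have := hM n (x - h n • b)
      linarith
    · obtain ⟨ξ, -, e⟩ := second_diff hF x b (h n) (hh n)
      rw [e, abs_div, abs_two]
      have := (hh n).ne'
      rw [mul_div_assoc, mul_comm, div_mul_cancel₀ _ (by positivity)]
      linarith [hM2 (x + ξ • b)]
  · refine ⟨r + ‖b‖, fun n x hx => ?_⟩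
    have hb : ‖h n • b‖ ≤ ‖b‖ := by
      rw [norm_smul, Real.norm_eq_abs, abs_of_pos (hh n)]
      exact mul_le_of_le_one_left (norm_nonneg _) (hh1 n)
    have h3 : r ≤ ‖x + h n • b‖ := by
      have := norm_sub_le (x + h n • b) (h n • b); simp at this; linarith
    have h4 : r ≤ ‖x - h n • b‖ := by
      have := norm_add_le (x - h n • b) (h n • b); simp at this; linarith
    simp [_root_.PP, hr n _ h3, hr n _ h4]

lemma cz_lim {B : ℝ → ℝ → ℝ} (hB : IsB B) {F g : R3 → ℝ} (hF : Sm F) (hc : HasCompactSupport F)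
    (hg : CC g) (a b c : R3) :
    |∫ x, dv a (dv a F) x * g x| ≤
      ∫ x, B (-(dv a (dv a F) x + dv b (dv b F) x + dv c (dv c F) x)) (g x) := by
  set h : ℕ → ℝ := fun n => 1 / ((n : ℝ) + 1) with hhdef
  have hh : ∀ n, 0 < h n := fun n => by positivity
  have hh1 : ∀ n, h n ≤ 1 := fun n => by
    simp only [hhdef]; rw [div_le_one (by positivity)]; linarith [(Nat.cast_nonneg n : (0:ℝ) ≤ n)]
  have hh0 : Tendsto h atTop (nhds 0) := tendsto_one_div_add_atTop_nhds_zero_nat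
  have hFc := hF.cc hc
  have T0 : TT F h (fun _ => F) (fun _ => 0) := by
    refine ⟨fun y x hy => by simp, ⟨0, le_rfl, by simp⟩, ?_⟩
    obtain ⟨r, -, hr⟩ := hFc.ball
    exact ⟨r, fun _ => hr⟩
  have T := (((((T0.step hF hc hh hh1 hh0 a).step hF hc hh hh1 hh0 b).step hF hc hh hh1 hh0 c).step
    hF hc hh hh1 hh0 a).step hF hc hh hh1 hh0 b).step hF hc hh hh1 hh0 c
  obtain ⟨T1, ⟨M, hM0, hM⟩, r, hr⟩ := T
  obtain ⟨r0, hr0p, hr0⟩ := hFc.ball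
  obtain ⟨rg, hrgp, hrg⟩ := hg.ball
  obtain ⟨Mg, hMg0, hMg⟩ := hg.bdd
  have main := fun n => main_h hB (f := fun x => F x / (h n) ^ 2) (g := g)
    (hFc.comp2 hFc (fun a _ => a / (h n) ^ 2) (by fun_prop) (by simp)) hg (h n • a) (h n • b) (h n • c)
  have e1 : ∀ n x, DD (h n • a) (DD (h n • a) (fun x => F x / (h n) ^ 2)) x =
      4 * ((F (x + (2 * h n) • a) + F (x - (2 * h n) • a) - 2 * F x) / (2 * h n) ^ 2) := by
    intro n x
    simp only [DD]
    rw [show x + h n • a + h n • a = x + (2 * h n) • a by module,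
      show x + h n • a - h n • a = x by module, show x - h n • a + h n • a = x by module,
      show x - h n • a - h n • a = x - (2 * h n) • a by module]
    have := (hh n).ne'
    field_simp; ring
  have e2 : ∀ n x, F x / (h n) ^ 2 - SS (h n • a) (h n • b) (h n • c)
      (SS (h n • a) (h n • b) (h n • c) (fun x => F x / (h n) ^ 2)) x =
      - ((SS (h n • a) (h n • b) (h n • c) (SS (h n • a) (h n • b) (h n • c) F) x - F x) / (h n) ^ 2) := by
    intro n x
    have hP : ∀ (e : R3) (k : ℝ) (G : R3 → ℝ), PP e (fun x => G x / k) = fun x => PP e G x / k := by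
      intro e k G; funext x; simp only [PP]; ring
    simp only [SS, hP]
    ring
  simp_rw [e1, e2] at main
  change ∀ n, _ ≤ 4 * ∫ x, B (-((SS (h n • a) (h n • b) (h n • c) (SS (h n • a) (h n • b) (h n • c) F) x - F x) / (h n) ^ 2)) (g x) at main
  -- left limit
  have h2 : ∀ n, 0 < 2 * h n := fun n => by linarith [hh n]
  have h20 : Tendsto (fun n => 2 * h n) atTop (nhds 0) := by simpa using hh0.const_mul 2
  obtain ⟨M2, hM20, hM2⟩ := (((hF.dv a).dv a).cc (hcs_dv (hcs_dv hc a) a)).bdd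
  have L1 : Tendsto (fun n => ∫ x, 4 * ((F (x + (2 * h n) • a) + F (x - (2 * h n) • a) - 2 * F x)
      / (2 * h n) ^ 2) * g x) atTop (nhds (∫ x, 4 * dv a (dv a F) x * g x)) := by
    refine tendsto_integral_of_dominated_convergence (fun x => 4 * M2 * |g x|) ?_ ?_ ?_ ?_
    · intro n
      refine Continuous.aestronglyMeasurable ?_
      have := hF.continuous; have := hg.1
      fun_prop
    · exact (hg.integrable.abs.const_mul _)
    · intro n
      refine Eventually.of_forall fun x => ?_
      obtain ⟨ξ, -, e⟩ := second_diff hF x a (2 * h n) (h2 n)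
      rw [Real.norm_eq_abs, abs_mul, abs_mul, e]
      have := (h2 n).ne'
      rw [mul_div_assoc, mul_comm ((2 * h n) ^ 2), div_mul_cancel₀ _ (by positivity)]
      rw [abs_of_pos (by norm_num : (0:ℝ) < 4)]
      gcongr
      exact hM2 _
    · refine Eventually.of_forall fun x => ?_
      exact ((cv_second hF a h2 h20 (fun _ => x) x tendsto_const_nhds).const_mul 4).mul_const _
  obtain ⟨MB, hMB⟩ : ∃ MB, ∀ s t, |s| ≤ M → |t| ≤ Mg → B s t ≤ MB := by
    have hK : IsCompact (Set.Icc (-M) M ×ˢ Set.Icc (-Mg) Mg) := isCompact_Icc.prod isCompact_Icc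
    obtain ⟨C, hC⟩ := hK.exists_bound_of_continuousOn hB.1.continuousOn
    refine ⟨C, fun s t hs ht => (le_abs_self _).trans (hC (s, t) ⟨abs_le.1 hs, abs_le.1 ht⟩)⟩
  set ρ := max (max r r0) rg with hρ
  have L2 : Tendsto (fun n => ∫ x, B (-((SS (h n • a) (h n • b) (h n • c)
      (SS (h n • a) (h n • b) (h n • c) F) x - F x) / (h n) ^ 2)) (g x)) atTop
      (nhds (∫ x, B (-(dv a (dv a F) x + dv b (dv b F) x + dv c (dv c F) x)) (g x))) := by
    refine tendsto_integral_of_dominated_convergence ((closedBall (0:R3) ρ).indicator (fun _ => MB)) ?_ ?_ ?_ ?_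
    · intro n
      refine Continuous.aestronglyMeasurable ?_
      have h3 := ((hFc.SS (h n • a) (h n • b) (h n • c)).SS (h n • a) (h n • b) (h n • c)).1
      exact hB.1.comp ((((h3.sub hF.continuous).div_const ((h n) ^ 2)).neg).prodMk hg.1)
    · rw [integrable_indicator_iff measurableSet_closedBall]
      exact integrableOn_const (measure_closedBall_lt_top.ne)
    · intro n
      refine Eventually.of_forall fun x => ?_
      rw [Real.norm_eq_abs, abs_of_nonneg (hB.2.1 _ _)]
      by_cases hx : x ∈ closedBall (0:R3) ρ
      · rw [Set.indicator_of_mem hx]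
        refine hMB _ _ ?_ (hMg x)
        rw [abs_neg]; exact hM n x
      · rw [Set.indicator_of_notMem hx]
        rw [mem_closedBall_zero_iff, not_le] at hx
        have h5 := hr n x (((le_max_left r r0).trans (le_max_left _ rg)).trans hx.le)
        have h6 := hr0 x (((le_max_right r r0).trans (le_max_left _ rg)).trans hx.le)
        have h7 := hrg x ((le_max_right _ rg).trans hx.le)
        change SS (h n • a) (h n • b) (h n • c) (SS (h n • a) (h n • b) (h n • c) F) x = 0 at h5
        rw [h5, h6, h7]; simp [hB.2.2.1]
    · refine Eventually.of_forall fun x => ?_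
      have h5 := T1 (fun _ => x) x tendsto_const_nhds
      have h6 : Tendsto (fun n => (-((SS (h n • a) (h n • b) (h n • c)
      (SS (h n • a) (h n • b) (h n • c) F) x - F x) / (h n) ^ 2), g x)) atTop
        (nhds (-(dv a (dv a F) x + dv b (dv b F) x + dv c (dv c F) x), g x)) := by
        refine (Tendsto.prodMk_nhds ?_ tendsto_const_nhds)
        have e : -(dv a (dv a F) x + dv b (dv b F) x + dv c (dv c F) x) = -(0 + dv a (dv a F) x / 2 + dv b (dv b F) x / 2 + dv c (dv c F) x / 2 + dv a (dv a F) x / 2 + dv b (dv b F) x / 2 + dv c (dv c F) x / 2) := by ring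
        rw [e]
        exact h5.neg
      exact (hB.1.tendsto _).comp h6
  have L3 := le_of_tendsto_of_tendsto' L1.abs (L2.const_mul 4) main
  have e4 : ∫ x, 4 * dv a (dv a F) x * g x = 4 * ∫ x, dv a (dv a F) x * g x := by
    rw [← integral_const_mul]; congr 1; funext x; ring
  rw [e4, abs_mul, abs_of_pos (by norm_num : (0:ℝ) < 4)] at L3
  linarith

lemma CC.rpow {F : R3 → ℝ} (h : CC F) {p : ℝ} (hp : 0 < p) : CC (fun x => |F x| ^ p) :=
  h.comp2 h (fun a _ => |a| ^ p)
    ((continuous_abs.comp continuous_fst).rpow_const fun _ => Or.inr hp.le)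
    (by simp [Real.zero_rpow hp.ne'])

lemma cz_p (p : ℝ) (hp : 2 ≤ p) : ∃ C, 0 < C ∧ ∀ F : R3 → ℝ, Sm F → HasCompactSupport F → ∀ a b c : R3,
    ∫ x, |dv a (dv a F) x| ^ p ≤ C * ∫ x, |dv a (dv a F) x + dv b (dv b F) x + dv c (dv c F) x| ^ p := by
  obtain ⟨B, C, hC, h1, h2, h3, h4⟩ := bellman p hp
  have hp0 : 0 < p := by linarith
  have hp1 : 0 < p - 1 := by linarith
  have hpp : 0 < p / (p - 1) := by positivity
  have hB : IsB B := by
    refine ⟨h1, h2, le_antisymm ?_ (h2 _ _), h4⟩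
    refine (h3 0 0).trans (le_of_eq ?_)
    rw [abs_zero, Real.zero_rpow hp0.ne', Real.zero_rpow hpp.ne']; simp
  set ε : ℝ := (1 / (2 * C)) ^ (p - 1) with hε
  have hε0 : 0 < ε := by positivity
  have hεp : C * ε ^ (p / (p - 1)) = ε / 2 := by
    have e1 : ε ^ (p / (p - 1)) = (1 / (2 * C)) ^ p := by
      rw [hε, ← Real.rpow_mul (by positivity)]; congr 1; field_simp
    have e2 : (1 / (2 * C)) ^ p = ε * (1 / (2 * C)) := by
      rw [hε, ← Real.rpow_add_one (by positivity)]; congr 1; ring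
    rw [e1, e2]; field_simp
  refine ⟨C / (ε / 2), by positivity, fun F hF hc a b c => ?_⟩
  set w := dv a (dv a F) with hw
  have hwc : CC w := (((hF.dv a).dv a).cc (hcs_dv (hcs_dv hc a) a))
  have hbc : CC (dv b (dv b F)) := (((hF.dv b).dv b).cc (hcs_dv (hcs_dv hc b) b))
  have hcc : CC (dv c (dv c F)) := (((hF.dv c).dv c).cc (hcs_dv (hcs_dv hc c) c))
  set s : R3 → ℝ := fun x => w x + dv b (dv b F) x + dv c (dv c F) x with hs
  have hsc : CC s := (hwc.add hbc).add hcc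
  set g : R3 → ℝ := fun x => ε * (|w x| ^ (p - 2) * w x) with hg
  have hgc : CC g := hwc.comp2 hwc (fun t _ => ε * (|t| ^ (p - 2) * t))
    (continuous_const.mul (((continuous_abs.comp continuous_fst).rpow_const fun _ => Or.inr (by linarith)).mul
      continuous_fst)) (by simp)
  have habs : ∀ x, |w x| ^ (p - 2) * w x * w x = |w x| ^ p := by
    intro x
    rcases eq_or_ne (w x) 0 with h | h
    · rw [h]; simp [Real.zero_rpow hp0.ne']
    · have h' : 0 < |w x| := abs_pos.2 h
      rw [mul_assoc, ← abs_mul_abs_self (w x), ← pow_two, ← Real.rpow_natCast, ← Real.rpow_add h']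
      congr 1; push_cast; ring
  have hgabs : ∀ x, |g x| ^ (p / (p - 1)) = ε ^ (p / (p - 1)) * |w x| ^ p := by
    intro x
    have e1 : |g x| = ε * |w x| ^ (p - 1) := by
      rcases eq_or_ne (w x) 0 with h | h
      · simp [hg, h, Real.zero_rpow hp1.ne']
      · have h' : 0 < |w x| := abs_pos.2 h
        simp only [hg]
        rw [abs_mul, abs_of_pos hε0, abs_mul, abs_of_nonneg (by positivity : 0 ≤ |w x| ^ (p - 2)),
          ← Real.rpow_add_one h'.ne']
        congr 2; ring
    rw [e1, Real.mul_rpow hε0.le (by positivity), ← Real.rpow_mul (abs_nonneg _)]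
    congr 2; field_simp
  have key := cz_lim hB hF hc hgc a b c
  have eL : ∫ x, w x * g x = ε * ∫ x, |w x| ^ p := by
    rw [← integral_const_mul]; congr 1; funext x; rw [← habs x]; simp only [hg]; ring
  have hI0 : 0 ≤ ∫ x, |w x| ^ p := integral_nonneg fun x => by positivity
  rw [eL, abs_of_nonneg (by positivity)] at key
  have hwp := (hwc.rpow hp0).integrable
  have hsp := (hsc.rpow hp0).integrable
  have hR : ∫ x, B (-(w x + dv b (dv b F) x + dv c (dv c F) x)) (g x) ≤
      ∫ x, (C * |s x| ^ p + C * ε ^ (p / (p - 1)) * |w x| ^ p) := by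
    refine integral_mono ?_ ((hsp.const_mul C).add (hwp.const_mul _)) ?_
    · exact (CC.comp2 (f := fun x => - s x) (hsc.comp2 hsc (fun a _ => -a) (by fun_prop) (by simp)) hgc B h1 hB.2.2.1).integrable
    · intro x
      refine (h3 _ _).trans (le_of_eq ?_)
      rw [hgabs, abs_neg]; simp only [hs]; ring
  rw [integral_add (hsp.const_mul C) (hwp.const_mul _), integral_const_mul, integral_const_mul, hεp] at hR
  have h5 : ε / 2 * ∫ x, |w x| ^ p ≤ C * ∫ x, |s x| ^ p := by linarith
  rw [div_mul_eq_mul_div, le_div_iff₀ (by positivity)]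
  linarith

lemma dv_add (a b : R3) (F : R3 → ℝ) : dv (a + b) F = fun x => dv a F x + dv b F x := by
  funext x; simp [dv]
lemma dv_sub (a b : R3) (F : R3 → ℝ) : dv (a - b) F = fun x => dv a F x - dv b F x := by
  funext x; simp [dv]
lemma dv_smul (t : ℝ) (b : R3) (F : R3 → ℝ) : dv (t • b) F = fun x => t * dv b F x := by
  funext x; simp [dv]
lemma dv_fadd {F G : R3 → ℝ} (hF : Sm F) (hG : Sm G) (b : R3) : dv b (fun x => F x + G x) = fun x => dv b F x + dv b G x := by
  funext x; simp [dv, fderiv_fun_add (hF.diff x) (hG.diff x)]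
lemma dv_fsub {F G : R3 → ℝ} (hF : Sm F) (hG : Sm G) (b : R3) : dv b (fun x => F x - G x) = fun x => dv b F x - dv b G x := by
  funext x; simp [dv, fderiv_fun_sub (hF.diff x) (hG.diff x)]
lemma dv_fconst {F : R3 → ℝ} (hF : Sm F) (t : ℝ) (b : R3) : dv b (fun x => t * F x) = fun x => t * dv b F x := by
  funext x; simp [dv, fderiv_const_mul (hF.diff x)]
lemma dv_fmul {F G : R3 → ℝ} (hF : Sm F) (hG : Sm G) (b : R3) : dv b (fun x => F x * G x) = fun x => F x * dv b G x + G x * dv b F x := by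
  funext x; simp [dv, fderiv_fun_mul (hF.diff x) (hG.diff x)]

lemma dv_comm {F : R3 → ℝ} (hF : Sm F) (a b : R3) : dv a (dv b F) = dv b (dv a F) := by
  have h1 : ContDiff ℝ (⊤ : ℕ∞) (fderiv ℝ F) := hF.fderiv_right (m := (⊤ : ℕ∞)) (by simp)
  have key : ∀ a b x, dv a (dv b F) x = fderiv ℝ (fderiv ℝ F) x a b := by
    intro a b x
    have hd : DifferentiableAt ℝ (fderiv ℝ F) x := (h1.differentiable (by simp)) x
    have : dv b F = fun y => (fderiv ℝ F y) b := rfl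
    rw [this]
    simp only [dv]
    rw [fderiv_clm_apply hd (by fun_prop)]
    simp
  funext x
  rw [key, key]
  have := (hF.contDiffAt (x := x)).isSymmSndFDerivAt (by simp; exact WithTop.coe_le_coe.2 (le_top : (2:ℕ∞) ≤ ⊤))
  exact this a b

abbrev ee (i : Fin 3) : R3 := EuclideanSpace.single i 1

lemma pd_eq (F : R3 → ℝ) (i : Fin 3) : pd F i = dv (ee i) F := rfl

lemma lap_eq (F : R3 → ℝ) (x : R3) : lap F x = dv (ee 0) (dv (ee 0) F) x + dv (ee 1) (dv (ee 1) F) x +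
    dv (ee 2) (dv (ee 2) F) x := by
  simp [lap, Fin.sum_univ_three, pd_eq]

lemma cz (p : ℝ) (hp : 2 ≤ p) : ∃ C, 0 < C ∧ ∀ F : R3 → ℝ, Sm F → HasCompactSupport F → ∀ i j,
    ∫ x, |pd (pd F i) j x| ^ p ≤ C * ∫ x, |lap F x| ^ p := by
  obtain ⟨C, hC, h⟩ := cz_p p hp
  have hp0 : 0 < p := by linarith
  refine ⟨C + 2 * (C * 2 ^ p), by positivity, fun F hF hc i j => ?_⟩
  have hL0 : 0 ≤ ∫ x, |lap F x| ^ p := integral_nonneg fun x => by positivity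
  have hlap : ∀ i j k : Fin 3, i ≠ j → j ≠ k → i ≠ k → ∀ x, lap F x =
      dv (ee i) (dv (ee i) F) x + dv (ee j) (dv (ee j) F) x + dv (ee k) (dv (ee k) F) x := by
    intro i j k h1 h2 h3 x
    rw [lap_eq]
    fin_cases i <;> fin_cases j <;> fin_cases k <;> simp at h1 h2 h3 ⊢ <;> ring
  have diag : ∀ i j k : Fin 3, i ≠ j → j ≠ k → i ≠ k →
      ∫ x, |pd (pd F i) i x| ^ p ≤ (C + 2 * (C * 2 ^ p)) * ∫ x, |lap F x| ^ p := by
    intro i j k h1 h2 h3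
    have := h F hF hc (ee i) (ee j) (ee k)
    simp_rw [← hlap i j k h1 h2 h3] at this
    refine this.trans (mul_le_mul_of_nonneg_right ?_ hL0)
    have : (0:ℝ) ≤ 2 * (C * 2 ^ p) := by positivity
    linarith
  have off : ∀ i j k : Fin 3, i ≠ j → j ≠ k → i ≠ k →
      ∫ x, |pd (pd F i) j x| ^ p ≤ (C + 2 * (C * 2 ^ p)) * ∫ x, |lap F x| ^ p := by
    intro i j k h1 h2 h3
    have q1 := h F hF hc (ee i + ee j) (ee i - ee j) (√2 • ee k)
    have q2 := h F hF hc (ee i - ee j) (ee i + ee j) (√2 • ee k)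
    have cm : dv (ee j) (dv (ee i) F) = dv (ee i) (dv (ee j) F) := dv_comm hF _ _
    have s2 : √2 * √2 = (2:ℝ) := Real.mul_self_sqrt (by norm_num)
    have ep : ∀ x, dv (ee i + ee j) (dv (ee i + ee j) F) x = dv (ee i) (dv (ee i) F) x
        + 2 * dv (ee i) (dv (ee j) F) x + dv (ee j) (dv (ee j) F) x := by
      intro x
      rw [dv_add, dv_add, dv_fadd (hF.dv _) (hF.dv _), dv_fadd (hF.dv _) (hF.dv _), cm]; ring
    have em : ∀ x, dv (ee i - ee j) (dv (ee i - ee j) F) x = dv (ee i) (dv (ee i) F) x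
        - 2 * dv (ee i) (dv (ee j) F) x + dv (ee j) (dv (ee j) F) x := by
      intro x
      rw [dv_sub, dv_sub, dv_fsub (hF.dv _) (hF.dv _), dv_fsub (hF.dv _) (hF.dv _), cm]; ring
    have ek : ∀ x, dv (√2 • ee k) (dv (√2 • ee k) F) x = 2 * dv (ee k) (dv (ee k) F) x := by
      intro x
      rw [dv_smul, dv_smul, dv_fconst (hF.dv _)]
      linear_combination s2 * dv (ee k) (dv (ee k) F) x
    have hs1 : ∀ x, |dv (ee i + ee j) (dv (ee i + ee j) F) x + dv (ee i - ee j) (dv (ee i - ee j) F) x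
        + dv (√2 • ee k) (dv (√2 • ee k) F) x| ^ p = 2 ^ p * |lap F x| ^ p := by
      intro x
      rw [← Real.mul_rpow (by norm_num) (abs_nonneg _), ep, em, ek, hlap i j k h1 h2 h3]
      congr 1
      rw [← abs_two (α := ℝ), ← abs_mul, abs_two]; congr 1; ring
    have hs2 : ∀ x, |dv (ee i - ee j) (dv (ee i - ee j) F) x + dv (ee i + ee j) (dv (ee i + ee j) F) x
        + dv (√2 • ee k) (dv (√2 • ee k) F) x| ^ p = 2 ^ p * |lap F x| ^ p := by
      intro x
      rw [← hs1 x, add_comm (dv (ee i - ee j) _ x)]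
    simp_rw [hs1, integral_const_mul] at q1
    simp_rw [hs2, integral_const_mul] at q2
    have i1 := ((((hF.dv (ee i + ee j)).dv (ee i + ee j)).cc (hcs_dv (hcs_dv hc _) _)).rpow hp0).integrable
    have i2 := ((((hF.dv (ee i - ee j)).dv (ee i - ee j)).cc (hcs_dv (hcs_dv hc _) _)).rpow hp0).integrable
    have i3 := ((((hF.dv (ee i)).dv (ee j)).cc (hcs_dv (hcs_dv hc _) _)).rpow hp0).integrable
    have : ∫ x, |pd (pd F i) j x| ^ p ≤ ∫ x, (|dv (ee i + ee j) (dv (ee i + ee j) F) x| ^ p +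
        |dv (ee i - ee j) (dv (ee i - ee j) F) x| ^ p) := by
      refine integral_mono i3 (i1.add i2) fun x => ?_
      simp only
      have e5 : pd (pd F i) j x = (dv (ee i + ee j) (dv (ee i + ee j) F) x -
        dv (ee i - ee j) (dv (ee i - ee j) F) x) / 4 := by
        rw [ep, em, pd_eq, pd_eq, cm]; ring
      set A := dv (ee i + ee j) (dv (ee i + ee j) F) x
      set D := dv (ee i - ee j) (dv (ee i - ee j) F) x
      have h6 : |pd (pd F i) j x| ≤ max |A| |D| := by
        rw [e5, abs_div]
        have := abs_sub A D
        have := le_max_left |A| |D|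
        have := le_max_right |A| |D|
        have := abs_nonneg A
        rw [abs_of_pos (by norm_num : (0:ℝ) < 4)]
        linarith
      have h7 := Real.rpow_le_rpow (abs_nonneg _) h6 hp0.le
      have : 0 ≤ |A| ^ p := by positivity
      have : 0 ≤ |D| ^ p := by positivity
      rcases max_choice |A| |D| with h8 | h8 <;> rw [h8] at h7 <;> linarith
    rw [integral_add i1 i2] at this
    have : 0 ≤ C * ∫ x, |lap F x| ^ p := by positivity
    nlinarith
  have d01 : (0 : Fin 3) ≠ 1 := by decide
  have d02 : (0 : Fin 3) ≠ 2 := by decide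
  have d12 : (1 : Fin 3) ≠ 2 := by decide
  fin_cases i <;> fin_cases j
  · exact diag 0 1 2 d01 d12 d02
  · exact off 0 1 2 d01 d12 d02
  · exact off 0 2 1 d02 d12.symm d01
  · exact off 1 0 2 d01.symm d02 d12
  · exact diag 1 0 2 d01.symm d02 d12
  · exact off 1 2 0 d12 d02.symm d01.symm
  · exact off 2 0 1 d02.symm d01 d12.symm
  · exact off 2 1 0 d12.symm d01.symm d02.symm
  · exact diag 2 0 1 d02.symm d01 d12.symm

lemma ibp {F G : R3 → ℝ} (hF : Sm F) (hG : Sm G) (hc : HasCompactSupport F) (b : R3) :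
    ∫ x, F x * dv b G x = -∫ x, dv b F x * G x := by
  have c1 : HasCompactSupport (fun x => dv b F x * G x) := (hcs_dv hc b).mul_right
  have c2 : HasCompactSupport (fun x => F x * dv b G x) := hc.mul_right
  have c3 : HasCompactSupport (fun x => F x * G x) := hc.mul_right
  exact integral_mul_fderiv_eq_neg_fderiv_mul_of_integrable
    (((hF.dv b).continuous.mul hG.continuous).integrable_of_hasCompactSupport c1)
    ((hF.continuous.mul (hG.dv b).continuous).integrable_of_hasCompactSupport c2)
    ((hF.continuous.mul hG.continuous).integrable_of_hasCompactSupport c3)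
    (fun x _ => hF.diff x) (fun x _ => hG.diff x)

lemma ibp' {F G : R3 → ℝ} (hF : Sm F) (hG : Sm G) (hc : HasCompactSupport G) (b : R3) :
    ∫ x, F x * dv b G x = -∫ x, dv b F x * G x := by
  have := ibp hG hF hc b
  have e1 : ∫ x, F x * dv b G x = ∫ x, dv b G x * F x := by congr 1; funext x; ring
  have e2 : ∫ x, dv b F x * G x = ∫ x, G x * dv b F x := by congr 1; funext x; ring
  rw [e1, e2, this, neg_neg]

section Av
variable {Ω : Type} [MeasurableSpace Ω] {μ : Measure Ω} [IsFiniteMeasure μ] {K : Ω → ℝ} {Y : Ω → R3}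
  {E : Type} [NormedAddCommGroup E] [NormedSpace ℝ E]

def Av (μ : Measure Ω) (K : Ω → ℝ) (Y : Ω → R3) (F : R3 → E) (x : R3) : E := ∫ ω, K ω • F (x + Y ω) ∂μ

/-- kernel hypotheses -/
def KY (K : Ω → ℝ) (Y : Ω → R3) (M δ : ℝ) : Prop :=
  Measurable K ∧ Measurable Y ∧ (∀ ω, |K ω| ≤ M) ∧ (∀ ω, ‖Y ω‖ ≤ δ) ∧ 0 ≤ M ∧ 0 ≤ δ

lemma Av_meas {M δ : ℝ} (h : KY K Y M δ) {F : R3 → E} (hF : Continuous F) (x : R3) :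
    AEStronglyMeasurable (fun ω => K ω • F (x + Y ω)) μ := by
  refine h.1.aestronglyMeasurable.smul ?_
  exact hF.comp_aestronglyMeasurable (h.2.1.const_add x).aestronglyMeasurable

lemma Av_bound {F : R3 → E} (hF : Continuous F) (x : R3) (δ : ℝ) :
    ∃ C, 0 ≤ C ∧ ∀ y, ‖y - x‖ ≤ δ → ‖F y‖ ≤ C := by
  obtain ⟨C, hC⟩ := (isCompact_closedBall x δ).exists_bound_of_continuousOn hF.continuousOn
  refine ⟨|C|, abs_nonneg _, fun y hy => (hC y ?_).trans (le_abs_self _)⟩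
  rwa [mem_closedBall, dist_eq_norm]

lemma Av_int {M δ : ℝ} (h : KY K Y M δ) {F : R3 → E} (hF : Continuous F) (x : R3) :
    Integrable (fun ω => K ω • F (x + Y ω)) μ := by
  obtain ⟨C, hC0, hC⟩ := Av_bound hF x δ
  refine Integrable.of_bound (Av_meas h hF x) (M * C) (Eventually.of_forall fun ω => ?_)
  rw [norm_smul]
  exact mul_le_mul (h.2.2.1 ω) (hC _ (by simpa using h.2.2.2.1 ω)) (norm_nonneg _) h.2.2.2.2.1

lemma Av_hasFDerivAt {M δ : ℝ} (h : KY K Y M δ) {F : R3 → E} (hF : ContDiff ℝ 1 F) (x : R3) :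
    HasFDerivAt (Av μ K Y F) (Av μ K Y (fderiv ℝ F) x) x := by
  have hF' : Continuous (fderiv ℝ F) := hF.continuous_fderiv (by simp)
  obtain ⟨C, hC0, hC⟩ := Av_bound hF' x (1 + δ)
  refine hasFDerivAt_integral_of_dominated_of_fderiv_le (bound := fun _ => M * C)
    (F' := fun x ω => K ω • fderiv ℝ F (x + Y ω)) (ball_mem_nhds x one_pos)
    (Eventually.of_forall fun y => Av_meas h hF.continuous y) (Av_int h hF.continuous x)
    (Av_meas h hF' x) ?_ (integrable_const _) ?_
  · refine Eventually.of_forall fun ω y hy => ?_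
    rw [norm_smul]
    refine mul_le_mul (h.2.2.1 ω) (hC _ ?_) (norm_nonneg _) h.2.2.2.2.1
    rw [mem_ball, dist_eq_norm] at hy
    have := norm_add_le (y - x) (Y ω)
    have e : y + Y ω - x = y - x + Y ω := by abel
    rw [e]
    linarith [h.2.2.2.1 ω]
  · refine Eventually.of_forall fun ω y _ => ?_
    have h1 : HasFDerivAt F (fderiv ℝ F (y + Y ω)) (y + Y ω) :=
      (hF.differentiable (by simp) _).hasFDerivAt
    have h2 : HasFDerivAt (fun y => F (y + Y ω)) (fderiv ℝ F (y + Y ω)) y := by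
      exact (hasFDerivAt_comp_add_right (Y ω)).2 h1
    exact h2.const_smul (K ω)

lemma Av_contDiff {M δ : ℝ} (h : KY K Y M δ) (n : ℕ) : ∀ (E : Type) [NormedAddCommGroup E] [NormedSpace ℝ E]
    (F : R3 → E), ContDiff ℝ (⊤ : ℕ∞) F → ContDiff ℝ n (Av μ K Y F) := by
  induction n with
  | zero =>
    intro E _ _ F hF
    have h1 : ContDiff ℝ 1 F := hF.of_le (by exact_mod_cast le_top)
    simp only [Nat.cast_zero, contDiff_zero]
    exact continuous_iff_continuousAt.2 fun x => (Av_hasFDerivAt h h1 x).continuousAt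
  | succ n ih =>
    intro E _ _ F hF
    have h1 : ContDiff ℝ 1 F := hF.of_le (by exact_mod_cast le_top)
    push_cast
    rw [contDiff_succ_iff_fderiv]
    refine ⟨fun x => (Av_hasFDerivAt h h1 x).differentiableAt, by simp, ?_⟩
    have e : fderiv ℝ (Av μ K Y F) = Av μ K Y (fderiv ℝ F) :=
      funext fun x => (Av_hasFDerivAt h h1 x).fderiv
    rw [e]
    exact ih _ _ (hF.fderiv_right (by simp))

lemma Av_sm {M δ : ℝ} (h : KY K Y M δ) {F : R3 → ℝ} (hF : Sm F) : Sm (Av μ K Y F) := by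
  rw [Sm, contDiff_infty]
  exact fun n => Av_contDiff h n ℝ F hF

lemma Av_dv {M δ : ℝ} (h : KY K Y M δ) {F : R3 → ℝ} (hF : Sm F) (b : R3) :
    dv b (Av μ K Y F) = Av μ K Y (dv b F) := by
  funext x
  have h1 : ContDiff ℝ 1 F := hF.of_le (by exact_mod_cast le_top)
  rw [dv, (Av_hasFDerivAt h h1 x).fderiv]
  have hF' : Continuous (fderiv ℝ F) := h1.continuous_fderiv (by simp)
  rw [Av, ContinuousLinearMap.integral_apply (Av_int h hF' x)]
  rfl

end Av

def IsMoll (κ φ : R3 → ℝ) : Prop := Sm κ ∧ Sm φ ∧ (∀ y, 0 ≤ φ y) ∧ (∀ y, 1 ≤ ‖y‖ → κ y = 0) ∧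
  (∀ y, 1 ≤ ‖y‖ → φ y = 0) ∧ ∫ y, φ y = 1 ∧ ∀ b y, dv b κ y = -(inner ℝ y b) * φ y

lemma cs_of_ball {f : R3 → ℝ} {r : ℝ} (h : ∀ y, r ≤ ‖y‖ → f y = 0) : HasCompactSupport f := by
  refine HasCompactSupport.intro (isCompact_closedBall (0:R3) r) fun x hx => h x ?_
  rw [mem_closedBall_zero_iff, not_le] at hx
  exact hx.le

lemma sm_sq : ContDiff ℝ (⊤ : ℕ∞) (fun y : R3 => 1 - ‖y‖ ^ 2) := contDiff_const.sub (contDiff_norm_sq ℝ)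

lemma exists_moll : ∃ κ φ, IsMoll κ φ := by
  set st := Real.smoothTransition with hst
  have hs : ContDiff ℝ (⊤ : ℕ∞) st := Real.smoothTransition.contDiff
  have hs' : ContDiff ℝ (⊤ : ℕ∞) (deriv st) :=
    (contDiff_infty_iff_deriv.1 hs).2
  set κ0 : R3 → ℝ := fun y => st (1 - ‖y‖ ^ 2) with hκ0
  set φ0 : R3 → ℝ := fun y => 2 * deriv st (1 - ‖y‖ ^ 2) with hφ0
  have sκ : Sm κ0 := hs.comp sm_sq
  have sφ : Sm φ0 := contDiff_const.mul (hs'.comp sm_sq)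
  have mono : Monotone st := Real.smoothTransition.monotone
  have φnn : ∀ y, 0 ≤ φ0 y := fun y => by
    simp only [hφ0]; have := mono.deriv_nonneg (x := 1 - ‖y‖ ^ 2); positivity
  have κz : ∀ y : R3, 1 ≤ ‖y‖ → κ0 y = 0 := fun y hy =>
    Real.smoothTransition.zero_of_nonpos (by nlinarith)
  have φz : ∀ y : R3, 1 ≤ ‖y‖ → φ0 y = 0 := fun y hy => by
    have h1 : st (1 - ‖y‖ ^ 2) = 0 := Real.smoothTransition.zero_of_nonpos (by nlinarith)
    have h2 : IsLocalMin st (1 - ‖y‖ ^ 2) := Eventually.of_forall fun t => by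
      rw [h1]; exact Real.smoothTransition.nonneg t
    simp only [hφ0, h2.deriv_eq_zero, mul_zero]
  have hd : ∀ b y, dv b κ0 y = -(inner ℝ y b) * φ0 y := by
    intro b y
    have h1 : HasDerivAt st (deriv st (1 - ‖y‖ ^ 2)) (1 - ‖y‖ ^ 2) :=
      (hs.differentiable (by simp) _).hasDerivAt
    have h2 : HasFDerivAt (fun y : R3 => 1 - ‖y‖ ^ 2) (-(2 • (innerSL ℝ y))) y := by
      have := (hasStrictFDerivAt_norm_sq y).hasFDerivAt.const_sub 1
      simpa using this
    have h3 := h1.comp_hasFDerivAt y h2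
    have : dv b κ0 y = (deriv st (1 - ‖y‖ ^ 2) • -(2 • innerSL ℝ y)) b := by
      rw [dv]; congr 1; exact h3.fderiv
    rw [this]; simp [hφ0]; ring
  have hint := (sφ.cc (cs_of_ball φz)).integrable
  have pos : 0 < ∫ y, φ0 y := by
    refine lt_of_le_of_ne (integral_nonneg φnn) fun h => ?_
    have h1 := (integral_eq_zero_iff_of_nonneg φnn hint).1 h.symm
    have h2 : φ0 = 0 := (Continuous.ae_eq_iff_eq volume sφ.continuous continuous_zero).1 h1
    have h3 : ∀ y, fderiv ℝ κ0 y = 0 := by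
      intro y; ext b; have := hd b y; rw [h2] at this; simpa [dv] using this
    have h4 := is_const_of_fderiv_eq_zero sκ.diff h3 0 (ee 0)
    rw [κz (ee 0) (by simp)] at h4
    simp [hκ0, hst] at h4
  set c := (∫ y, φ0 y)⁻¹ with hcdef
  refine ⟨fun y => c * κ0 y, fun y => c * φ0 y, contDiff_const.mul sκ, contDiff_const.mul sφ,
    fun y => mul_nonneg (by positivity) (φnn y), fun y hy => by simp [κz y hy], fun y hy => by simp [φz y hy], ?_, ?_⟩
  · rw [integral_const_mul]; exact inv_mul_cancel₀ pos.ne'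
  · intro b y
    rw [dv_fconst sκ]; simp only; rw [hd]; ring

lemma IsMoll.cκ {κ φ : R3 → ℝ} (m : IsMoll κ φ) : CC κ := m.1.cc (cs_of_ball m.2.2.2.1)
lemma IsMoll.cφ {κ φ : R3 → ℝ} (m : IsMoll κ φ) : CC φ := m.2.1.cc (cs_of_ball m.2.2.2.2.1)

abbrev mB : Measure R3 := volume.restrict (closedBall (0:R3) 1)

instance mB_fin : IsFiniteMeasure mB :=
  ⟨by rw [Measure.restrict_apply_univ]; exact measure_closedBall_lt_top⟩

def clampY (s : ℝ) (y : R3) : R3 := (closedBall (0:R3) 1).indicator (fun y => s • y) y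

lemma clampY_eq {s : ℝ} {y : R3} (hy : y ∈ closedBall (0:R3) 1) : clampY s y = s • y :=
  Set.indicator_of_mem hy _

/-- mollification -/
def mo (φ : R3 → ℝ) (s : ℝ) (F : R3 → ℝ) (x : R3) : ℝ := ∫ y, φ y * F (x + s • y)

lemma IsMoll.KY {κ φ : R3 → ℝ} (m : IsMoll κ φ) (s : ℝ) : ∃ M, KY φ (clampY s) M |s| := by
  obtain ⟨M, h0, hM⟩ := m.cφ.bdd
  refine ⟨M, m.2.1.continuous.measurable, ?_, hM, ?_, h0, abs_nonneg _⟩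
  · exact (measurable_id.const_smul s).indicator measurableSet_closedBall
  · intro y
    by_cases hy : y ∈ closedBall (0:R3) 1
    · rw [clampY_eq hy, norm_smul, Real.norm_eq_abs]
      rw [mem_closedBall_zero_iff] at hy
      exact mul_le_of_le_one_right (abs_nonneg _) hy
    · simp [clampY, Set.indicator_of_notMem hy]

lemma mo_eq {φ : R3 → ℝ} (hφ : ∀ y, 1 ≤ ‖y‖ → φ y = 0) (s : ℝ) (F : R3 → ℝ) :
    mo φ s F = Av mB φ (clampY s) F := by
  funext x
  rw [mo, Av]
  have : ∫ y in closedBall (0:R3) 1, φ y • F (x + clampY s y) =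
      ∫ y in closedBall (0:R3) 1, φ y * F (x + s • y) := by
    refine setIntegral_congr_fun measurableSet_closedBall fun y hy => ?_
    simp [clampY_eq hy]
  rw [this, setIntegral_eq_integral_of_forall_compl_eq_zero]
  intro y hy
  rw [mem_closedBall_zero_iff, not_le] at hy
  rw [hφ y hy.le, zero_mul]

lemma IsMoll.mo_sm {κ φ : R3 → ℝ} (m : IsMoll κ φ) (s : ℝ) {F : R3 → ℝ} (hF : Sm F) : Sm (mo φ s F) := by
  obtain ⟨M, h⟩ := m.KY s
  rw [mo_eq m.2.2.2.2.1]; exact Av_sm h hF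

lemma IsMoll.mo_dv {κ φ : R3 → ℝ} (m : IsMoll κ φ) (s : ℝ) {F : R3 → ℝ} (hF : Sm F) (b : R3) :
    dv b (mo φ s F) = mo φ s (dv b F) := by
  obtain ⟨M, h⟩ := m.KY s
  rw [mo_eq m.2.2.2.2.1, mo_eq m.2.2.2.2.1]; exact Av_dv h hF b

lemma sm_affine {F : R3 → ℝ} (hF : Sm F) (x : R3) (s : ℝ) : Sm (fun y => F (x + s • y)) :=
  hF.comp (contDiff_const.add (contDiff_id.const_smul s))

lemma dv_affine {F : R3 → ℝ} (hF : Sm F) (x : R3) (s : ℝ) (b : R3) :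
    dv b (fun y => F (x + s • y)) = fun y => s * dv b F (x + s • y) := by
  funext y
  have h1 : HasFDerivAt F (fderiv ℝ F (x + s • y)) (x + s • y) := (hF.diff _).hasFDerivAt
  have h2 : HasFDerivAt (fun y : R3 => x + s • y) (s • ContinuousLinearMap.id ℝ R3) y :=
    ((hasFDerivAt_id y).const_smul s).const_add x
  have h3 := h1.comp y h2
  have : dv b (fun y => F (x + s • y)) y = ((fderiv ℝ F (x + s • y)).comp (s • ContinuousLinearMap.id ℝ R3)) b := by
    rw [dv]; congr 1; exact h3.fderiv
  rw [this]; simp [dv]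

/-- t-derivative of the mollification -/
lemma IsMoll.dt {κ φ : R3 → ℝ} (m : IsMoll κ φ) {f : R3 → ℝ} (hf : Sm f) (x : R3) (t : ℝ) :
    HasDerivAt (fun t => mo φ t f x) (t * mo κ t (lap f) x) t := by
  -- derivative under the integral
  have h0 : HasDerivAt (fun t => mo φ t f x) (∫ y, φ y * dv y f (x + t • y)) t := by
    have hcont : Continuous (fun z : ℝ × R3 => φ z.2 * dv z.2 f (x + z.1 • z.2)) := by
      have h1 : Continuous (fderiv ℝ f) := hf.continuous_fderiv (by simp)
      have h2 := m.2.1.continuous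
      simp only [dv]
      fun_prop
    obtain ⟨C, hC⟩ := ((isCompact_closedBall t 1).prod (isCompact_closedBall (0:R3) 1)).exists_bound_of_continuousOn
      hcont.continuousOn
    have hfc := hf.continuous
    have hφc := m.2.1.continuous
    refine (hasDerivAt_integral_of_dominated_loc_of_deriv_le (F := fun t y => φ y * f (x + t • y))
      (F' := fun t y => φ y * dv y f (x + t • y))
      (bound := (closedBall (0:R3) 1).indicator fun _ => C) (ball_mem_nhds t one_pos)
      (Eventually.of_forall fun s => Continuous.aestronglyMeasurable (by fun_prop))
      ?_ ?_ ?_ ?_ ?_).2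
    · refine Continuous.integrable_of_hasCompactSupport (by fun_prop) (m.cφ.2.mul_right)
    · exact (hcont.comp (Continuous.prodMk continuous_const continuous_id)).aestronglyMeasurable
    · refine Eventually.of_forall fun y s hs => ?_
      by_cases hy : y ∈ closedBall (0:R3) 1
      · rw [Set.indicator_of_mem hy]
        exact hC (s, y) ⟨ball_subset_closedBall hs, hy⟩
      · rw [Set.indicator_of_notMem hy]
        rw [mem_closedBall_zero_iff, not_le] at hy
        rw [m.2.2.2.2.1 y hy.le]; simp
    · rw [integrable_indicator_iff measurableSet_closedBall]
      exact integrableOn_const (measure_closedBall_lt_top.ne)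
    · refine Eventually.of_forall fun y s hs => ?_
      exact (hasDerivAt_line hf x y s).const_mul _
  convert h0 using 1
  have e1 : ∀ y, dv y f (x + t • y) = ∑ j, y j * dv (ee j) f (x + t • y) := by
    intro y
    have hy : y = ∑ j, y j • ee j := by
      ext i; fin_cases i <;> simp [Fin.sum_univ_three]
    simp only [dv]
    refine (congrArg (fderiv ℝ f (x + t • y)) hy).trans ?_
    rw [map_sum]
    simp
  have e2 : ∀ j, t * ∫ y, κ y * dv (ee j) (dv (ee j) f) (x + t • y) =
      ∫ y, φ y * (y j * dv (ee j) f (x + t • y)) := by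
    intro j
    have := ibp m.1 (sm_affine (hf.dv (ee j)) x t) m.cκ.2 (ee j)
    rw [dv_affine (hf.dv _)] at this
    rw [← integral_const_mul]
    calc _ = ∫ y, κ y * (t * dv (ee j) (dv (ee j) f) (x + t • y)) := by congr 1; funext y; ring
      _ = _ := this
      _ = _ := by
        rw [← integral_neg]; congr 1; funext y; rw [m.2.2.2.2.2.2]
        simp [EuclideanSpace.inner_single_right]; ring
  have i1 : ∀ j, Integrable (fun y => φ y * (y j * dv (ee j) f (x + t • y))) := by
    intro j
    have := m.2.1.continuous
    have := (hf.dv (ee j)).continuous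
    exact Continuous.integrable_of_hasCompactSupport (by fun_prop) (m.cφ.2.mul_right)
  have i2 : ∀ j, Integrable (fun y => κ y * dv (ee j) (dv (ee j) f) (x + t • y)) := by
    intro j
    have := m.1.continuous
    have := ((hf.dv (ee j)).dv (ee j)).continuous
    exact Continuous.integrable_of_hasCompactSupport (by fun_prop) (m.cκ.2.mul_right)
  simp_rw [e1, Finset.mul_sum]
  rw [integral_finsetSum _ fun j _ => i1 j]
  simp_rw [← e2]
  rw [← Finset.mul_sum, ← integral_finsetSum _ fun j _ => i2 j]
  simp only [mo, lap, Finset.mul_sum]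
  rfl

lemma sm_lap {f : R3 → ℝ} (hf : Sm f) : Sm (lap f) := by
  have : lap f = fun x => dv (ee 0) (dv (ee 0) f) x + dv (ee 1) (dv (ee 1) f) x + dv (ee 2) (dv (ee 2) f) x :=
    funext fun x => lap_eq f x
  rw [this]
  exact (((hf.dv _).dv _).add ((hf.dv _).dv _)).add ((hf.dv _).dv _)

lemma Sm.lap {f : R3 → ℝ} (hf : Sm f) : Sm (_root_.lap f) := sm_lap hf

lemma IsMoll.mo_zero {κ φ : R3 → ℝ} (m : IsMoll κ φ) (f : R3 → ℝ) (x : R3) : mo φ 0 f x = f x := by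
  simp [mo, integral_mul_const, m.2.2.2.2.2.1]

lemma IsMoll.potential {κ φ : R3 → ℝ} (m : IsMoll κ φ) {f : R3 → ℝ} (hf : Sm f) {δ : ℝ} (hδ : 0 < δ) :
    ∃ Φ : R3 → ℝ, Sm Φ ∧ (∀ x, (∀ z, ‖z - x‖ ≤ δ → f z = 0) → Φ x = 0) ∧
      ∀ x, lap Φ x = f x - mo φ δ f x := by
  set cl : ℝ → ℝ := fun t => max 0 (min t δ) with hcl
  have clc : Continuous cl := by fun_prop
  have cl0 : ∀ t, 0 ≤ cl t := fun t => le_max_left _ _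
  have cl1 : ∀ t, cl t ≤ δ := fun t => max_le hδ.le (min_le_right _ _)
  have cle : ∀ t ∈ Set.Ioc 0 δ, cl t = t := fun t ht => by
    simp only [hcl]; rw [min_eq_left ht.2, max_eq_right ht.1.le]
  set K : ℝ × R3 → ℝ := fun z => cl z.1 * κ z.2 with hK
  set Y : ℝ × R3 → R3 := fun z => cl z.1 • clampY 1 z.2 with hY
  set μ : Measure (ℝ × R3) := (volume.restrict (Set.Ioc 0 δ)).prod mB with hμ
  obtain ⟨M, hM0, hM⟩ := m.cκ.bdd
  have hYb : ∀ z, ‖Y z‖ ≤ δ := by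
    intro z
    obtain ⟨M', hM'⟩ := m.KY 1
    have h1 := hM'.2.2.2.1 z.2
    rw [abs_one] at h1
    simp only [hY]
    rw [norm_smul, Real.norm_eq_abs, abs_of_nonneg (cl0 _)]
    have := cl0 z.1; have := cl1 z.1; have := norm_nonneg (clampY 1 z.2)
    nlinarith
  have hKY : _root_.KY K Y (δ * M) δ := by
    refine ⟨?_, ?_, ?_, hYb, by positivity, hδ.le⟩
    · have := m.1.continuous
      exact Continuous.measurable (by fun_prop)
    · obtain ⟨M', hM'⟩ := m.KY 1
      exact (clc.measurable.comp measurable_fst).smul (hM'.2.1.comp measurable_snd)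
    · intro z
      simp only [hK]
      rw [abs_mul, abs_of_nonneg (cl0 _)]
      exact mul_le_mul (cl1 _) (hM _) (abs_nonneg _) hδ.le
  refine ⟨fun x => -1 * Av μ K Y f x, contDiff_const.mul (Av_sm hKY hf), ?_, ?_⟩
  · intro x hx
    have : ∀ z, K z • f (x + Y z) = 0 := fun z => by
      rw [hx _ (by simpa using hYb z), smul_zero]
    simp only [Av]; simp_rw [this]; simp
  · intro x
    have hS := Av_sm (μ := μ) hKY hf
    have e1 : ∀ b, dv b (dv b (fun x => -1 * Av μ K Y f x)) x = -1 * Av μ K Y (dv b (dv b f)) x := by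
      intro b
      rw [dv_fconst hS, dv_fconst (hS.dv b), Av_dv hKY hf, Av_dv hKY (hf.dv b)]
    have hii := fun b => Av_int (μ := μ) hKY ((hf.dv b).dv b).continuous x
    have e2 : lap (fun x => -1 * Av μ K Y f x) x = - Av μ K Y (lap f) x := by
      rw [lap_eq, e1, e1, e1]
      have : Av μ K Y (lap f) x = Av μ K Y (dv (ee 0) (dv (ee 0) f)) x + Av μ K Y (dv (ee 1) (dv (ee 1) f)) x
         + Av μ K Y (dv (ee 2) (dv (ee 2) f)) x := by
        simp only [Av]
        have s1 := integral_add (hii (ee 0)) (hii (ee 1))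
        have s2 := integral_add ((hii (ee 0)).add (hii (ee 1))) (hii (ee 2))
        simp only [Pi.add_apply] at s1 s2
        rw [← s1, ← s2]
        congr 1; funext z; rw [lap_eq]; simp only [smul_eq_mul]; ring
      rw [this]; ring
    rw [e2, Av, integral_prod _ (Av_int hKY hf.lap.continuous x)]
    have e3 : ∫ t in Set.Ioc 0 δ, ∫ y, K (t, y) • lap f (x + Y (t, y)) ∂mB =
        ∫ t in Set.Ioc 0 δ, t * mo κ t (lap f) x := by
      refine setIntegral_congr_fun measurableSet_Ioc fun t ht => ?_
      rw [mo_eq m.2.2.2.1, Av, ← integral_const_mul]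
      refine setIntegral_congr_fun measurableSet_closedBall fun y hy => ?_
      simp only [hK, hY, cle t ht, clampY_eq hy, smul_eq_mul, one_smul, mul_assoc]
    rw [e3, ← intervalIntegral.integral_of_le hδ.le]
    have e4 : ∫ t in (0:ℝ)..δ, t * mo κ t (lap f) x = mo φ δ f x - mo φ 0 f x := by
      refine intervalIntegral.integral_eq_sub_of_hasDerivAt (fun t _ => m.dt hf x t) ?_
      refine Continuous.intervalIntegrable ?_ _ _
      refine continuous_id.mul ?_
      have hc1 := m.1.continuous
      have hc2 := hf.lap.continuous
      refine continuous_iff_continuousAt.2 fun t => ?_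
      obtain ⟨C, hC⟩ := ((isCompact_closedBall t 1).prod (isCompact_closedBall (0:R3) 1)).exists_bound_of_continuousOn
        (f := fun z : ℝ × R3 => κ z.2 * lap f (x + z.1 • z.2)) (by fun_prop)
      refine continuousAt_of_dominated (bound := (closedBall (0:R3) 1).indicator fun _ => C)
        (Eventually.of_forall fun s => Continuous.aestronglyMeasurable (by fun_prop)) ?_ ?_ ?_
      · filter_upwards [ball_mem_nhds t one_pos] with s hs
        refine Eventually.of_forall fun y => ?_
        by_cases hy : y ∈ closedBall (0:R3) 1
        · rw [Set.indicator_of_mem hy]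
          exact hC (s, y) ⟨ball_subset_closedBall hs, hy⟩
        · rw [Set.indicator_of_notMem hy]
          rw [mem_closedBall_zero_iff, not_le] at hy
          rw [m.2.2.2.1 y hy.le]; simp
      · rw [integrable_indicator_iff measurableSet_closedBall]
        exact integrableOn_const (measure_closedBall_lt_top.ne)
      · exact Eventually.of_forall fun y => Continuous.continuousAt (by fun_prop)
    rw [e4, m.mo_zero]; ring

/-- L^p contraction -/
lemma IsMoll.mo_p {κ φ : R3 → ℝ} (m : IsMoll κ φ) {f : R3 → ℝ} (hf : CC f) (s : ℝ) {p : ℝ} (hp : 1 ≤ p) :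
    ∫ x, |mo φ s f x| ^ p ≤ ∫ x, |f x| ^ p := by
  have hp0 : 0 < p := by linarith
  have hfp := hf.rpow hp0
  have hφc := m.2.1.continuous
  have jens : ∀ x, |mo φ s f x| ^ p ≤ ∫ y, φ y * |f (x + s • y)| ^ p := by
    intro x
    set ν : Measure R3 := volume.withDensity (fun y => ENNReal.ofReal (φ y)) with hν
    have hprob : IsProbabilityMeasure ν := by
      constructor
      rw [hν, withDensity_apply _ MeasurableSet.univ, Measure.restrict_univ,
        ← ofReal_integral_eq_lintegral_ofReal m.cφ.integrable (Eventually.of_forall m.2.2.1), m.2.2.2.2.2.1]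
      simp
    have conv : ∀ G : R3 → ℝ, ∫ y, G y ∂ν = ∫ y, φ y * G y := by
      intro G
      rw [hν, integral_withDensity_eq_integral_toReal_smul (by fun_prop) (Eventually.of_forall fun y => ENNReal.ofReal_lt_top)]
      congr 1; funext y; rw [ENNReal.toReal_ofReal (m.2.2.1 y), smul_eq_mul]
    have hcv : ConvexOn ℝ Set.univ (fun t : ℝ => |t| ^ p) := by
      have h1 := (convexOn_rpow hp)
      refine ⟨convex_univ, fun a _ b _ α β hα hβ hab => ?_⟩
      have h2 := h1.2 (abs_nonneg a : |a| ∈ Set.Ici 0) (abs_nonneg b : |b| ∈ Set.Ici 0) hα hβ hab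
      refine le_trans (Real.rpow_le_rpow (abs_nonneg _) ?_ hp0.le) h2
      simp only [smul_eq_mul]
      refine (abs_add_le _ _).trans ?_
      rw [abs_mul, abs_mul, abs_of_nonneg hα, abs_of_nonneg hβ]
    obtain ⟨C, hC0, hC⟩ := hf.bdd
    obtain ⟨C', hC0', hC'⟩ := hfp.bdd
    have h1 := hf.1
    have h2 := hfp.1
    have := hcv.map_integral_le (μ := ν) (f := fun y => f (x + s • y))
      ((continuous_abs.rpow_const fun _ => Or.inr hp0.le).continuousOn) isClosed_univ
      (Eventually.of_forall fun _ => Set.mem_univ _)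
      (Integrable.of_bound (Continuous.aestronglyMeasurable (by fun_prop)) C (Eventually.of_forall fun y => hC _))
      (Integrable.of_bound (Continuous.aestronglyMeasurable (h2.comp (by fun_prop : Continuous fun y : R3 => x + s • y))) C' (Eventually.of_forall fun y => hC' _))
    rw [conv, conv] at this
    exact this
  have h2 := hfp.1
  have hshift : ∀ y, ∫ x, φ y * |f (x + s • y)| ^ p = φ y * ∫ x, |f x| ^ p := by
    intro y
    rw [integral_const_mul, int_shift (fun x => |f x| ^ p)]
  have hI : Integrable (fun z : R3 × R3 => φ z.2 * |f (z.1 + s • z.2)| ^ p) (volume.prod volume) := by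
    have hcont : Continuous (fun z : R3 × R3 => φ z.2 * |f (z.1 + s • z.2)| ^ p) :=
      (hφc.comp continuous_snd).mul (h2.comp (by fun_prop : Continuous fun z : R3 × R3 => z.1 + s • z.2))
    refine (integrable_prod_iff' hcont.aestronglyMeasurable).2 ⟨Eventually.of_forall fun y => ?_, ?_⟩
    · exact (hfp.shift (s • y)).integrable.const_mul (φ y)
    · have : ∀ y, ∫ x, ‖φ y * |f (x + s • y)| ^ p‖ = φ y * ∫ x, |f x| ^ p := by
        intro y
        rw [← hshift]; congr 1; funext x
        rw [Real.norm_eq_abs, abs_of_nonneg (mul_nonneg (m.2.2.1 y) (by positivity))]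
      simp_rw [this]
      exact m.cφ.integrable.mul_const _
  calc ∫ x, |mo φ s f x| ^ p ≤ ∫ x, ∫ y, φ y * |f (x + s • y)| ^ p :=
        integral_mono_of_nonneg (Eventually.of_forall fun x => by positivity) hI.integral_prod_left
          (Eventually.of_forall jens)
    _ = ∫ y, ∫ x, φ y * |f (x + s • y)| ^ p := integral_integral_swap hI
    _ = ∫ x, |f x| ^ p := by
        simp_rw [hshift]; rw [integral_mul_const, m.2.2.2.2.2.1, one_mul]

lemma IsMoll.mo_swap {κ φ : R3 → ℝ} (m : IsMoll κ φ) {f g : R3 → ℝ} (hf : CC f) (hg : Continuous g) (s : ℝ) :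
    ∫ x, g x * mo φ s f x = ∫ x, mo φ (-s) g x * f x := by
  have hφc := m.2.1.continuous
  have hcont : Continuous (fun z : R3 × R3 => φ z.2 * (g z.1 * f (z.1 + s • z.2))) := by
    have := hf.1; fun_prop
  have hI : Integrable (fun z : R3 × R3 => φ z.2 * (g z.1 * f (z.1 + s • z.2))) (volume.prod volume) := by
    refine hcont.integrable_of_hasCompactSupport ?_
    obtain ⟨r, hr, hr2⟩ := hf.ball
    refine HasCompactSupport.intro ((isCompact_closedBall (0:R3) (r + |s|)).prod (isCompact_closedBall (0:R3) 1)) ?_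
    rintro ⟨x, y⟩ hxy
    simp only
    by_cases hy : 1 ≤ ‖y‖
    · rw [m.2.2.2.2.1 y hy]; simp
    · rw [hr2 (x + s • y)]; · simp
      by_contra hlt
      push Not at hy hlt
      apply hxy
      refine ⟨?_, ?_⟩
      · rw [mem_closedBall_zero_iff]
        have h1 := norm_sub_le (x + s • y) (s • y)
        rw [add_sub_cancel_right, norm_smul, Real.norm_eq_abs] at h1
        have : |s| * ‖y‖ ≤ |s| := mul_le_of_le_one_right (abs_nonneg _) hy.le
        simp only; linarith
      · rw [mem_closedBall_zero_iff]; exact hy.le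
  have e1 : ∀ x, g x * mo φ s f x = ∫ y, φ y * (g x * f (x + s • y)) := by
    intro x; rw [mo, ← integral_const_mul]; congr 1; funext y; ring
  have hI2 : Integrable (fun z : R3 × R3 => φ z.2 * (g (z.1 - s • z.2) * f z.1)) (volume.prod volume) := by
    have hcont : Continuous (fun z : R3 × R3 => φ z.2 * (g (z.1 - s • z.2) * f z.1)) := by
      have := hf.1; fun_prop
    refine hcont.integrable_of_hasCompactSupport ?_
    obtain ⟨r, hr, hr2⟩ := hf.ball
    refine HasCompactSupport.intro ((isCompact_closedBall (0:R3) r).prod (isCompact_closedBall (0:R3) 1)) ?_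
    rintro ⟨x, y⟩ hxy
    simp only
    by_cases hy : 1 ≤ ‖y‖
    · rw [m.2.2.2.2.1 y hy]; simp
    · rw [hr2 x]; · simp
      by_contra hlt
      push Not at hy hlt
      apply hxy
      refine ⟨?_, ?_⟩
      · rw [mem_closedBall_zero_iff]; exact hlt.le
      · rw [mem_closedBall_zero_iff]; exact hy.le
  simp_rw [e1]
  rw [integral_integral_swap hI]
  have e2 : ∀ y, ∫ x, φ y * (g x * f (x + s • y)) = ∫ x, φ y * (g (x - s • y) * f x) := by
    intro y
    rw [← int_shift (fun x => φ y * (g (x - s • y) * f x)) (s • y)]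
    simp
  simp_rw [e2]
  rw [integral_integral_swap (f := fun y x => φ y * (g (x - s • y) * f x)) hI2.swap]
  congr 1; funext x
  rw [mo, ← integral_mul_const]; congr 1; funext y
  simp only [neg_smul, ← sub_eq_add_neg]; ring

lemma dv_zero_of_eventually {f : R3 → ℝ} {c : ℝ} {x : R3} (h : ∀ᶠ y in nhds x, f y = c) (b : R3) :
    dv b f x = 0 := by
  have : f =ᶠ[nhds x] fun _ => c := h
  rw [dv, this.fderiv_eq]; simp

lemma exists_cutoff : ∃ C0 : ℝ, 0 < C0 ∧ ∀ a b : ℝ, 0 < a → a < b → ∃ η : R3 → ℝ, Sm η ∧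
    (∀ x, 0 ≤ η x ∧ η x ≤ 1) ∧ (∀ x, ‖x‖ ≤ a → η x = 1) ∧ (∀ x, b ≤ ‖x‖ → η x = 0) ∧
    (∀ j x, |dv (ee j) η x| ≤ C0 / (b - a)) ∧ (∀ x, |lap η x| ≤ C0 / (b - a) ^ 2) ∧
    (∀ x, (‖x‖ < a ∨ b < ‖x‖) → (∀ j, dv (ee j) η x = 0) ∧ lap η x = 0) := by
  set st := Real.smoothTransition with hst
  have hs : ContDiff ℝ (⊤ : ℕ∞) st := Real.smoothTransition.contDiff
  have hs1 : ContDiff ℝ (⊤ : ℕ∞) (deriv st) := (contDiff_infty_iff_deriv.1 hs).2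
  have hs2 : ContDiff ℝ (⊤ : ℕ∞) (deriv (deriv st)) := (contDiff_infty_iff_deriv.1 hs1).2
  have cs1 : HasCompactSupport (deriv st) := by
    refine HasCompactSupport.intro (isCompact_Icc (a := (0:ℝ)) (b := 1)) fun t ht => ?_
    rw [Set.mem_Icc, not_and_or, not_le, not_le] at ht
    rcases ht with ht | ht
    · have h1 : st t = 0 := Real.smoothTransition.zero_of_nonpos ht.le
      have h2 : IsLocalMin st t := Eventually.of_forall fun t => by
        rw [h1]; exact Real.smoothTransition.nonneg t
      exact h2.deriv_eq_zero
    · have h1 : st t = 1 := Real.smoothTransition.one_of_one_le ht.le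
      have h2 : IsLocalMax st t := Eventually.of_forall fun t => by
        rw [h1]; exact Real.smoothTransition.le_one t
      exact h2.deriv_eq_zero
  obtain ⟨C1, hC1⟩ := cs1.exists_bound_of_continuous hs1.continuous
  obtain ⟨C2, hC2⟩ := cs1.deriv.exists_bound_of_continuous hs2.continuous
  have hC10 : 0 ≤ C1 := (norm_nonneg _).trans (hC1 0)
  have hC20 : 0 ≤ C2 := (norm_nonneg _).trans (hC2 0)
  simp only [Real.norm_eq_abs] at hC1 hC2
  refine ⟨1 + 6 * C1 + 12 * C2, by positivity, fun a b ha hab => ?_⟩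
  set D := b ^ 2 - a ^ 2 with hD
  have hD0 : 0 < D := by nlinarith
  set g : R3 → ℝ := fun x => (b ^ 2 - ‖x‖ ^ 2) / D with hg
  have hgs : Sm g := (contDiff_const.sub (contDiff_norm_sq ℝ)).div_const D
  have hη : Sm (fun x => st (g x)) := hs.comp hgs
  have hgd : ∀ e x, dv e g x = -(2 * inner ℝ x e) / D := by
    intro e x
    have h2 : HasFDerivAt (fun y : R3 => b ^ 2 - ‖y‖ ^ 2) (-(2 • (innerSL ℝ x))) x := by
      have := (hasStrictFDerivAt_norm_sq x).hasFDerivAt.const_sub (b ^ 2)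
      simpa using this
    have h3 : HasFDerivAt g (D⁻¹ • (-(2 • (innerSL ℝ x)) : R3 →L[ℝ] ℝ)) x := by
      have := h2.const_mul D⁻¹
      refine this.congr_of_eventuallyEq (Eventually.of_forall fun y => ?_)
      simp only [hg]; ring
    rw [dv, h3.fderiv]; simp; ring
  have chain : ∀ (F : ℝ → ℝ), ContDiff ℝ (⊤ : ℕ∞) F → ∀ e x, dv e (fun x => F (g x)) x = deriv F (g x) * dv e g x := by
    intro F hF e x
    have h1 : HasDerivAt F (deriv F (g x)) (g x) := (hF.differentiable (by simp) _).hasDerivAt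
    have h3 := h1.comp_hasFDerivAt x (hgs.diff x).hasFDerivAt
    have : dv e (fun x => F (g x)) x = (deriv F (g x) • fderiv ℝ g x) e := by
      rw [dv]; congr 1; exact h3.fderiv
    rw [this]; simp [dv]
  have hz : ∀ x, (‖x‖ < a ∨ b < ‖x‖) → ∃ c, ∀ᶠ y in nhds x, st (g y) = c := by
    intro x hx
    rcases hx with hx | hx
    · refine ⟨1, ?_⟩
      filter_upwards [(continuous_norm.tendsto x).eventually (gt_mem_nhds hx)] with y hy
      refine Real.smoothTransition.one_of_one_le ?_
      rw [le_div_iff₀ hD0]; nlinarith [norm_nonneg y]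
    · refine ⟨0, ?_⟩
      filter_upwards [(continuous_norm.tendsto x).eventually (lt_mem_nhds hx)] with y hy
      refine Real.smoothTransition.zero_of_nonpos ?_
      refine div_nonpos_of_nonpos_of_nonneg ?_ hD0.le
      nlinarith [norm_nonneg y]
  have hz' : ∀ x, (‖x‖ < a ∨ b < ‖x‖) → (∀ j, dv (ee j) (fun x => st (g x)) x = 0) ∧ lap (fun x => st (g x)) x = 0 := by
    intro x hx
    obtain ⟨c, hc⟩ := hz x hx
    refine ⟨fun j => dv_zero_of_eventually hc _, ?_⟩
    have : ∀ e, dv e (dv e (fun x => st (g x))) x = 0 := by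
      intro e
      refine dv_zero_of_eventually (c := 0) ?_ e
      filter_upwards [hc.eventually_nhds] with y hy
      exact dv_zero_of_eventually hy e
    rw [lap_eq, this, this, this]; simp
  have hba : 0 < b - a := by linarith
  have hin : ∀ x : R3, ‖x‖ ≤ b → ∀ j, |2 * inner ℝ x (ee j) / D| ≤ 2 / (b - a) := by
    intro x hx j
    have h1 : |inner ℝ x (ee j)| ≤ b := by
      refine (abs_real_inner_le_norm _ _).trans ?_
      simpa using hx
    rw [abs_div, abs_of_pos hD0, abs_mul, abs_two, div_le_div_iff₀ hD0 hba]
    have : D = (b - a) * (b + a) := by rw [hD]; ring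
    rw [this]
    nlinarith
  refine ⟨fun x => st (g x), hη, fun x => ⟨Real.smoothTransition.nonneg _, Real.smoothTransition.le_one _⟩, ?_, ?_, ?_, ?_, hz'⟩
  · intro x hx
    refine Real.smoothTransition.one_of_one_le ?_
    rw [le_div_iff₀ hD0]; nlinarith [norm_nonneg x]
  · intro x hx
    refine Real.smoothTransition.zero_of_nonpos ?_
    refine div_nonpos_of_nonpos_of_nonneg ?_ hD0.le
    nlinarith [norm_nonneg x]
  · intro j x
    by_cases hx : b < ‖x‖
    · rw [(hz' x (Or.inr hx)).1 j]; simp; positivity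
    · rw [chain st hs, hgd, neg_div, mul_neg, abs_neg, abs_mul]
      calc _ ≤ C1 * (2 / (b - a)) := mul_le_mul (hC1 _) (hin x (not_lt.1 hx) j) (abs_nonneg _) hC10
        _ = (2 * C1) / (b - a) := by ring
        _ ≤ _ := by gcongr; linarith
  · intro x
    by_cases hx : b < ‖x‖
    · rw [(hz' x (Or.inr hx)).2]; simp; positivity
    · have hlin : ∀ e : R3, dv e (fun x : R3 => -(2 * inner ℝ x e) / D) x = -(2 * inner ℝ e e) / D := by
        intro e
        have h2 : HasFDerivAt (fun y : R3 => -(2 * inner ℝ y e) / D) ((-2 / D) • innerSL ℝ e) x := by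
          have := (innerSL ℝ e).hasFDerivAt (x := x) |>.const_mul (-2 / D)
          refine this.congr_of_eventuallyEq (Eventually.of_forall fun y => ?_)
          simp only [innerSL_apply_apply]; rw [real_inner_comm]; ring
        rw [dv, h2.fderiv]; simp; ring
      have hsm : ∀ e, Sm (fun x : R3 => -(2 * inner ℝ x e) / D) := by
        intro e
        exact ((contDiff_const.mul (contDiff_id.inner ℝ contDiff_const)).neg).div_const D
      have h2 : ∀ j, |dv (ee j) (dv (ee j) (fun x => st (g x))) x| ≤ (2 * C1 + 4 * C2) / (b - a) ^ 2 := by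
        intro j
        have e1 : dv (ee j) (fun x => st (g x)) = fun x => deriv st (g x) * (-(2 * inner ℝ x (ee j)) / D) := by
          funext y; rw [chain st hs, hgd]
        rw [e1, dv_fmul (F := fun x => deriv st (g x)) (G := fun x => -(2 * inner ℝ x (ee j)) / D) (hs1.comp hgs) (hsm _)]
        simp only
        rw [hlin, chain _ hs1, hgd]
        refine (abs_add_le _ _).trans ?_
        have t1 : |deriv st (g x) * (-(2 * inner ℝ (ee j) (ee j)) / D)| ≤ C1 * (2 / (b - a) ^ 2) := by
          rw [abs_mul]
          refine mul_le_mul (hC1 _) ?_ (abs_nonneg _) hC10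
          rw [neg_div, abs_neg, real_inner_self_eq_norm_sq]
          simp only [EuclideanSpace.norm_single, norm_one, one_pow, mul_one]
          rw [abs_of_pos (by positivity)]
          gcongr
          rw [hD]; nlinarith
        have t2 : |-(2 * inner ℝ x (ee j)) / D * (deriv (deriv st) (g x) * (-(2 * inner ℝ x (ee j)) / D))| ≤
            (2 / (b - a)) * (C2 * (2 / (b - a))) := by
          rw [abs_mul, abs_mul, neg_div, abs_neg]
          have h5 := hin x (not_lt.1 hx) j
          exact mul_le_mul h5 (mul_le_mul (hC2 _) h5 (abs_nonneg _) hC20) (by positivity) (by positivity)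
        calc _ ≤ C1 * (2 / (b - a) ^ 2) + (2 / (b - a)) * (C2 * (2 / (b - a))) := add_le_add t1 t2
          _ = _ := by field_simp; ring
      rw [lap_eq]
      calc _ ≤ |dv (ee 0) (dv (ee 0) (fun x => st (g x))) x| + |dv (ee 1) (dv (ee 1) (fun x => st (g x))) x|
            + |dv (ee 2) (dv (ee 2) (fun x => st (g x))) x| := abs_add_three _ _ _
        _ ≤ (2 * C1 + 4 * C2) / (b - a) ^ 2 + (2 * C1 + 4 * C2) / (b - a) ^ 2 + (2 * C1 + 4 * C2) / (b - a) ^ 2 :=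
            add_le_add (add_le_add (h2 0) (h2 1)) (h2 2)
        _ = (6 * C1 + 12 * C2) / (b - a) ^ 2 := by ring
        _ ≤ _ := by gcongr; linarith

lemma exists_orth (w : R3) (hw : ‖w‖ = 1) : ∃ e : R3, ‖e‖ = 1 ∧ inner ℝ w e = 0 := by
  have h1 : 0 < Module.finrank ℝ (ℝ ∙ w)ᗮ := by
    have h0 : w ≠ 0 := by intro h; simp [h] at hw
    have := Submodule.finrank_add_finrank_orthogonal (ℝ ∙ w)
    rw [finrank_span_singleton h0] at this
    simp at this; omega
  obtain ⟨z, hz⟩ := (Module.finrank_pos_iff_exists_ne_zero).1 h1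
  have hz0 : (z : R3) ≠ 0 := by simpa using hz
  have hzi : inner ℝ w (z : R3) = 0 := Submodule.mem_orthogonal_singleton_iff_inner_right.1 z.2
  refine ⟨‖(z:R3)‖⁻¹ • (z:R3), norm_smul_inv_norm hz0, ?_⟩
  rw [inner_smul_right, hzi, mul_zero]

lemma exists_arc (w w' : R3) (hw : ‖w‖ = 1) (hw' : ‖w'‖ = 1) : ∃ (e : R3) (α : ℝ), ‖e‖ = 1 ∧
    inner ℝ w e = 0 ∧ 0 ≤ α ∧ α ≤ Real.pi ∧ w' = Real.cos α • w + Real.sin α • e := by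
  set c : ℝ := inner ℝ w w' with hc
  have hcb : |c| ≤ 1 := by
    have := abs_real_inner_le_norm w w'; rw [hw, hw'] at this; simpa using this
  have hcb' := abs_le.1 hcb
  have hcos : Real.cos (Real.arccos c) = c := Real.cos_arccos hcb'.1 hcb'.2
  have hsin : Real.sin (Real.arccos c) = √(1 - c ^ 2) := Real.sin_arccos c
  have hww : inner ℝ w w = (1:ℝ) := by rw [real_inner_self_eq_norm_sq, hw]; norm_num
  have hnz : ‖w' - c • w‖ ^ 2 = 1 - c ^ 2 := by
    rw [norm_sub_sq_real, norm_smul, hw, hw', inner_smul_right, real_inner_comm, ← hc]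
    simp; ring
  have hz : inner ℝ w (w' - c • w) = 0 := by
    rw [inner_sub_right, inner_smul_right, hww, ← hc]; ring
  by_cases h : w' - c • w = 0
  · obtain ⟨e, he, hwe⟩ := exists_orth w hw
    refine ⟨e, Real.arccos c, he, hwe, Real.arccos_nonneg _, Real.arccos_le_pi _, ?_⟩
    rw [hcos, hsin, ← hnz, h]
    simpa using sub_eq_zero.1 h
  · refine ⟨‖w' - c • w‖⁻¹ • (w' - c • w), Real.arccos c, norm_smul_inv_norm h, ?_, Real.arccos_nonneg _, Real.arccos_le_pi _, ?_⟩
    · rw [inner_smul_right, hz, mul_zero]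
    · rw [hcos, hsin, ← hnz, Real.sqrt_sq (norm_nonneg _), smul_smul, mul_inv_cancel₀ (norm_ne_zero_iff.2 h)]
      simp

lemma norm_rot {w e : R3} (hw : ‖w‖ = 1) (he : ‖e‖ = 1) (hwe : inner ℝ w e = 0) {s t : ℝ} (h : s ^ 2 + t ^ 2 = 1) :
    ‖s • w + t • e‖ = 1 := by
  have : ‖s • w + t • e‖ ^ 2 = 1 := by
    rw [norm_add_sq_real, norm_smul, norm_smul, inner_smul_left, inner_smul_right, hwe, hw, he]
    simp [h]
  nlinarith [norm_nonneg (s • w + t • e)]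

lemma osc_shell {h : R3 → ℝ} (hh : Sm h) {a b N : ℝ} (ha : 0 < a) (hab : a ≤ b)
    (hN : ∀ x, a ≤ ‖x‖ → ‖x‖ ≤ b → ‖fderiv ℝ h x‖ ≤ N) (x x' : R3) (hx : a ≤ ‖x‖ ∧ ‖x‖ ≤ b)
    (hx' : a ≤ ‖x'‖ ∧ ‖x'‖ ≤ b) : |h x' - h x| ≤ 5 * b * N := by
  have hx0 : x ≠ 0 := by intro h; simp [h] at hx; linarith
  have hx0' : x' ≠ 0 := by intro h; simp [h] at hx'; linarith
  have hN0 : 0 ≤ N := (norm_nonneg _).trans (hN x hx.1 hx.2)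
  obtain ⟨e, α, he, hwe, hα0, hαπ, hw'⟩ := exists_arc (‖x‖⁻¹ • x) (‖x'‖⁻¹ • x') (norm_smul_inv_norm hx0)
    (norm_smul_inv_norm hx0')
  have hw : ‖(‖x‖⁻¹ • x)‖ = 1 := norm_smul_inv_norm hx0
  set w := ‖x‖⁻¹ • x with hwdef
  set r := ‖x‖ with hr
  set r' := ‖x'‖ with hr'
  have hr0 : r ≠ 0 := by linarith [hx.1]
  have hr0' : r' ≠ 0 := by linarith [hx'.1]
  set c : ℝ → R3 := fun t => (r + t * (r' - r)) • (Real.cos (t * α) • w + Real.sin (t * α) • e) with hcdef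
  have c0 : c 0 = x := by simp [hcdef, hwdef, smul_smul, hr0]
  have c1 : c 1 = x' := by
    have : r + (r' - r) = r' := by ring
    simp only [hcdef, one_mul, this]; rw [← hw', smul_smul, mul_inv_cancel₀ hr0', one_smul]
  set c' : ℝ → R3 := fun t => (r + t * (r' - r)) • ((-Real.sin (t * α) * α) • w + (Real.cos (t * α) * α) • e)
    + (r' - r) • (Real.cos (t * α) • w + Real.sin (t * α) • e) with hc'def
  have hd : ∀ t, HasDerivAt c (c' t) t := by
    intro t
    have d1 : HasDerivAt (fun t : ℝ => r + t * (r' - r)) (r' - r) t := by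
      simpa using ((hasDerivAt_id t).mul_const (r' - r)).const_add r
    have d0 : HasDerivAt (fun t : ℝ => t * α) α t := by simpa using (hasDerivAt_id t).mul_const α
    exact d1.smul ((d0.cos.smul_const w).add (d0.sin.smul_const e))
  have hcn : ∀ t, ‖Real.cos (t * α) • w + Real.sin (t * α) • e‖ = 1 := fun t =>
    norm_rot hw he hwe (Real.cos_sq_add_sin_sq _)
  have hrad : ∀ t ∈ Set.Ico (0:ℝ) 1, a ≤ r + t * (r' - r) ∧ r + t * (r' - r) ≤ b := by
    intro t ht
    have h0 := ht.1; have h1 := ht.2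
    constructor <;> nlinarith [hx.1, hx.2, hx'.1, hx'.2]
  have key := norm_image_sub_le_of_norm_deriv_le_segment_01' (f := fun t => h (c t))
    (f' := fun t => fderiv ℝ h (c t) (c' t)) (C := 5 * b * N) (fun t _ =>
      ((hh.diff (c t)).hasFDerivAt.comp_hasDerivAt t (hd t)).hasDerivWithinAt) ?_
  · simpa [c0, c1] using key
  · intro t ht
    obtain ⟨q1, q2⟩ := hrad t ht
    have q0 : 0 ≤ r + t * (r' - r) := by linarith
    have hcnorm : ‖c t‖ = r + t * (r' - r) := by
      simp only [hcdef]; rw [norm_smul, hcn, mul_one, Real.norm_eq_abs, abs_of_nonneg q0]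
    have hc'norm : ‖c' t‖ ≤ 5 * b := by
      simp only [hc'def]
      refine (norm_add_le _ _).trans ?_
      have e1 : (-Real.sin (t * α) * α) • w + (Real.cos (t * α) * α) • e =
          α • ((-Real.sin (t * α)) • w + (Real.cos (t * α)) • e) := by
        module
      rw [e1, norm_smul, norm_smul, norm_smul, hcn, norm_rot hw he hwe (by rw [neg_sq, Real.sin_sq_add_cos_sq])]
      simp only [Real.norm_eq_abs, mul_one]
      rw [abs_of_nonneg q0, abs_of_nonneg hα0]
      have h1 : |r' - r| ≤ b := abs_le.2 ⟨by linarith [hx.2, hx'.1], by linarith [hx.1, hx'.2]⟩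
      have h2 : α ≤ 4 := hαπ.trans Real.pi_le_four
      nlinarith
    calc ‖fderiv ℝ h (c t) (c' t)‖ ≤ ‖fderiv ℝ h (c t)‖ * ‖c' t‖ := ContinuousLinearMap.le_opNorm _ _
      _ ≤ N * (5 * b) := mul_le_mul (hN _ (by rw [hcnorm]; exact q1) (by rw [hcnorm]; exact q2)) hc'norm (norm_nonneg _) hN0
      _ = 5 * b * N := by ring

structure Sys (U V : Fin 3 → R3 → ℝ) (π θ : R3 → ℝ) : Prop where
  sU : ∀ i, Sm (U i)
  sV : ∀ i, Sm (V i)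
  sπ : Sm π
  sθ : Sm θ
  eu : ∀ i x, dv (ee i) π x = lap (U i) x - ∑ j, U j x * dv (ee j) (U i) x -
    ∑ j, (V j x * dv (ee j) (V i) x + V i x * dv (ee j) (V j) x)
  ev : ∀ i x, lap (V i) x = (∑ j, U j x * dv (ee j) (V i) x) + dv (ee i) θ x + ∑ j, V j x * dv (ee j) (U i) x
  et : ∀ x, lap θ x = (∑ j, U j x * dv (ee j) θ x) + ∑ j, dv (ee j) (V j) x
  ed : ∀ x, ∑ j, dv (ee j) (U j) x = 0

lemma sm_coord {u : R3 → R3} (hu : ContDiff ℝ (⊤ : ℕ∞) u) (i : Fin 3) : Sm (fun x => u x i) := by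
  exact (EuclideanSpace.proj (𝕜 := ℝ) i).contDiff.comp hu

lemma Sys.of_tcm {u v : R3 → R3} {pr θ : R3 → ℝ}
    (hu : ContDiff ℝ (⊤ : ℕ∞) u) (hv : ContDiff ℝ (⊤ : ℕ∞) v)
    (hpr : ContDiff ℝ (⊤ : ℕ∞) pr) (hθ : ContDiff ℝ (⊤ : ℕ∞) θ)
    (hsol : TCM u v pr θ) : Sys (fun i x => u x i) (fun i x => v x i) pr θ := by
  obtain ⟨h1, h2, h3, h4⟩ := hsol
  refine ⟨sm_coord hu, sm_coord hv, hpr, hθ, fun i x => ?_, fun i x => ?_, fun x => ?_, h4⟩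
  · have := h1 i x
    simp only [pd_eq] at this
    simp only [dv_fmul (sm_coord hv _) (sm_coord hv _)] at this
    linear_combination this
  · have := h2 i x
    simp only [pd_eq] at this
    linear_combination -this
  · have := h3 x
    simp only [pd_eq] at this
    linear_combination -this

lemma sm_sum {f : Fin 3 → R3 → ℝ} (h : ∀ i, Sm (f i)) : Sm (fun x => ∑ i, f i x) :=
  ContDiff.sum fun i _ => h i

lemma dv_sum {f : Fin 3 → R3 → ℝ} (h : ∀ i, Sm (f i)) (b : R3) :
    dv b (fun x => ∑ i, f i x) = fun x => ∑ i, dv b (f i) x := by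
  funext x
  rw [dv, fderiv_fun_sum fun i _ => (h i).diff x]
  simp [dv]

/-- half energy density -/
def Wd (U V : Fin 3 → R3 → ℝ) (θ : R3 → ℝ) (x : R3) : ℝ :=
  (1 / 2) * ((∑ i, U i x * U i x) + (∑ i, V i x * V i x) + θ x * θ x)

def Sd (U V : Fin 3 → R3 → ℝ) (θ : R3 → ℝ) (x : R3) : ℝ := (∑ i, U i x * V i x) + θ x

/-- squared gradient -/
def g2 (f : R3 → ℝ) (x : R3) : ℝ := ∑ j, dv (ee j) f x ^ 2

def Ed (U V : Fin 3 → R3 → ℝ) (θ : R3 → ℝ) (x : R3) : ℝ :=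
  (∑ i, g2 (U i) x) + (∑ i, g2 (V i) x) + g2 θ x

section
variable {U V : Fin 3 → R3 → ℝ} {π θ : R3 → ℝ}

lemma Sys.sW (S : Sys U V π θ) : Sm (Wd U V θ) :=
  contDiff_const.mul (((sm_sum fun i => (S.sU i).mul (S.sU i)).add (sm_sum fun i => (S.sV i).mul (S.sV i))).add
    (S.sθ.mul S.sθ))

lemma Sys.sS (S : Sys U V π θ) : Sm (Sd U V θ) :=
  (sm_sum fun i => (S.sU i).mul (S.sV i)).add S.sθ

lemma Sys.dW (S : Sys U V π θ) (b : R3) : dv b (Wd U V θ) = fun x =>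
    ((∑ i, U i x * dv b (U i) x) + (∑ i, V i x * dv b (V i) x)) + θ x * dv b θ x := by
  have h1 := sm_sum fun i => (S.sU i).mul (S.sU i)
  have h2 := sm_sum fun i => (S.sV i).mul (S.sV i)
  have : Wd U V θ = fun x => (1 / 2) * (((∑ i, U i x * U i x) + (∑ i, V i x * V i x)) + θ x * θ x) := rfl
  rw [this, dv_fconst ((h1.add h2).add (S.sθ.mul S.sθ)), dv_fadd (h1.add h2) (S.sθ.mul S.sθ), dv_fadd h1 h2,
    dv_sum fun i => (S.sU i).mul (S.sU i), dv_sum fun i => (S.sV i).mul (S.sV i), dv_fmul S.sθ S.sθ]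
  funext x
  simp only [dv_fmul (S.sU _) (S.sU _), dv_fmul (S.sV _) (S.sV _), Fin.sum_univ_three]
  ring

lemma Sys.ddW (S : Sys U V π θ) (b : R3) : dv b (dv b (Wd U V θ)) = fun x =>
    ((∑ i, (U i x * dv b (dv b (U i)) x + dv b (U i) x ^ 2)) + (∑ i, (V i x * dv b (dv b (V i)) x + dv b (V i) x ^ 2)))
      + (θ x * dv b (dv b θ) x + dv b θ x ^ 2) := by
  have h1 := sm_sum fun i => (S.sU i).mul ((S.sU i).dv b)
  have h2 := sm_sum fun i => (S.sV i).mul ((S.sV i).dv b)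
  rw [S.dW, dv_fadd (h1.add h2) (S.sθ.mul (S.sθ.dv b)), dv_fadd h1 h2,
    dv_sum fun i => (S.sU i).mul ((S.sU i).dv b), dv_sum fun i => (S.sV i).mul ((S.sV i).dv b), dv_fmul S.sθ (S.sθ.dv b)]
  funext x
  simp only [dv_fmul (S.sU _) ((S.sU _).dv b), dv_fmul (S.sV _) ((S.sV _).dv b), Fin.sum_univ_three]
  ring

lemma Sys.dS (S : Sys U V π θ) (b : R3) : dv b (Sd U V θ) = fun x =>
    (∑ i, (U i x * dv b (V i) x + V i x * dv b (U i) x)) + dv b θ x := by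
  have h1 := sm_sum fun i => (S.sU i).mul (S.sV i)
  have : Sd U V θ = fun x => (∑ i, U i x * V i x) + θ x := rfl
  rw [this, dv_fadd h1 S.sθ, dv_sum fun i => (S.sU i).mul (S.sV i)]
  funext x
  simp only [dv_fmul (S.sU _) (S.sV _)]

lemma Sys.pointwise (S : Sys U V π θ) (x : R3) : Ed U V θ x =
    lap (Wd U V θ) x - ∑ j, (U j x * (dv (ee j) (Wd U V θ) x + dv (ee j) π x) + (Wd U V θ x + π x) * dv (ee j) (U j) x)
     - ∑ j, (V j x * dv (ee j) (Sd U V θ) x + Sd U V θ x * dv (ee j) (V j) x) := by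
  have hw : lap (Wd U V θ) x = (∑ i, U i x * lap (U i) x) + (∑ i, V i x * lap (V i) x) + θ x * lap θ x + Ed U V θ x := by
    simp only [lap_eq, S.ddW, Ed, g2, Fin.sum_univ_three]; ring
  rw [hw]
  have hd := S.ed x
  simp only [S.ev, S.et, S.eu, S.dW, S.dS]
  rw [Sd]
  simp only [Fin.sum_univ_three] at hd ⊢
  linear_combination (-(Wd U V θ x + π x)) * (-hd)

lemma Sys.energy (S : Sys U V π θ) {η : R3 → ℝ} (hη : Sm η) (hc : HasCompactSupport η) :
    ∫ x, η x * Ed U V θ x = (∫ x, Wd U V θ x * lap η x) + ∑ j, ∫ x, dv (ee j) η x * (U j x * (Wd U V θ x + π x) +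
      V j x * Sd U V θ x) := by
  have sQ : ∀ j, Sm (fun x => U j x * (Wd U V θ x + π x) + V j x * Sd U V θ x) := fun j =>
    ((S.sU j).mul (S.sW.add S.sπ)).add ((S.sV j).mul S.sS)
  have dQ : ∀ j, dv (ee j) (fun x => U j x * (Wd U V θ x + π x) + V j x * Sd U V θ x) = fun x =>
      (U j x * (dv (ee j) (Wd U V θ) x + dv (ee j) π x) + (Wd U V θ x + π x) * dv (ee j) (U j) x)
       + (V j x * dv (ee j) (Sd U V θ) x + Sd U V θ x * dv (ee j) (V j) x) := by
    intro j
    rw [dv_fadd ((S.sU j).mul (S.sW.add S.sπ)) ((S.sV j).mul S.sS), dv_fmul (S.sU j) (S.sW.add S.sπ),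
      dv_fmul (S.sV j) S.sS, dv_fadd S.sW S.sπ]
  have e1 : ∀ x, η x * Ed U V θ x = (∑ j, η x * dv (ee j) (dv (ee j) (Wd U V θ)) x) -
      ∑ j, η x * dv (ee j) (fun x => U j x * (Wd U V θ x + π x) + V j x * Sd U V θ x) x := by
    intro x
    rw [S.pointwise]
    simp only [dQ, lap_eq, Fin.sum_univ_three]; ring
  have i1 : ∀ {f : R3 → ℝ}, Sm f → Integrable fun x => η x * f x := fun hf =>
    (CC.integrable ⟨hη.continuous.mul hf.continuous, hc.mul_right⟩)
  simp only [e1]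
  rw [integral_sub (integrable_finset_sum _ fun j _ => i1 ((S.sW.dv _).dv _))
    (integrable_finset_sum _ fun j _ => i1 ((sQ j).dv _)), integral_finset_sum _ fun j _ => i1 ((S.sW.dv _).dv _),
    integral_finset_sum _ fun j _ => i1 ((sQ j).dv _)]
  have e2 : ∀ j, ∫ x, η x * dv (ee j) (dv (ee j) (Wd U V θ)) x = ∫ x, Wd U V θ x * dv (ee j) (dv (ee j) η) x := by
    intro j
    rw [ibp hη (S.sW.dv _) hc, ibp (hη.dv _) S.sW (hcs_dv hc _), neg_neg]
    congr 1; funext x; ring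
  have e3 : ∫ x, Wd U V θ x * lap η x = ∑ j, ∫ x, Wd U V θ x * dv (ee j) (dv (ee j) η) x := by
    rw [← integral_finset_sum]
    · congr 1; funext x; rw [lap_eq]; simp only [Fin.sum_univ_three]; ring
    · intro j _
      exact CC.integrable ⟨S.sW.continuous.mul ((hη.dv _).dv _).continuous, (hcs_dv (hcs_dv hc _) _).mul_left⟩
  rw [e3, Finset.sum_congr rfl fun j _ => e2 j, Finset.sum_congr rfl fun j _ => ibp hη (sQ j) hc (ee j)]
  simp
end

/-- bounded measurable -/
def BM (E : Set R3) : Prop := MeasurableSet E ∧ Bornology.IsBounded E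

lemma BM.int {E : Set R3} (h : BM E) {f : R3 → ℝ} (hf : Continuous f) : IntegrableOn f E := by
  obtain ⟨r, hr⟩ := h.2.subset_closedBall 0
  exact (hf.continuousOn.integrableOn_compact (isCompact_closedBall 0 r)).mono_set hr

def Sh (ρ τ : ℝ) : Set R3 := ball 0 τ \ ball 0 ρ

lemma BM_Sh (ρ τ : ℝ) : BM (Sh ρ τ) :=
  ⟨measurableSet_ball.diff measurableSet_ball, isBounded_ball.subset Set.diff_subset⟩
lemma BM_ball (ρ : ℝ) : BM (ball 0 ρ) := ⟨measurableSet_ball, isBounded_ball⟩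

lemma mem_Sh {ρ τ : ℝ} {x : R3} : x ∈ Sh ρ τ ↔ ρ ≤ ‖x‖ ∧ ‖x‖ < τ := by
  simp [Sh, and_comm]

lemma BM.hold {E : Set R3} (h : BM E) {f g : R3 → ℝ} (hf : Continuous f) (hg : Continuous g) (f0 : ∀ x, 0 ≤ f x)
    (g0 : ∀ x, 0 ≤ g x) {P Q : ℝ} (hP : 1 < P) (hQ : Q = P / (P - 1)) :
    ∫ x in E, f x * g x ≤ (∫ x in E, f x ^ P) ^ (1 / P) * (∫ x in E, g x ^ Q) ^ (1 / Q) := by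
  have hc : P.HolderConjugate Q := by
    rw [hQ]; exact Real.HolderConjugate.conjExponent hP
  have mem : ∀ {f : R3 → ℝ} {P : ℝ}, Continuous f → 0 < P → (∀ x, 0 ≤ f x) → MemLp f (ENNReal.ofReal P) (volume.restrict E) := by
    intro f P hf hP f0
    refine (integrable_norm_rpow_iff (μ := volume.restrict E) (p := ENNReal.ofReal P) hf.aestronglyMeasurable (by simpa) (by simp)).1 ?_
    rw [ENNReal.toReal_ofReal hP.le]
    exact h.int (hf.norm.rpow_const fun x => Or.inr hP.le)
  exact integral_mul_le_Lp_mul_Lq_of_nonneg hc (Eventually.of_forall f0) (Eventually.of_forall g0)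
    (mem hf hc.pos f0) (mem hg hc.symm.pos g0)

lemma cont_rpow {f : R3 → ℝ} (hf : Continuous f) {P : ℝ} (hP : 0 ≤ P) : Continuous fun x => f x ^ P :=
  hf.rpow_const fun _ => Or.inr hP

lemma setint_nonneg {E : Set R3} {f : R3 → ℝ} (f0 : ∀ x, 0 ≤ f x) (P : ℝ) : 0 ≤ ∫ x in E, f x ^ P :=
  integral_nonneg fun x => Real.rpow_nonneg (f0 x) P

/-- Interpolation. -/
lemma BM.interp {E : Set R3} (h : BM E) {f : R3 → ℝ} (hf : Continuous f) (f0 : ∀ x, 0 ≤ f x)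
    {k l m t : ℝ} (hk : 0 < k) (hl : 0 < l) (ht : 0 < t) (ht1 : t < 1) (hm : m = k * t + l * (1 - t)) :
    ∫ x in E, f x ^ m ≤ (∫ x in E, f x ^ k) ^ t * (∫ x in E, f x ^ l) ^ (1 - t) := by
  have h1t : 0 < 1 - t := by linarith
  have := h.hold (f := fun x => f x ^ (k * t)) (g := fun x => f x ^ (l * (1 - t)))
    (cont_rpow hf (by positivity)) (cont_rpow hf (by positivity)) (fun x => Real.rpow_nonneg (f0 x) _)
    (fun x => Real.rpow_nonneg (f0 x) _) (P := 1 / t) (Q := 1 / (1 - t)) (by rw [lt_div_iff₀ ht]; linarith)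
    (by field_simp)
  simp only [one_div_one_div] at this
  have e1 : ∀ x, (f x ^ (k * t)) ^ (1 / t) = f x ^ k := fun x => by
    rw [← Real.rpow_mul (f0 x)]; congr 1; field_simp
  have e2 : ∀ x, (f x ^ (l * (1 - t))) ^ (1 / (1 - t)) = f x ^ l := fun x => by
    rw [← Real.rpow_mul (f0 x)]; congr 1; field_simp
  have e3 : ∀ x, f x ^ (k * t) * f x ^ (l * (1 - t)) = f x ^ m := fun x => by
    rw [← Real.rpow_add_of_nonneg (f0 x) (by positivity) (by positivity), hm]
  simp only [e1, e2, e3] at this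
  exact this

/-- Lowering the exponent, `m < k`. -/
lemma BM.lower {E : Set R3} (h : BM E) {f : R3 → ℝ} (hf : Continuous f) (f0 : ∀ x, 0 ≤ f x)
    {k m : ℝ} (hm : 0 < m) (hk : m ≤ k) :
    ∫ x in E, f x ^ m ≤ (∫ x in E, f x ^ k) ^ (m / k) * (volume.real E) ^ (1 - m / k) := by
  have hk0 : 0 < k := hm.trans_le hk
  rcases hk.eq_or_lt with rfl | hk
  · simp [hm.ne']
  have hm1 : m / k < 1 := by rwa [div_lt_one hk0]
  have := h.hold (f := fun x => f x ^ m) (g := fun _ => 1) (cont_rpow hf hm.le) continuous_const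
    (fun x => Real.rpow_nonneg (f0 x) _) (fun _ => zero_le_one) (P := k / m) (Q := (k / m) / (k / m - 1))
    (by rwa [lt_div_iff₀ hm, one_mul]) rfl
  have e1 : ∀ x, (f x ^ m) ^ (k / m) = f x ^ k := fun x => by
    rw [← Real.rpow_mul (f0 x)]; congr 1; field_simp
  have e2 : 1 / ((k / m) / (k / m - 1)) = 1 - m / k := by
    have : k - m ≠ 0 := by linarith
    field_simp
  simp only [e1, e2, one_div_div, Real.one_rpow, mul_one, integral_const, smul_eq_mul] at this
  rwa [measureReal_restrict_apply_univ] at this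

lemma vol_Sh : ∃ C, 1 ≤ C ∧ ∀ R ρ τ : ℝ, 0 < R → τ ≤ 2 * R → volume.real (Sh ρ τ) ≤ C * R ^ 3 := by
  refine ⟨max 1 (8 * volume.real (ball (0:R3) 1)), le_max_left _ _, fun R ρ τ hR hτ => ?_⟩
  have h1 : volume.real (Sh ρ τ) ≤ volume.real (ball (0:R3) (2 * R)) :=
    measureReal_mono (Set.diff_subset.trans (ball_subset_ball hτ)) measure_ball_lt_top.ne
  refine h1.trans ?_
  rw [measureReal_def, Measure.addHaar_ball _ _ (by positivity)]
  simp only [finrank_euclideanSpace, Fintype.card_fin, ENNReal.toReal_mul]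
  rw [ENNReal.toReal_ofReal (by positivity), ← measureReal_def]
  have := le_max_right 1 (8 * volume.real (ball (0:R3) 1))
  nlinarith [pow_pos hR 3]

lemma smcc_int {f g : R3 → ℝ} (hf : Sm f) (hg : Sm g) (hc : HasCompactSupport g) : Integrable fun x => f x * g x :=
  CC.integrable ⟨hf.continuous.mul hg.continuous, hc.mul_left⟩

lemma hcs_lap {f : R3 → ℝ} (hc : HasCompactSupport f) : HasCompactSupport (lap f) := by
  have : lap f = fun x => (dv (ee 0) (dv (ee 0) f) x + dv (ee 1) (dv (ee 1) f) x) +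
    dv (ee 2) (dv (ee 2) f) x := funext (lap_eq f)
  rw [this]
  exact ((hcs_dv (hcs_dv hc _) _).add (hcs_dv (hcs_dv hc _) _)).add (hcs_dv (hcs_dv hc _) _)

lemma ibp_lap {f g : R3 → ℝ} (hf : Sm f) (hg : Sm g) (hc : HasCompactSupport g) :
    ∫ x, lap f x * g x = ∫ x, f x * lap g x := by
  have key : ∀ j, ∫ x, dv (ee j) (dv (ee j) f) x * g x = ∫ x, f x * dv (ee j) (dv (ee j) g) x := by
    intro j
    rw [ibp' hf (hg.dv _) (hcs_dv hc _), ibp' (hf.dv _) hg hc, neg_neg]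
  have e1 : ∀ x, lap f x * g x = ∑ j, dv (ee j) (dv (ee j) f) x * g x := fun x => by
    rw [lap_eq, Fin.sum_univ_three]; ring
  have e2 : ∀ x, f x * lap g x = ∑ j, f x * dv (ee j) (dv (ee j) g) x := fun x => by
    rw [lap_eq, Fin.sum_univ_three]; ring
  simp only [e1, e2]
  rw [integral_finsetSum, integral_finsetSum]
  · exact Finset.sum_congr rfl fun j _ => key j
  · exact fun j _ => smcc_int hf ((hg.dv _).dv _) (hcs_dv (hcs_dv hc _) _)
  · exact fun j _ => smcc_int ((hf.dv _).dv _) hg hc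

lemma dv_lap {f : R3 → ℝ} (hf : Sm f) (b : R3) : lap (dv b f) = dv b (lap f) := by
  have : lap f = fun x => (dv (ee 0) (dv (ee 0) f) x + dv (ee 1) (dv (ee 1) f) x) +
    dv (ee 2) (dv (ee 2) f) x := funext (lap_eq f)
  have s : ∀ i, Sm (dv (ee i) (dv (ee i) f)) := fun i => (hf.dv _).dv _
  rw [this, dv_fadd ((s 0).add (s 1)) (s 2), dv_fadd (s 0) (s 1)]
  funext x
  rw [lap_eq]
  have c : ∀ i, dv (ee i) (dv (ee i) (dv b f)) = dv b (dv (ee i) (dv (ee i) f)) := fun i => by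
    rw [dv_comm hf (ee i) b, dv_comm (hf.dv _) (ee i) b]
  simp only [c]

def Pt (U V : Fin 3 → R3 → ℝ) (i j : Fin 3) (x : R3) : ℝ := U i x * U j x + V i x * V j x

section
variable {U V : Fin 3 → R3 → ℝ} {π θ : R3 → ℝ}

lemma Sys.sP (S : Sys U V π θ) (i j : Fin 3) : Sm (Pt U V i j) :=
  ((S.sU i).mul (S.sU j)).add ((S.sV i).mul (S.sV j))

lemma Sys.eu' (S : Sys U V π θ) (i : Fin 3) (x : R3) :
    dv (ee i) π x = lap (U i) x - ∑ j, dv (ee j) (Pt U V i j) x := by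
  have : ∀ j, dv (ee j) (Pt U V i j) = fun x => (U i x * dv (ee j) (U j) x + U j x * dv (ee j) (U i) x) +
     (V i x * dv (ee j) (V j) x + V j x * dv (ee j) (V i) x) := by
    intro j
    have : Pt U V i j = fun x => U i x * U j x + V i x * V j x := rfl
    rw [this, dv_fadd ((S.sU i).mul (S.sU j)) ((S.sV i).mul (S.sV j)), dv_fmul (S.sU _) (S.sU _),
      dv_fmul (S.sV _) (S.sV _)]
  simp only [this]
  rw [S.eu]
  have hd := S.ed x
  simp only [Fin.sum_univ_three] at hd ⊢
  linear_combination (U i x) * hd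

lemma Sys.pair (S : Sys U V π θ) (i : Fin 3) {ψ : R3 → ℝ} (hψ : Sm ψ) (hc : HasCompactSupport ψ) :
    ∫ x, dv (ee i) π x * ψ x = (∫ x, U i x * lap ψ x) + ∑ j, ∫ x, Pt U V i j x * dv (ee j) ψ x := by
  have e1 : ∀ x, dv (ee i) π x * ψ x = lap (U i) x * ψ x - ∑ j, dv (ee j) (Pt U V i j) x * ψ x := fun x => by
    rw [S.eu', ← Finset.sum_mul]; ring
  simp only [e1]
  have i1 : ∀ j, Integrable fun x => dv (ee j) (Pt U V i j) x * ψ x := fun j =>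
    smcc_int ((S.sP i j).dv _) hψ hc
  rw [integral_sub (smcc_int (sm_lap (S.sU i)) hψ hc) (integrable_finsetSum _ fun j _ => i1 j),
    integral_finsetSum _ fun j _ => i1 j, ibp_lap (S.sU i) hψ hc]
  simp only [ibp' (S.sP i _) hψ hc]
  rw [sub_eq_add_neg, Finset.sum_neg_distrib]

lemma Sys.pres (S : Sys U V π θ) {Φ : R3 → ℝ} (hΦ : Sm Φ) (hc : HasCompactSupport Φ) :
    ∫ x, π x * lap Φ x = -∑ i, ∑ j, ∫ x, Pt U V i j x * dv (ee j) (dv (ee i) Φ) x := by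
  have e2 : ∀ x, π x * lap Φ x = ∑ j, π x * dv (ee j) (dv (ee j) Φ) x := fun x => by
    rw [lap_eq, Fin.sum_univ_three]; ring
  simp only [e2]
  rw [integral_finsetSum _ fun j _ => smcc_int S.sπ ((hΦ.dv _).dv _) (hcs_dv (hcs_dv hc _) _)]
  have e3 : ∀ i, ∫ x, π x * dv (ee i) (dv (ee i) Φ) x = (∫ x, dv (ee i) (U i) x * lap Φ x) -
      ∑ j, ∫ x, Pt U V i j x * dv (ee j) (dv (ee i) Φ) x := by
    intro i
    rw [ibp' S.sπ (hΦ.dv _) (hcs_dv hc _), S.pair i (hΦ.dv _) (hcs_dv hc _), dv_lap hΦ,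
      ibp' (S.sU i) (sm_lap hΦ) (hcs_lap hc)]
    ring
  simp only [e3]
  rw [Finset.sum_sub_distrib, ← integral_finsetSum _ fun j _ => smcc_int ((S.sU j).dv _) (sm_lap hΦ) (hcs_lap hc)]
  simp only [← Finset.sum_mul, S.ed]
  simp
end

/-- cutoff -/
structure IsCut (η : R3 → ℝ) (C0 ρ τ : ℝ) : Prop where
  sm : Sm η
  n0 : ∀ x, 0 ≤ η x
  l1 : ∀ x, η x ≤ 1
  e1 : ∀ x, ‖x‖ ≤ ρ → η x = 1
  e0 : ∀ x, ρ + (τ - ρ) / 2 ≤ ‖x‖ → η x = 0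
  d1 : ∀ j x, |dv (ee j) η x| ≤ C0 / (τ - ρ)
  d2 : ∀ x, |lap η x| ≤ C0 / (τ - ρ) ^ 2
  z1 : ∀ j x, (‖x‖ < ρ + (τ - ρ) / 4 ∨ ρ + (τ - ρ) / 2 < ‖x‖) → dv (ee j) η x = 0
  z2 : ∀ x, (‖x‖ < ρ + (τ - ρ) / 4 ∨ ρ + (τ - ρ) / 2 < ‖x‖) → lap η x = 0

lemma IsCut.hc {η : R3 → ℝ} {C0 ρ τ : ℝ} (h : IsCut η C0 ρ τ) : HasCompactSupport η := cs_of_ball h.e0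

lemma exists_cut : ∃ C0, 0 < C0 ∧ ∀ ρ τ : ℝ, 0 < ρ → ρ < τ → ∃ η, IsCut η C0 ρ τ := by
  obtain ⟨C, hC, h⟩ := exists_cutoff
  refine ⟨16 * C, by positivity, fun ρ τ hρ hτ => ?_⟩
  obtain ⟨η, h1, h2, h3, h4, h5, h6, h7⟩ := h (ρ + (τ - ρ) / 4) (ρ + (τ - ρ) / 2) (by linarith) (by linarith)
  have hd : 0 < τ - ρ := by linarith
  have e : ρ + (τ - ρ) / 2 - (ρ + (τ - ρ) / 4) = (τ - ρ) / 4 := by ring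
  rw [e] at h5 h6
  refine ⟨η, h1, fun x => (h2 x).1, fun x => (h2 x).2, fun x hx => h3 x (by linarith), h4, fun j x => (h5 j x).trans ?_,
    fun x => (h6 x).trans ?_, fun j x hx => (h7 x hx).1 j, fun x hx => (h7 x hx).2⟩
  · rw [div_le_div_iff₀ (by positivity) hd]; nlinarith [mul_pos hC hd]
  · rw [div_le_div_iff₀ (by positivity) (by positivity)]; nlinarith [mul_pos hC (pow_pos hd 2)]

structure Ctx (C0 : ℝ) (κ φ : R3 → ℝ) (U V : Fin 3 → R3 → ℝ) (π θ a b η : R3 → ℝ) (ρ τ : ℝ) : Prop where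
  S : Sys U V π θ
  m : IsMoll κ φ
  cut : IsCut η C0 ρ τ
  ca : Continuous a
  cb : Continuous b
  ha : ∀ i x, |U i x| ≤ a x
  hb : ∀ i x, |V i x| ≤ b x
  hC0 : 0 < C0
  hρ : 0 < ρ
  hτ : ρ < τ

def ff (U : Fin 3 → R3 → ℝ) (η : R3 → ℝ) (x : R3) : ℝ := ∑ j, U j x * dv (ee j) η x

section
variable {C0 : ℝ} {κ φ : R3 → ℝ} {U V : Fin 3 → R3 → ℝ} {π θ a b η : R3 → ℝ} {ρ τ : ℝ}

lemma Ctx.a0 (c : Ctx C0 κ φ U V π θ a b η ρ τ) (x : R3) : 0 ≤ a x := (abs_nonneg _).trans (c.ha 0 x)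
lemma Ctx.b0 (c : Ctx C0 κ φ U V π θ a b η ρ τ) (x : R3) : 0 ≤ b x := (abs_nonneg _).trans (c.hb 0 x)
lemma Ctx.d0 (c : Ctx C0 κ φ U V π θ a b η ρ τ) : 0 < τ - ρ := sub_pos.2 c.hτ

lemma Ctx.sf (c : Ctx C0 κ φ U V π θ a b η ρ τ) : Sm (ff U η) := sm_sum fun j => (c.S.sU j).mul (c.cut.sm.dv _)

lemma Ctx.fz (c : Ctx C0 κ φ U V π θ a b η ρ τ) {x : R3} (hx : ‖x‖ < ρ + (τ - ρ) / 4 ∨ ρ + (τ - ρ) / 2 < ‖x‖) :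
    ff U η x = 0 := by
  simp [ff, c.cut.z1 _ x hx]

lemma Ctx.cf (c : Ctx C0 κ φ U V π θ a b η ρ τ) : HasCompactSupport (ff U η) :=
  cs_of_ball (r := τ) fun y hy => c.fz (Or.inr (by linarith [c.d0]))

lemma Ctx.fb (c : Ctx C0 κ φ U V π θ a b η ρ τ) (x : R3) : |ff U η x| ≤ 3 * C0 / (τ - ρ) * a x := by
  have : ∀ j, |U j x * dv (ee j) η x| ≤ a x * (C0 / (τ - ρ)) := fun j => by
    rw [abs_mul]
    exact mul_le_mul (c.ha j x) (c.cut.d1 j x) (abs_nonneg _) (c.a0 x)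
  refine (Finset.abs_sum_le_sum_abs _ _).trans ((Finset.sum_le_sum fun j _ => this j).trans (le_of_eq ?_))
  simp; ring

lemma Ctx.fi (c : Ctx C0 κ φ U V π θ a b η ρ τ) : ∫ x, ff U η x = 0 := by
  simp only [ff]
  rw [integral_finsetSum _ fun j _ => smcc_int (c.S.sU j) (c.cut.sm.dv _) (hcs_dv c.cut.hc _)]
  simp only [ibp' (c.S.sU _) c.cut.sm c.cut.hc]
  rw [Finset.sum_neg_distrib, ← integral_finsetSum _ fun j _ => smcc_int ((c.S.sU j).dv _) c.cut.sm c.cut.hc]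
  simp only [← Finset.sum_mul, c.S.ed]
  simp

lemma int_eq_set {F : R3 → ℝ} {ρ τ : ℝ} (h : ∀ x, x ∉ Sh ρ τ → F x = 0) : ∫ x, F x = ∫ x in Sh ρ τ, F x :=
  (setIntegral_eq_integral_of_forall_compl_eq_zero h).symm

lemma Ctx.fP (c : Ctx C0 κ φ U V π θ a b η ρ τ) {P : ℝ} (hP : 0 < P) :
    ∫ x, |ff U η x| ^ P ≤ (3 * C0 / (τ - ρ)) ^ P * ∫ x in Sh ρ τ, a x ^ P := by
  have hd := c.d0
  have := c.hC0
  rw [int_eq_set (ρ := ρ) (τ := τ), ← integral_const_mul]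
  · refine setIntegral_mono_on ((BM_Sh ρ τ).int (cont_rpow c.sf.continuous.abs hP.le))
      ((BM_Sh ρ τ).int (continuous_const.mul (cont_rpow c.ca hP.le))) (BM_Sh ρ τ).1 fun x _ => ?_
    rw [← Real.mul_rpow (by positivity) (c.a0 x)]
    exact Real.rpow_le_rpow (abs_nonneg _) (c.fb x) hP.le
  · intro x hx
    rw [mem_Sh, not_and_or, not_le, not_lt] at hx
    rw [c.fz, abs_zero, Real.zero_rpow hP.ne']
    rcases hx with hx | hx
    · left; linarith
    · right; linarith

lemma Ctx.exΦ (c : Ctx C0 κ φ U V π θ a b η ρ τ) : ∃ Φ, Sm Φ ∧ (∀ x, x ∉ Sh ρ τ → Φ x = 0) ∧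
    (∀ x, (‖x‖ < ρ + (τ - ρ) / 8 ∨ ρ + (τ - ρ) * (5 / 8) < ‖x‖) → Φ x = 0) ∧
    ∀ x, lap Φ x = ff U η x - mo φ ((τ - ρ) / 8) (ff U η) x := by
  have hd := c.d0
  obtain ⟨Φ, h1, h2, h3⟩ := c.m.potential c.sf (δ := (τ - ρ) / 8) (by linarith)
  have key : ∀ x, (‖x‖ < ρ + (τ - ρ) / 8 ∨ ρ + (τ - ρ) * (5 / 8) < ‖x‖) → Φ x = 0 := by
    intro x hx
    refine h2 x fun z hz => c.fz ?_
    have t1 := norm_sub_norm_le z x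
    have t2 := norm_sub_norm_le x z
    rw [norm_sub_rev] at t2
    rcases hx with hx | hx
    · left; linarith
    · right; linarith
  refine ⟨Φ, h1, fun x hx => key x ?_, key, h3⟩
  rw [mem_Sh, not_and_or, not_le, not_lt] at hx
  rcases hx with hx | hx
  · left; linarith
  · right; linarith

lemma czP (P : ℝ) (hP : 2 ≤ P) : ∃ C, 0 < C ∧ ∀ (κ φ f Φ : R3 → ℝ) (δ : ℝ), IsMoll κ φ → CC f → Sm Φ → HasCompactSupport Φ →
    (∀ x, lap Φ x = f x - mo φ δ f x) → ∀ i j, ∫ x, |dv (ee j) (dv (ee i) Φ) x| ^ P ≤ C * ∫ x, |f x| ^ P := by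
  obtain ⟨C, hC, h⟩ := cz P hP
  refine ⟨C * (2 ^ P * 2), by positivity, fun κ φ f Φ δ m hf hΦ hc hl i j => ?_⟩
  have hP0 : 0 < P := by linarith
  have hmo := m.mo_p hf δ (p := P) (by linarith)
  have hlap : CC (lap Φ) := ⟨(sm_lap hΦ).continuous, hcs_lap hc⟩
  have hmc : CC (mo φ δ f) := by
    have : mo φ δ f = fun x => f x - lap Φ x := by funext x; rw [hl]; ring
    rw [this]; exact hf.sub hlap
  have h1 : ∫ x, |lap Φ x| ^ P ≤ 2 ^ P * ((∫ x, |f x| ^ P) + ∫ x, |mo φ δ f x| ^ P) := by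
    rw [← integral_add (hf.rpow hP0).integrable (hmc.rpow hP0).integrable, ← integral_const_mul]
    refine integral_mono (hlap.rpow hP0).integrable
      (((hf.rpow hP0).integrable.add (hmc.rpow hP0).integrable).const_mul _) fun x => ?_
    simp only [Pi.add_apply, hl]
    set A := |f x|
    set B := |mo φ δ f x|
    have hA : 0 ≤ A := abs_nonneg _
    have hB : 0 ≤ B := abs_nonneg _
    have hm : 0 ≤ max A B := le_max_of_le_left hA
    calc |f x - mo φ δ f x| ^ P ≤ (2 * max A B) ^ P := by
          refine Real.rpow_le_rpow (abs_nonneg _) ((abs_sub _ _).trans ?_) hP0.le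
          linarith [le_max_left A B, le_max_right A B]
      _ = 2 ^ P * (max A B) ^ P := Real.mul_rpow (by norm_num) hm
      _ ≤ 2 ^ P * (A ^ P + B ^ P) := by
          gcongr
          rcases max_cases A B with ⟨h, _⟩ | ⟨h, _⟩ <;> rw [h] <;>
            linarith [Real.rpow_nonneg hA P, Real.rpow_nonneg hB P]
  refine (h Φ hΦ hc i j).trans ?_
  rw [mul_assoc]
  gcongr
  refine h1.trans ?_
  rw [mul_assoc]
  gcongr
  linarith

lemma Ctx.part1 {C0 : ℝ} (hC0 : 0 < C0) (P : ℝ) (hP : 2 ≤ P) : ∃ C, 0 < C ∧ ∀ {κ φ : R3 → ℝ} {U V : Fin 3 → R3 → ℝ}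
    {π θ a b η : R3 → ℝ} {ρ τ : ℝ} (_ : Ctx C0 κ φ U V π θ a b η ρ τ) {Φ : R3 → ℝ}, Sm Φ → (∀ x, x ∉ Sh ρ τ → Φ x = 0) →
    (∀ x, (‖x‖ < ρ + (τ - ρ) / 8 ∨ ρ + (τ - ρ) * (5 / 8) < ‖x‖) → Φ x = 0) →
    (∀ x, lap Φ x = ff U η x - mo φ ((τ - ρ) / 8) (ff U η) x) → ∀ {G g : R3 → ℝ}, Continuous G → Continuous g →
    (∀ x, |G x| ≤ g x) → ∀ i j, |∫ x, G x * dv (ee j) (dv (ee i) Φ) x| ≤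
      C * (τ - ρ)⁻¹ * ((∫ x in Sh ρ τ, g x ^ (P / (P - 1))) ^ (1 / (P / (P - 1))) * (∫ x in Sh ρ τ, a x ^ P) ^ (1 / P)) := by
  obtain ⟨C, hC, h⟩ := czP P hP
  refine ⟨C ^ (1 / P) * (3 * C0), by positivity, fun {κ φ U V π θ a b η ρ τ} c {Φ} hΦ hz hz' hl {G g} hG hg hGg i j => ?_⟩
  have hP0 : 0 < P := by linarith
  have hd := c.d0
  have hcs : HasCompactSupport Φ := cs_of_ball (r := τ) fun x hx => hz x (by rw [mem_Sh]; simp [hx])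
  have hv : ∀ x, x ∉ Sh ρ τ → dv (ee j) (dv (ee i) Φ) x = 0 := by
    intro x hx
    have ev : ∀ᶠ y in nhds x, Φ y = 0 := by
      rw [mem_Sh, not_and_or, not_le, not_lt] at hx
      rcases hx with hx | hx
      · have : ∀ᶠ y in nhds x, ‖y‖ < ρ + (τ - ρ) / 8 :=
          (continuous_norm.continuousAt).eventually (gt_mem_nhds (by linarith))
        exact this.mono fun y hy => hz' y (Or.inl hy)
      · have : ∀ᶠ y in nhds x, ρ + (τ - ρ) * (5 / 8) < ‖y‖ :=
          (continuous_norm.continuousAt).eventually (lt_mem_nhds (by linarith))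
        exact this.mono fun y hy => hz' y (Or.inr hy)
    have ev2 : ∀ᶠ y in nhds x, dv (ee i) Φ y = 0 := by
      refine ev.eventually_nhds.mono fun y hy => ?_
      have : fderiv ℝ Φ y = fderiv ℝ (fun _ => (0:ℝ)) y := EventuallyEq.fderiv_eq hy
      simp [dv, this]
    have : fderiv ℝ (dv (ee i) Φ) x = fderiv ℝ (fun _ => (0:ℝ)) x := EventuallyEq.fderiv_eq ev2
    rw [dv, this]; simp
  have hcont : Continuous (dv (ee j) (dv (ee i) Φ)) := ((hΦ.dv _).dv _).continuous
  have g0 : ∀ x, 0 ≤ g x := fun x => (abs_nonneg _).trans (hGg x)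
  have hf : CC (ff U η) := ⟨c.sf.continuous, c.cf⟩
  have h1 : ∫ x in Sh ρ τ, |dv (ee j) (dv (ee i) Φ) x| ^ P ≤ C * ((3 * C0 / (τ - ρ)) ^ P * ∫ x in Sh ρ τ, a x ^ P) := by
    rw [← int_eq_set]
    · refine (h κ φ (ff U η) Φ _ c.m hf hΦ hcs hl i j).trans ?_
      gcongr
      exact c.fP hP0
    · intro x hx; rw [hv x hx, abs_zero, Real.zero_rpow hP0.ne']
  rw [int_eq_set fun x hx => by rw [hv x hx, mul_zero]]
  calc |∫ x in Sh ρ τ, G x * dv (ee j) (dv (ee i) Φ) x| ≤ ∫ x in Sh ρ τ, |dv (ee j) (dv (ee i) Φ) x| * g x := by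
        refine abs_integral_le_integral_abs.trans ?_
        refine integral_mono ((BM_Sh ρ τ).int (hG.mul hcont).abs) ((BM_Sh ρ τ).int (hcont.abs.mul hg)) fun x => ?_
        simp only [abs_mul]; rw [mul_comm]
        exact mul_le_mul_of_nonneg_left (hGg x) (abs_nonneg _)
    _ ≤ _ := (BM_Sh ρ τ).hold hcont.abs hg (fun _ => abs_nonneg _) g0 (P := P) (by linarith) rfl
    _ ≤ (C * ((3 * C0 / (τ - ρ)) ^ P * ∫ x in Sh ρ τ, a x ^ P)) ^ (1 / P) *
        (∫ x in Sh ρ τ, g x ^ (P / (P - 1))) ^ (1 / (P / (P - 1))) := by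
        refine mul_le_mul_of_nonneg_right (Real.rpow_le_rpow (integral_nonneg fun x => by positivity) h1 (by positivity))
          (Real.rpow_nonneg (setint_nonneg g0 _) _)
    _ = _ := by
        have i0 := setint_nonneg (E := Sh ρ τ) c.a0 P
        rw [Real.mul_rpow hC.le (by positivity), Real.mul_rpow (by positivity) i0, ← Real.rpow_mul (by positivity),
          mul_one_div_cancel hP0.ne', Real.rpow_one]
        field_simp
end

lemma mo_pair {ψ F g : R3 → ℝ} {M δ : ℝ} {x : R3} {E : Set R3} (hE : BM E) (hδ : 0 < δ) (hM : 0 ≤ M)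
    (hψb : ∀ y, |ψ y| ≤ M) (hψz : ∀ y, 1 < ‖y‖ → ψ y = 0) (hg : Continuous g)
    (hFg : ∀ x, |F x| ≤ g x) (hsub : ball x (2 * δ) ⊆ E) :
    |∫ y, ψ y * F (x + (-δ) • y)| ≤ M * (δ ^ 3)⁻¹ * ∫ z in E, g z := by
  have g0 : ∀ x, 0 ≤ g x := fun x => (abs_nonneg _).trans (hFg x)
  set G : R3 → ℝ := fun z => (ball x (2 * δ)).indicator g (x - z) with hG
  have hint : Integrable ((ball x (2 * δ)).indicator g) :=
    (BM.int ⟨measurableSet_ball, isBounded_ball⟩ hg).integrable_indicator measurableSet_ball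
  have hGi : Integrable G := hint.comp_sub_left x
  have hGi' : Integrable fun y : R3 => G (δ • y) := hGi.comp_smul hδ.ne'
  have h1 : ∀ y, |ψ y * F (x + (-δ) • y)| ≤ M * G (δ • y) := by
    intro y
    by_cases hy : 1 < ‖y‖
    · rw [hψz y hy]; simp only [zero_mul, abs_zero]
      exact mul_nonneg hM (Set.indicator_nonneg (fun _ _ => g0 _) _)
    · have hm : x - δ • y ∈ ball x (2 * δ) := by
        rw [mem_ball, dist_eq_norm]
        simp only [sub_sub_cancel_left, norm_neg, norm_smul, Real.norm_eq_abs, abs_of_pos hδ]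
        nlinarith [not_lt.1 hy]
      have e : x + (-δ) • y = x - δ • y := by simp [sub_eq_add_neg]
      rw [hG]; simp only
      rw [Set.indicator_of_mem hm, e, abs_mul]
      exact mul_le_mul (hψb y) (hFg _) (abs_nonneg _) hM
  calc |∫ y, ψ y * F (x + (-δ) • y)| ≤ ∫ y, M * G (δ • y) := by
        rw [← Real.norm_eq_abs]
        exact norm_integral_le_of_norm_le (hGi'.const_mul M) (Eventually.of_forall h1)
    _ = M * ((δ ^ 3)⁻¹ * ∫ z, G z) := by
        rw [integral_const_mul, Measure.integral_comp_smul]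
        simp only [finrank_euclideanSpace, Fintype.card_fin, smul_eq_mul]
        rw [abs_of_pos (by positivity)]
    _ = M * (δ ^ 3)⁻¹ * ∫ z in ball x (2 * δ), g z := by
        rw [hG, integral_sub_left_eq_self ((ball x (2 * δ)).indicator g) volume x, integral_indicator measurableSet_ball]
        ring
    _ ≤ _ := by
        refine mul_le_mul_of_nonneg_left ?_ (by positivity)
        exact setIntegral_mono_set (hE.int hg) (Eventually.of_forall g0) hsub.eventuallyLE

lemma fderiv_le (h : R3 → ℝ) (x : R3) {N : ℝ} (hN : ∀ i, |dv (ee i) h x| ≤ N) : ‖fderiv ℝ h x‖ ≤ 3 * N := by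
  have hN0 : 0 ≤ N := (abs_nonneg _).trans (hN 0)
  refine ContinuousLinearMap.opNorm_le_bound _ (by positivity) fun y => ?_
  have : y = ∑ i, y i • ee i := by
    ext k; fin_cases k <;> simp [Fin.sum_univ_three, ee]
  have h2 : fderiv ℝ h x y = ∑ i, y i * dv (ee i) h x := by
    conv_lhs => rw [this]
    rw [map_sum]; simp [dv]
  rw [h2]
  refine (Finset.abs_sum_le_sum_abs _ _).trans ?_
  have : ∀ i, |y i * dv (ee i) h x| ≤ ‖y‖ * N := fun i => by
    rw [abs_mul]
    exact mul_le_mul (PiLp.norm_apply_le y i) (hN i) (abs_nonneg _) (norm_nonneg _)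
  refine (Finset.sum_le_sum fun i _ => this i).trans (le_of_eq ?_)
  simp; ring

lemma lap_affine {F : R3 → ℝ} (hF : Sm F) (x : R3) (s : ℝ) (y : R3) :
    lap (fun y => F (x + s • y)) y = s ^ 2 * lap F (x + s • y) := by
  have h : ∀ b, dv b (dv b (fun y => F (x + s • y))) = fun y => s * (s * dv b (dv b F) (x + s • y)) := by
    intro b
    have sa : Sm (fun y => dv b F (x + s • y)) := sm_affine (hF.dv b) x s
    rw [dv_affine hF, dv_fconst sa, dv_affine (hF.dv b)]
  simp only [lap_eq, h]; ring

section
variable {C0 : ℝ} {κ φ : R3 → ℝ} {U V : Fin 3 → R3 → ℝ} {π θ a b η : R3 → ℝ} {ρ τ : ℝ}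

lemma Sys.mo_grad (S : Sys U V π θ) (m : IsMoll κ φ) {s : ℝ} (hs : s ≠ 0) (i : Fin 3) (x : R3) :
    dv (ee i) (mo φ s π) x = s⁻¹ ^ 2 * (∫ y, lap φ y * U i (x + s • y)) +
      ∑ j, s⁻¹ * ∫ y, dv (ee j) φ y * Pt U V i j (x + s • y) := by
  have hφc := m.cφ.2
  have hφ := m.2.1
  rw [m.mo_dv s S.sπ]
  have e1 : ∀ y, φ y * dv (ee i) π (x + s • y) = s⁻¹ ^ 2 * (φ y * lap (fun y => U i (x + s • y)) y) -
      ∑ j, s⁻¹ * (φ y * dv (ee j) (fun y => Pt U V i j (x + s • y)) y) := by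
    intro y
    rw [S.eu', lap_affine (S.sU i)]
    simp only [dv_affine (S.sP i _), Fin.sum_univ_three]
    field_simp
  rw [mo]
  simp only [e1]
  have sU : Sm (fun y => U i (x + s • y)) := sm_affine (S.sU i) x s
  have sP : ∀ j, Sm (fun y => Pt U V i j (x + s • y)) := fun j => sm_affine (S.sP i j) x s
  have i1 : ∀ {F : R3 → ℝ}, Sm F → Integrable fun y => φ y * F y := fun hF =>
    CC.integrable ⟨hφ.continuous.mul hF.continuous, hφc.mul_right⟩
  rw [integral_sub ((i1 (sm_lap sU)).const_mul _) (integrable_finsetSum _ fun j _ => (i1 ((sP j).dv _)).const_mul _),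
    integral_finsetSum _ fun j _ => (i1 ((sP j).dv _)).const_mul _]
  simp only [integral_const_mul]
  have e2 : ∫ y, φ y * lap (fun y => U i (x + s • y)) y = ∫ y, lap φ y * U i (x + s • y) := by
    have := ibp_lap sU hφ hφc
    calc _ = ∫ y, lap (fun y => U i (x + s • y)) y * φ y := by congr 1; funext y; ring
      _ = _ := by rw [this]; congr 1; funext y; ring
  rw [e2]
  simp only [ibp hφ (sP _) hφc]
  simp

lemma IsMoll.bounds (m : IsMoll κ φ) : ∃ M, 0 < M ∧ (∀ y, |_root_.lap φ y| ≤ M) ∧ (∀ j y, |_root_.dv (ee j) φ y| ≤ M) ∧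
    (∀ y, 1 < ‖y‖ → _root_.lap φ y = 0) ∧ (∀ j y, 1 < ‖y‖ → _root_.dv (ee j) φ y = 0) := by
  have hφc := m.cφ.2
  have hφ := m.2.1
  obtain ⟨M1, h10, h1⟩ := CC.bdd ⟨(sm_lap hφ).continuous, hcs_lap hφc⟩
  have h2 : ∀ j, ∃ M, 0 ≤ M ∧ ∀ x, |_root_.dv (ee j) φ x| ≤ M := fun j =>
    CC.bdd ⟨(hφ.dv (ee j)).continuous, hcs_dv hφc _⟩
  choose M2 h20 h2 using h2
  have z1 : ∀ j y, 1 < ‖y‖ → _root_.dv (ee j) φ y = 0 := by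
    intro j y hy
    have ev : ∀ᶠ z in nhds y, φ z = 0 := by
      have : ∀ᶠ z in nhds y, 1 < ‖z‖ := (continuous_norm.continuousAt).eventually (lt_mem_nhds hy)
      exact this.mono fun z hz => m.2.2.2.2.1 z hz.le
    have : fderiv ℝ φ y = fderiv ℝ (fun _ => (0:ℝ)) y := EventuallyEq.fderiv_eq ev
    rw [_root_.dv, this]; simp
  refine ⟨M1 + ∑ j, M2 j + 1, ?_, fun y => (h1 y).trans ?_, fun j y => (h2 j y).trans ?_, ?_, z1⟩
  · have := Finset.sum_nonneg (s := Finset.univ) fun j _ => h20 j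
    linarith
  · have := Finset.sum_nonneg (s := Finset.univ) fun j _ => h20 j
    linarith
  · have := Finset.single_le_sum (f := M2) (s := Finset.univ) (fun j _ => h20 j) (Finset.mem_univ j)
    linarith
  · intro y hy
    have ev : ∀ j, ∀ᶠ z in nhds y, _root_.dv (ee j) φ z = 0 := by
      intro j
      have : ∀ᶠ z in nhds y, 1 < ‖z‖ := (continuous_norm.continuousAt).eventually (lt_mem_nhds hy)
      exact this.mono fun z hz => z1 j z hz
    have : ∀ j, _root_.dv (ee j) (_root_.dv (ee j) φ) y = 0 := by
      intro j
      have : fderiv ℝ (_root_.dv (ee j) φ) y = fderiv ℝ (fun _ => (0:ℝ)) y := EventuallyEq.fderiv_eq (ev j)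
      rw [_root_.dv, this]; simp
    rw [lap_eq]; simp [this]

lemma Ctx.grad_h (m : IsMoll κ φ) : ∃ C, 0 < C ∧ ∀ {C0 : ℝ} {U V : Fin 3 → R3 → ℝ} {π θ a b η : R3 → ℝ} {ρ τ : ℝ}
    (_ : Ctx C0 κ φ U V π θ a b η ρ τ) (x : R3), ρ + (τ - ρ) / 4 ≤ ‖x‖ → ‖x‖ ≤ ρ + (τ - ρ) / 2 →
    ‖fderiv ℝ (mo φ (-((τ - ρ) / 8)) π) x‖ ≤ C * ((τ - ρ)⁻¹ ^ 5 * (∫ z in Sh ρ τ, a z) +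
      (τ - ρ)⁻¹ ^ 4 * ∫ z in Sh ρ τ, (a z ^ 2 + b z ^ 2)) := by
  obtain ⟨M, hM, b1, b2, z1, z2⟩ := m.bounds
  refine ⟨3 * (M * 8 ^ 5), by positivity, fun {C0 U V π θ a b η ρ τ} c x hx1 hx2 => ?_⟩
  have hd := c.d0
  set d := τ - ρ with hdd
  rw [mul_assoc]
  refine fderiv_le _ _ fun i => ?_
  have hδ : 0 < d / 8 := by positivity
  have hsub : ball x (2 * (d / 8)) ⊆ Sh ρ τ := by
    intro z hz
    rw [mem_ball, dist_eq_norm] at hz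
    have t1 := norm_sub_norm_le z x
    have t2 := norm_sub_norm_le x z
    rw [norm_sub_rev] at t2
    rw [mem_Sh]
    constructor <;> linarith
  rw [c.S.mo_grad m (by linarith) i x]
  have h1 := mo_pair (BM_Sh ρ τ) hδ hM.le b1 z1 c.ca (c.ha i) hsub
  have h2 := fun j => mo_pair (F := Pt U V i j) (g := fun x => a x ^ 2 + b x ^ 2) (BM_Sh ρ τ) hδ hM.le (b2 j) (z2 j)
    ((c.ca.pow 2).add (c.cb.pow 2)) (fun x => by
      rw [Pt]
      refine (abs_add_le _ _).trans ?_
      rw [abs_mul, abs_mul, sq, sq]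
      exact add_le_add (mul_le_mul (c.ha _ _) (c.ha _ _) (abs_nonneg _) (c.a0 x))
        (mul_le_mul (c.hb _ _) (c.hb _ _) (abs_nonneg _) (c.b0 x))) hsub
  set I1 := ∫ z in Sh ρ τ, a z
  set I2 := ∫ z in Sh ρ τ, (a z ^ 2 + b z ^ 2)
  have hI2 : 0 ≤ I2 := integral_nonneg fun z => by positivity
  refine (abs_add_le _ _).trans ?_
  have e1 : |(-(d / 8))⁻¹ ^ 2 * ∫ y, lap φ y * U i (x + (-(d / 8)) • y)| ≤ M * 8 ^ 5 * (d⁻¹ ^ 5 * I1) := by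
    rw [abs_mul, abs_of_nonneg (by positivity)]
    refine (mul_le_mul_of_nonneg_left h1 (by positivity)).trans (le_of_eq ?_)
    field_simp
  have e2 : ∀ j, |(-(d / 8))⁻¹ * ∫ y, dv (ee j) φ y * Pt U V i j (x + (-(d / 8)) • y)| ≤ M * 8 ^ 4 * (d⁻¹ ^ 4 * I2) := by
    intro j
    rw [abs_mul, inv_neg, abs_neg, abs_of_nonneg (by positivity)]
    refine (mul_le_mul_of_nonneg_left (h2 j) (by positivity)).trans (le_of_eq ?_)
    field_simp
  refine (add_le_add e1 ((Finset.abs_sum_le_sum_abs _ _).trans (Finset.sum_le_sum fun j _ => e2 j))).trans ?_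
  simp only [Finset.sum_const, Finset.card_univ, Fintype.card_fin]
  have : 0 ≤ M * (d⁻¹ ^ 4 * I2) := by positivity
  simp only [nsmul_eq_mul]
  push_cast
  nlinarith

lemma Ctx.part2 {C0 : ℝ} (hC0 : 0 < C0) (m : IsMoll κ φ) : ∃ C, 0 < C ∧ ∀ {U V : Fin 3 → R3 → ℝ} {π θ a b η : R3 → ℝ} {ρ τ : ℝ}
    (_ : Ctx C0 κ φ U V π θ a b η ρ τ),
    |∫ x, π x * mo φ ((τ - ρ) / 8) (ff U η) x| ≤ C * τ * ((τ - ρ)⁻¹ ^ 5 * (∫ z in Sh ρ τ, a z) +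
      (τ - ρ)⁻¹ ^ 4 * ∫ z in Sh ρ τ, (a z ^ 2 + b z ^ 2)) * ((τ - ρ)⁻¹ * ∫ z in Sh ρ τ, a z) := by
  obtain ⟨C, hC, h⟩ := Ctx.grad_h m
  refine ⟨15 * C * C0, by positivity, fun {U V π θ a b η ρ τ} c => ?_⟩
  have hd := c.d0
  have hρ := c.hρ
  set N := C * ((τ - ρ)⁻¹ ^ 5 * (∫ z in Sh ρ τ, a z) +
      (τ - ρ)⁻¹ ^ 4 * ∫ z in Sh ρ τ, (a z ^ 2 + b z ^ 2)) with hN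
  have hI0 : 0 ≤ ∫ z in Sh ρ τ, a z := integral_nonneg c.a0
  have hN0 : 0 ≤ N := by
    have : 0 ≤ ∫ z in Sh ρ τ, (a z ^ 2 + b z ^ 2) := integral_nonneg fun z => by positivity
    positivity
  set H := mo φ (-((τ - ρ) / 8)) π with hH
  have sH : Sm H := m.mo_sm _ c.S.sπ
  have hf : CC (ff U η) := ⟨c.sf.continuous, c.cf⟩
  rw [m.mo_swap hf c.S.sπ.continuous, ← hH]
  set x0 : R3 := (ρ + (τ - ρ) / 4) • ee 0
  have hx0 : ‖x0‖ = ρ + (τ - ρ) / 4 := by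
    simp only [x0, norm_smul, ee]
    simp only [PiLp.norm_single, norm_one, mul_one, Real.norm_eq_abs]
    exact abs_of_pos (by positivity)
  have e1 : ∫ x, H x * ff U η x = ∫ x, (H x - H x0) * ff U η x := by
    simp only [sub_mul]
    rw [integral_sub, integral_const_mul, c.fi, mul_zero, sub_zero]
    · exact smcc_int sH c.sf c.cf
    · exact hf.integrable.const_mul _
  rw [e1]
  have hb : ∀ x, |(H x - H x0) * ff U η x| ≤ (5 * τ * N) * |ff U η x| := by
    intro x
    rw [abs_mul]
    by_cases hx : ‖x‖ < ρ + (τ - ρ) / 4 ∨ ρ + (τ - ρ) / 2 < ‖x‖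
    · rw [c.fz hx]; simp
    · rw [not_or, not_lt, not_lt] at hx
      refine mul_le_mul_of_nonneg_right ?_ (abs_nonneg _)
      refine (osc_shell sH (a := ρ + (τ - ρ) / 4) (b := ρ + (τ - ρ) / 2) (N := N) (by positivity) (by linarith)
        (fun z h1 h2 => h c z h1 h2) x0 x ⟨hx0.ge, by linarith⟩ hx).trans ?_
      have : ρ + (τ - ρ) / 2 ≤ τ := by linarith
      gcongr
  have hfa : CC fun x => |ff U η x| := by simpa using hf.rpow one_pos
  have h1 : ∫ x, |ff U η x| ≤ 3 * C0 / (τ - ρ) * ∫ x in Sh ρ τ, a x := by simpa using c.fP one_pos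
  calc |∫ x, (H x - H x0) * ff U η x| ≤ ∫ x, (5 * τ * N) * |ff U η x| := by
        rw [← Real.norm_eq_abs]
        exact norm_integral_le_of_norm_le (hfa.integrable.const_mul _) (Eventually.of_forall hb)
    _ ≤ (5 * τ * N) * (3 * C0 / (τ - ρ) * ∫ x in Sh ρ τ, a x) := by
        rw [integral_const_mul]
        have : 0 < τ := by linarith
        gcongr
    _ = _ := by rw [hN]; ring
end

/-- mixed term -/
def MX (a b : R3 → ℝ) (p : ℝ) (E : Set R3) : ℝ :=
  (∫ x in E, a x ^ p) ^ (1 / p) * (∫ x in E, b x ^ (2 * (p / (p - 1)))) ^ (1 / (p / (p - 1)))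

def TE (a b c : R3 → ℝ) (p R : ℝ) (E : Set R3) : ℝ :=
  R⁻¹ ^ 2 * ((∫ x in E, a x ^ 2) + (∫ x in E, b x ^ 2) + ∫ x in E, c x ^ 2) +
  R⁻¹ * ((∫ x in E, a x ^ 3) + MX a b p E + MX a c p E + ∫ x in E, c x * b x)

lemma sq_rpow' {t : ℝ} (h : 0 ≤ t) (q : ℝ) : (t ^ 2) ^ q = t ^ (2 * q) := by
  rw [Real.rpow_mul h]; norm_num

lemma MX_nonneg {a b : R3 → ℝ} (a0 : ∀ x, 0 ≤ a x) (b0 : ∀ x, 0 ≤ b x) (p : ℝ) (E : Set R3) : 0 ≤ MX a b p E :=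
  mul_nonneg (Real.rpow_nonneg (setint_nonneg a0 _) _) (Real.rpow_nonneg (setint_nonneg b0 _) _)

lemma BM.mx {E : Set R3} (h : BM E) {a b : R3 → ℝ} (ca : Continuous a) (cb : Continuous b) (a0 : ∀ x, 0 ≤ a x)
    (b0 : ∀ x, 0 ≤ b x) {p : ℝ} (hp : 3 ≤ p) : ∫ x in E, a x * b x ^ 2 ≤ MX a b p E := by
  have := h.hold (g := fun x => b x ^ 2) ca (cb.pow 2) a0 (fun x => sq_nonneg (b x)) (P := p) (by linarith) rfl
  simp only [sq_rpow' (b0 _)] at this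
  exact this

lemma BM.A1 {E : Set R3} (h : BM E) {a : R3 → ℝ} (ca : Continuous a) (a0 : ∀ x, 0 ≤ a x) :
    (∫ x in E, a x) ^ 2 ≤ volume.real E * ∫ x in E, a x ^ 2 := by
  have := h.lower ca a0 (m := 1) (k := 2) one_pos (by norm_num)
  simp only [Real.rpow_one, Real.rpow_ofNat] at this
  have h0 : 0 ≤ ∫ x in E, a x := integral_nonneg a0
  have h1 : 0 ≤ ∫ x in E, a x ^ 2 := integral_nonneg fun x => by positivity
  have h2 : 0 ≤ volume.real E := measureReal_nonneg
  calc (∫ x in E, a x) ^ 2 ≤ ((∫ x in E, a x ^ 2) ^ (1 / 2 : ℝ) * (volume.real E) ^ (1 - 1 / 2 : ℝ)) ^ 2 := by gcongr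
    _ = _ := by
      rw [mul_pow, ← Real.rpow_mul_natCast h1, ← Real.rpow_mul_natCast h2]
      norm_num; ring

lemma BM.A3 {E : Set R3} (h : BM E) {a : R3 → ℝ} (ca : Continuous a) (a0 : ∀ x, 0 ≤ a x) :
    (∫ x in E, a x) * (∫ x in E, a x ^ 2) ≤ volume.real E * ∫ x in E, a x ^ 3 := by
  have t1 := h.lower ca a0 (m := 1) (k := 3) one_pos (by norm_num)
  have t2 := h.lower ca a0 (m := 2) (k := 3) two_pos (by norm_num)
  simp only [Real.rpow_one, Real.rpow_ofNat] at t1 t2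
  have h0 : 0 ≤ ∫ x in E, a x := integral_nonneg a0
  have h1 : 0 ≤ ∫ x in E, a x ^ 2 := integral_nonneg fun x => by positivity
  have h3 : 0 ≤ ∫ x in E, a x ^ 3 := integral_nonneg fun x => by have := a0 x; positivity
  have h2 : 0 ≤ volume.real E := measureReal_nonneg
  refine (mul_le_mul t1 t2 h1 (by positivity)).trans (le_of_eq ?_)
  rw [mul_mul_mul_comm, ← Real.rpow_add_of_nonneg h3 (by norm_num) (by norm_num),
    ← Real.rpow_add_of_nonneg h2 (by norm_num) (by norm_num)]
  norm_num; ring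

lemma BM.A4 {E : Set R3} (h : BM E) {a b : R3 → ℝ} (ca : Continuous a) (a0 : ∀ x, 0 ≤ a x)
    (cb : Continuous b) (b0 : ∀ x, 0 ≤ b x) {p : ℝ} (hp : 3 ≤ p) :
    (∫ x in E, a x) * (∫ x in E, b x ^ 2) ≤ volume.real E * MX a b p E := by
  have hp1 : 0 < p - 1 := by linarith
  have hp0 : 0 < p := by linarith
  have t1 := h.lower ca a0 (m := 1) (k := p) one_pos (by linarith)
  have t2 := h.lower cb b0 (m := 2) (k := 2 * (p / (p - 1))) two_pos (by
    have : 1 ≤ p / (p - 1) := by rw [le_div_iff₀ hp1]; linarith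
    linarith)
  simp only [Real.rpow_one, Real.rpow_ofNat] at t1 t2
  have h1 : 0 ≤ ∫ x in E, b x ^ 2 := integral_nonneg fun x => by positivity
  have h3 : 0 ≤ ∫ x in E, a x ^ p := setint_nonneg a0 _
  have h2 : 0 ≤ volume.real E := measureReal_nonneg
  refine (mul_le_mul t1 t2 h1 (by positivity)).trans (le_of_eq ?_)
  have e1 : 2 / (2 * (p / (p - 1))) = 1 / (p / (p - 1)) := by field_simp
  have e2 : 1 / (p / (p - 1)) = 1 - 1 / p := by field_simp
  have e3 : 0 ≤ 1 - 1 / p := by rw [← e2]; positivity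
  rw [mul_mul_mul_comm, e1, ← Real.rpow_add_of_nonneg h2 e3 (by rw [e2]; ring_nf; positivity), MX]
  rw [show (1 - 1 / p + (1 - 1 / (p / (p - 1)))) = 1 by rw [e2]; ring, Real.rpow_one]
  ring

section
variable {κ φ : R3 → ℝ}

lemma Ctx.pres {C0 : ℝ} (hC0 : 0 < C0) (m : IsMoll κ φ) {p : ℝ} (hp : 3 ≤ p) : ∃ C, 0 < C ∧
    ∀ {U V : Fin 3 → R3 → ℝ} {π θ a b η : R3 → ℝ} {ρ τ : ℝ}
    (_ : Ctx C0 κ φ U V π θ a b η ρ τ) (R : ℝ), 0 < R → R ≤ ρ → τ ≤ 2 * R →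
    |∫ x, π x * ff U η x| ≤ C * ((τ - ρ) / R)⁻¹ ^ 6 * (R⁻¹ ^ 2 * (∫ x in Sh ρ τ, a x ^ 2) +
      R⁻¹ * ((∫ x in Sh ρ τ, a x ^ 3) + MX a b p (Sh ρ τ))) := by
  obtain ⟨C3, hC3, h3⟩ := Ctx.part1 hC0 3 (by norm_num)
  obtain ⟨Cp, hCp, hp'⟩ := Ctx.part1 hC0 p (by linarith)
  obtain ⟨C2, hC2, h2⟩ := Ctx.part2 hC0 m
  obtain ⟨Cv, hCv, hv⟩ := vol_Sh
  refine ⟨9 * C3 + 9 * Cp + 2 * C2 * Cv, by positivity, fun {U V π θ a b η ρ τ} c R hR hρ hτ => ?_⟩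
  obtain ⟨Φ, sΦ, zΦ, zΦ', lΦ⟩ := c.exΦ
  have hd := c.d0
  have ca := c.ca
  have cb := c.cb
  have a0 := c.a0
  have b0 := c.b0
  have hE := BM_Sh ρ τ
  have hcs : HasCompactSupport Φ := cs_of_ball (r := τ) fun x hx => zΦ x (by rw [mem_Sh]; simp [hx])
  have hI2 : 0 ≤ ∫ x in Sh ρ τ, a x ^ 2 := integral_nonneg fun x => by positivity
  have hI3 : 0 ≤ ∫ x in Sh ρ τ, a x ^ 3 := integral_nonneg fun x => by have := a0 x; positivity
  have hMX : 0 ≤ MX a b p (Sh ρ τ) := MX_nonneg a0 b0 _ _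
  -- splitting
  have e0 : ∫ x, π x * ff U η x = (∫ x, π x * lap Φ x) + ∫ x, π x * mo φ ((τ - ρ) / 8) (ff U η) x := by
    rw [← integral_add (smcc_int c.S.sπ (sm_lap sΦ) (hcs_lap hcs))]
    · congr 1; funext x; rw [lΦ]; ring
    · refine smcc_int c.S.sπ (m.mo_sm _ c.sf) ?_
      have : mo φ ((τ - ρ) / 8) (ff U η) = fun x => ff U η x - lap Φ x := by funext x; rw [lΦ]; ring
      rw [this]; exact c.cf.sub (hcs_lap hcs)
  have b1 : |∫ x, π x * lap Φ x| ≤ (9 * C3 + 9 * Cp) * ((τ - ρ)⁻¹ * ((∫ x in Sh ρ τ, a x ^ 3) + MX a b p (Sh ρ τ))) := by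
    rw [c.S.pres sΦ hcs, abs_neg]
    have key : ∀ i j, |∫ x, Pt U V i j x * dv (ee j) (dv (ee i) Φ) x| ≤
        (C3 + Cp) * ((τ - ρ)⁻¹ * ((∫ x in Sh ρ τ, a x ^ 3) + MX a b p (Sh ρ τ))) := by
      intro i j
      have k1 := h3 c sΦ zΦ zΦ' lΦ (G := fun x => U i x * U j x) (g := fun x => a x ^ 2)
        ((c.S.sU i).continuous.mul (c.S.sU j).continuous) (ca.pow 2) (fun x => by
          rw [abs_mul, sq]; exact mul_le_mul (c.ha _ _) (c.ha _ _) (abs_nonneg _) (a0 x)) i j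
      have k2 := hp' c sΦ zΦ zΦ' lΦ (G := fun x => V i x * V j x) (g := fun x => b x ^ 2)
        ((c.S.sV i).continuous.mul (c.S.sV j).continuous) (cb.pow 2) (fun x => by
          rw [abs_mul, sq]; exact mul_le_mul (c.hb _ _) (c.hb _ _) (abs_nonneg _) (b0 x)) i j
      have r1 : (∫ x in Sh ρ τ, (a x ^ 2) ^ ((3:ℝ) / (3 - 1))) ^ (1 / ((3:ℝ) / (3 - 1))) *
          (∫ x in Sh ρ τ, a x ^ (3:ℝ)) ^ (1 / (3:ℝ)) = ∫ x in Sh ρ τ, a x ^ 3 := by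
        simp only [sq_rpow' (a0 _)]
        norm_num
        rw [← Real.rpow_add_of_nonneg hI3 (by norm_num) (by norm_num)]
        norm_num
      have r2 : (∫ x in Sh ρ τ, (b x ^ 2) ^ (p / (p - 1))) ^ (1 / (p / (p - 1))) *
          (∫ x in Sh ρ τ, a x ^ p) ^ (1 / p) = MX a b p (Sh ρ τ) := by
        simp only [sq_rpow' (b0 _)]
        rw [MX, mul_comm]
      rw [r1] at k1
      rw [r2] at k2
      have i1 : ∀ {F : R3 → ℝ}, Sm F → Integrable fun x => F x * dv (ee j) (dv (ee i) Φ) x := fun hF =>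
        smcc_int hF ((sΦ.dv _).dv _) (hcs_dv (hcs_dv hcs _) _)
      have e : ∫ x, Pt U V i j x * dv (ee j) (dv (ee i) Φ) x = (∫ x, U i x * U j x * dv (ee j) (dv (ee i) Φ) x) +
          ∫ x, V i x * V j x * dv (ee j) (dv (ee i) Φ) x := by
        rw [← integral_add (i1 ((c.S.sU i).mul (c.S.sU j))) (i1 ((c.S.sV i).mul (c.S.sV j)))]
        congr 1; funext x; rw [Pt]; ring
      rw [e]
      refine (abs_add_le _ _).trans ((add_le_add k1 k2).trans ?_)
      have : 0 < (τ - ρ)⁻¹ := by positivity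
      have q1 : 0 ≤ C3 * (τ - ρ)⁻¹ * MX a b p (Sh ρ τ) := by positivity
      have q2 : 0 ≤ Cp * (τ - ρ)⁻¹ * ∫ x in Sh ρ τ, a x ^ 3 := by positivity
      linarith
    refine (Finset.abs_sum_le_sum_abs _ _).trans ((Finset.sum_le_sum fun i _ => (Finset.abs_sum_le_sum_abs _ _).trans
      (Finset.sum_le_sum fun j _ => key i j)).trans (le_of_eq ?_))
    simp; ring
  have b2 := h2 c
  set d := τ - ρ with hdd
  have hs : ∃ t, 1 ≤ t ∧ d⁻¹ = t * R⁻¹ ∧ (d / R)⁻¹ = t := by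
    refine ⟨(d / R)⁻¹, ?_, ?_, rfl⟩
    · rw [inv_div, le_div_iff₀ hd]; linarith
    · field_simp
  obtain ⟨t, ht, hdt, ht'⟩ := hs
  rw [ht']
  set A1 := ∫ z in Sh ρ τ, a z
  have hA1 : 0 ≤ A1 := integral_nonneg a0
  set I2 := ∫ z in Sh ρ τ, a z ^ 2
  set I3 := ∫ z in Sh ρ τ, a z ^ 3
  have hsum : ∫ z in Sh ρ τ, (a z ^ 2 + b z ^ 2) = I2 + ∫ z in Sh ρ τ, b z ^ 2 :=
    integral_add (hE.int (ca.pow 2)) (hE.int (cb.pow 2))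
  rw [hsum] at b2
  set J2 := ∫ z in Sh ρ τ, b z ^ 2
  set X := MX a b p (Sh ρ τ)
  have v := hv R ρ τ hR hτ
  set vol := volume.real (Sh ρ τ)
  have w1 : A1 ^ 2 ≤ Cv * R ^ 3 * I2 := (hE.A1 ca a0).trans (mul_le_mul_of_nonneg_right v hI2)
  have w2 : A1 * I2 ≤ Cv * R ^ 3 * I3 := (hE.A3 ca a0).trans (mul_le_mul_of_nonneg_right v hI3)
  have w3 : A1 * J2 ≤ Cv * R ^ 3 * X := (hE.A4 ca a0 cb b0 hp).trans (mul_le_mul_of_nonneg_right v hMX)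
  have hτ0 : 0 < τ := by linarith
  have t5 : t ^ 5 ≤ t ^ 6 := pow_le_pow_right₀ ht (by norm_num)
  have t1 : t ≤ t ^ 6 := by simpa using pow_le_pow_right₀ ht (show 1 ≤ 6 by norm_num)
  have b2' : |∫ x, π x * mo φ (d / 8) (ff U η) x| ≤ 2 * C2 * Cv * (t ^ 6 * (R⁻¹ ^ 2 * I2 + R⁻¹ * (I3 + X))) := by
    have Ri : 0 < R⁻¹ := by positivity
    have hRR : R * R⁻¹ = 1 := mul_inv_cancel₀ hR.ne'
    calc _ ≤ C2 * τ * (d⁻¹ ^ 5 * A1 + d⁻¹ ^ 4 * (I2 + J2)) * (d⁻¹ * A1) := b2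
      _ = C2 * τ * (d⁻¹ ^ 6 * A1 ^ 2 + d⁻¹ ^ 5 * (A1 * I2 + A1 * J2)) := by ring
      _ ≤ C2 * (2 * R) * (d⁻¹ ^ 6 * (Cv * R ^ 3 * I2) + d⁻¹ ^ 5 * (Cv * R ^ 3 * I3 + Cv * R ^ 3 * X)) := by gcongr
      _ = 2 * C2 * Cv * (t ^ 6 * (R⁻¹ ^ 2 * I2) + t ^ 5 * (R⁻¹ * (I3 + X))) := by
          rw [hdt]; field_simp
      _ ≤ 2 * C2 * Cv * (t ^ 6 * (R⁻¹ ^ 2 * I2) + t ^ 6 * (R⁻¹ * (I3 + X))) := by gcongr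
      _ = _ := by ring
  have b1' : |∫ x, π x * lap Φ x| ≤ (9 * C3 + 9 * Cp) * (t ^ 6 * (R⁻¹ ^ 2 * I2 + R⁻¹ * (I3 + X))) := by
    refine b1.trans ?_
    rw [hdt]
    refine mul_le_mul_of_nonneg_left ?_ (by positivity)
    calc t * R⁻¹ * (I3 + X) ≤ t ^ 6 * R⁻¹ * (I3 + X) := by gcongr
      _ = t ^ 6 * (0 + R⁻¹ * (I3 + X)) := by ring
      _ ≤ _ := by gcongr; positivity
  rw [e0]
  refine (abs_add_le _ _).trans ((add_le_add b1' b2').trans (le_of_eq ?_))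
  ring
end

section
variable {κ φ : R3 → ℝ}

lemma Ctx.energy {C0 : ℝ} (hC0 : 0 < C0) (m : IsMoll κ φ) {p : ℝ} (hp : 3 ≤ p) : ∃ C, 0 < C ∧
    ∀ {U V : Fin 3 → R3 → ℝ} {π θ a b η : R3 → ℝ} {ρ τ : ℝ}
    (_ : Ctx C0 κ φ U V π θ a b η ρ τ) (R : ℝ), 0 < R → R ≤ ρ → τ ≤ 2 * R →
    ∫ x, η x * Ed U V θ x ≤ C * ((τ - ρ) / R)⁻¹ ^ 6 * TE a b (fun x => |θ x|) p R (Sh ρ τ) := by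
  obtain ⟨C, hC, h⟩ := Ctx.pres hC0 m hp
  refine ⟨C + 17 * C0, by positivity, fun {U V π θ a b η ρ τ} c R hR hρ hτ => ?_⟩
  have hpres := h c R hR hρ hτ
  have hd := c.d0
  have ca := c.ca
  have cb := c.cb
  have a0 := c.a0
  have b0 := c.b0
  have cc : Continuous fun x => |θ x| := c.S.sθ.continuous.abs
  have c0 : ∀ x, 0 ≤ |θ x| := fun x => abs_nonneg _
  have hE := BM_Sh ρ τ
  have sW := c.S.sW
  have sS := c.S.sS
  have hη := c.cut.sm
  have hc := c.cut.hc
  set W := Wd U V θ with hW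
  set SS' := Sd U V θ with hSS
  set Q : R3 → ℝ := fun x => W x * lap η x + ∑ j, dv (ee j) η x * (U j x * W x + V j x * SS' x) with hQ
  have sQ : Sm Q := (sW.mul (sm_lap hη)).add (sm_sum fun j => (hη.dv _).mul (((c.S.sU j).mul sW).add ((c.S.sV j).mul sS)))
  have zQ : ∀ x, x ∉ Sh ρ τ → Q x = 0 := by
    intro x hx
    have hx' : ‖x‖ < ρ + (τ - ρ) / 4 ∨ ρ + (τ - ρ) / 2 < ‖x‖ := by
      rw [mem_Sh, not_and_or, not_le, not_lt] at hx
      rcases hx with hx | hx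
      · left; linarith
      · right; linarith
    simp [hQ, c.cut.z1 _ x hx', c.cut.z2 x hx']
  have cQ : HasCompactSupport Q := cs_of_ball (r := τ) fun x hx => zQ x (by rw [mem_Sh]; simp [hx])
  have e0 : ∫ x, η x * Ed U V θ x = (∫ x, Q x) + ∫ x, π x * ff U η x := by
    rw [c.S.energy hη hc, ← integral_finsetSum, ← integral_add, ← integral_add (CC.integrable ⟨sQ.continuous, cQ⟩)
      (smcc_int c.S.sπ c.sf c.cf)]
    · congr 1; funext x
      simp only [hQ, ff, ← hW, ← hSS, Fin.sum_univ_three]; ring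
    · exact smcc_int sW (sm_lap hη) (hcs_lap hc)
    · exact integrable_finsetSum _ fun j _ => CC.integrable ⟨(hη.dv _).continuous.mul
        (((c.S.sU j).mul (sW.add c.S.sπ)).add ((c.S.sV j).mul sS)).continuous, (hcs_dv hc _).mul_right⟩
    · exact fun j _ => CC.integrable ⟨(hη.dv _).continuous.mul
        (((c.S.sU j).mul (sW.add c.S.sπ)).add ((c.S.sV j).mul sS)).continuous, (hcs_dv hc _).mul_right⟩
  set d := τ - ρ with hdd
  have hs : ∃ t, 1 ≤ t ∧ d⁻¹ = t * R⁻¹ ∧ (d / R)⁻¹ = t := by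
    refine ⟨(d / R)⁻¹, ?_, ?_, rfl⟩
    · rw [inv_div, le_div_iff₀ hd]; linarith
    · field_simp
  obtain ⟨t, ht, hdt, ht'⟩ := hs
  rw [ht'] at hpres ⊢
  have hQb : ∀ x, Q x ≤ C0 * (d⁻¹ ^ 2 * 2) * (a x ^ 2 + b x ^ 2 + |θ x| ^ 2) +
      C0 * (d⁻¹ * 15) * (a x ^ 3 + a x * b x ^ 2 + a x * |θ x| ^ 2 + |θ x| * b x) := by
    intro x
    have A0 := a0 x
    have B0 := b0 x
    have T0 := c0 x
    have hsq : ∀ i, |U i x| ^ 2 ≤ a x ^ 2 := fun i => by have := c.ha i x; gcongr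
    have hsq' : ∀ i, |V i x| ^ 2 ≤ b x ^ 2 := fun i => by have := c.hb i x; gcongr
    have w1 : |W x| ≤ 2 * (a x ^ 2 + b x ^ 2 + |θ x| ^ 2) := by
      have : 0 ≤ W x := by
        rw [hW, Wd]; simp only [← sq]; positivity
      rw [abs_of_nonneg this, hW, Wd]
      simp only [← sq, ← sq_abs (U _ x), ← sq_abs (V _ x), ← sq_abs (θ x), Fin.sum_univ_three]
      nlinarith [hsq 0, hsq 1, hsq 2, hsq' 0, hsq' 1, hsq' 2]
    have w2 : |SS' x| ≤ 3 * (a x * b x) + |θ x| := by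
      rw [hSS, Sd]
      refine (abs_add_le _ _).trans (add_le_add_left ?_ _)
      refine (Finset.abs_sum_le_sum_abs _ _).trans ?_
      have : ∀ i, |U i x * V i x| ≤ a x * b x := fun i => by
        rw [abs_mul]; exact mul_le_mul (c.ha i x) (c.hb i x) (abs_nonneg _) A0
      refine (Finset.sum_le_sum fun i _ => this i).trans (le_of_eq ?_)
      simp
    have w3 : W x * lap η x ≤ 2 * (a x ^ 2 + b x ^ 2 + |θ x| ^ 2) * (C0 / d ^ 2) := by
      refine (le_abs_self _).trans ?_
      rw [abs_mul]
      exact mul_le_mul w1 (c.cut.d2 x) (abs_nonneg _) (by positivity)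
    have w4 : ∀ j, dv (ee j) η x * (U j x * W x + V j x * SS' x) ≤ (C0 / d) *
        (a x * (2 * (a x ^ 2 + b x ^ 2 + |θ x| ^ 2)) + b x * (3 * (a x * b x) + |θ x|)) := by
      intro j
      refine (le_abs_self _).trans ?_
      rw [abs_mul]
      refine mul_le_mul (c.cut.d1 j x) ?_ (abs_nonneg _) (by positivity)
      refine (abs_add_le _ _).trans ?_
      rw [abs_mul, abs_mul]
      exact add_le_add (mul_le_mul (c.ha j x) w1 (abs_nonneg _) A0) (mul_le_mul (c.hb j x) w2 (abs_nonneg _) B0)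
    rw [hQ]; simp only
    refine (add_le_add w3 (Finset.sum_le_sum fun j _ => w4 j)).trans ?_
    simp only [Finset.sum_const, Finset.card_univ, Fintype.card_fin, nsmul_eq_mul]
    have k : 0 < C0 * d⁻¹ := by positivity
    have k1 : 0 ≤ C0 * d⁻¹ * a x ^ 3 := by positivity
    have k2 : 0 ≤ C0 * d⁻¹ * (a x * b x ^ 2) := by positivity
    have k3 : 0 ≤ C0 * d⁻¹ * (a x * |θ x| ^ 2) := by positivity
    have k4 : 0 ≤ C0 * d⁻¹ * (|θ x| * b x) := by positivity
    rw [div_eq_mul_inv, div_eq_mul_inv, ← inv_pow]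
    push_cast
    nlinarith
  have i1 : IntegrableOn (fun x => a x ^ 2) (Sh ρ τ) := hE.int (ca.pow 2)
  have i2 : IntegrableOn (fun x => b x ^ 2) (Sh ρ τ) := hE.int (cb.pow 2)
  have i3 : IntegrableOn (fun x => |θ x| ^ 2) (Sh ρ τ) := hE.int (cc.pow 2)
  have i4 : IntegrableOn (fun x => a x ^ 3) (Sh ρ τ) := hE.int (ca.pow 3)
  have i5 : IntegrableOn (fun x => a x * b x ^ 2) (Sh ρ τ) := hE.int (ca.mul (cb.pow 2))
  have i6 : IntegrableOn (fun x => a x * |θ x| ^ 2) (Sh ρ τ) := hE.int (ca.mul (cc.pow 2))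
  have i7 : IntegrableOn (fun x => |θ x| * b x) (Sh ρ τ) := hE.int (cc.mul cb)
  have i12 : IntegrableOn (fun x => a x ^ 2 + b x ^ 2) (Sh ρ τ) := i1.add i2
  have i123 : IntegrableOn (fun x => a x ^ 2 + b x ^ 2 + |θ x| ^ 2) (Sh ρ τ) := i12.add i3
  have i45 : IntegrableOn (fun x => a x ^ 3 + a x * b x ^ 2) (Sh ρ τ) := i4.add i5
  have i456 : IntegrableOn (fun x => a x ^ 3 + a x * b x ^ 2 + a x * |θ x| ^ 2) (Sh ρ τ) := i45.add i6
  have i4567 : IntegrableOn (fun x => a x ^ 3 + a x * b x ^ 2 + a x * |θ x| ^ 2 + |θ x| * b x) (Sh ρ τ) := i456.add i7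
  have hM1 := hE.mx ca cb a0 b0 hp
  have hM2 := hE.mx ca cc a0 c0 hp
  have q1 : 0 ≤ ∫ x in Sh ρ τ, a x ^ 2 := integral_nonneg fun x => by positivity
  have q2 : 0 ≤ ∫ x in Sh ρ τ, b x ^ 2 := integral_nonneg fun x => by positivity
  have q3 : 0 ≤ ∫ x in Sh ρ τ, |θ x| ^ 2 := integral_nonneg fun x => by positivity
  have q4 : 0 ≤ ∫ x in Sh ρ τ, a x ^ 3 := integral_nonneg fun x => by have := a0 x; positivity
  have q7 : 0 ≤ ∫ x in Sh ρ τ, |θ x| * b x := integral_nonneg fun x => mul_nonneg (c0 x) (b0 x)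
  have q5 : 0 ≤ MX a b p (Sh ρ τ) := MX_nonneg a0 b0 _ _
  have q6 : 0 ≤ MX a (fun x => |θ x|) p (Sh ρ τ) := MX_nonneg a0 c0 _ _
  have hQi : ∫ x, Q x ≤ C0 * (d⁻¹ ^ 2 * 2) * ((∫ x in Sh ρ τ, a x ^ 2) + (∫ x in Sh ρ τ, b x ^ 2) + ∫ x in Sh ρ τ, |θ x| ^ 2) +
      C0 * (d⁻¹ * 15) * ((∫ x in Sh ρ τ, a x ^ 3) + MX a b p (Sh ρ τ) + MX a (fun x => |θ x|) p (Sh ρ τ)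
        + ∫ x in Sh ρ τ, |θ x| * b x) := by
    rw [int_eq_set zQ]
    refine (integral_mono (hE.int sQ.continuous) ?_ hQb).trans ?_
    · exact (i123.const_mul _).add (i4567.const_mul _)
    · rw [integral_add (i123.const_mul _) (i4567.const_mul _),
        integral_const_mul, integral_const_mul, integral_add i12 i3, integral_add i1 i2,
        integral_add i456 i7, integral_add i45 i6, integral_add i4 i5]
      gcongr
  rw [e0]
  refine (add_le_add hQi ((le_abs_self _).trans hpres)).trans ?_
  rw [TE, hdt]
  set I1 := ∫ x in Sh ρ τ, a x ^ 2
  set I2 := ∫ x in Sh ρ τ, b x ^ 2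
  set I3 := ∫ x in Sh ρ τ, |θ x| ^ 2
  set I4 := ∫ x in Sh ρ τ, a x ^ 3
  set I7 := ∫ x in Sh ρ τ, |θ x| * b x
  set M1 := MX a b p (Sh ρ τ)
  set M2 := MX a (fun x => |θ x|) p (Sh ρ τ)
  have t2 : t ^ 2 ≤ t ^ 6 := pow_le_pow_right₀ ht (by norm_num)
  have t1 : t ≤ t ^ 6 := by simpa using pow_le_pow_right₀ ht (show 1 ≤ 6 by norm_num)
  have Ri : 0 < R⁻¹ := by positivity
  have z1 : I1 ≤ I1 + I2 + I3 := by linarith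
  have z2 : I4 + M1 ≤ I4 + M1 + M2 + I7 := by linarith
  have z3 : 0 ≤ I1 + I2 + I3 := by linarith
  have z4 : 0 ≤ I4 + M1 + M2 + I7 := by linarith
  have z5 : (2:ℝ) ≤ 17 := by norm_num
  have z6 : (15:ℝ) ≤ 17 := by norm_num
  calc _ = C0 * 2 * t ^ 2 * (R⁻¹ ^ 2 * (I1 + I2 + I3)) + C0 * 15 * t * (R⁻¹ * (I4 + M1 + M2 + I7)) +
        C * t ^ 6 * (R⁻¹ ^ 2 * I1 + R⁻¹ * (I4 + M1)) := by ring
    _ ≤ C0 * 17 * t ^ 6 * (R⁻¹ ^ 2 * (I1 + I2 + I3)) + C0 * 17 * t ^ 6 * (R⁻¹ * (I4 + M1 + M2 + I7)) +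
        C * t ^ 6 * (R⁻¹ ^ 2 * (I1 + I2 + I3) + R⁻¹ * (I4 + M1 + M2 + I7)) := by
        refine add_le_add (add_le_add ?_ ?_) ?_
        · gcongr
        · gcongr
        · exact mul_le_mul_of_nonneg_left (add_le_add (mul_le_mul_of_nonneg_left z1 (by positivity))
            (mul_le_mul_of_nonneg_left z2 Ri.le)) (by positivity)
    _ = _ := by ring
end

lemma g2_nonneg (f : R3 → ℝ) (x : R3) : 0 ≤ g2 f x := Finset.sum_nonneg fun _ _ => sq_nonneg _

lemma sm_g2 {f : R3 → ℝ} (h : Sm f) : Sm (g2 f) := by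
  have : Sm (fun x => ∑ j, dv (ee j) f x * dv (ee j) f x) := sm_sum fun j => (h.dv _).mul (h.dv _)
  have e : g2 f = fun x => ∑ j, dv (ee j) f x * dv (ee j) f x := by
    funext x; simp [g2, sq]
  rw [e]; exact this

lemma sobolev : ∃ C, 0 < C ∧ ∀ F : R3 → ℝ, Sm F → HasCompactSupport F →
    (∫ x, |F x| ^ (6:ℝ)) ^ (1 / 3 : ℝ) ≤ C * ∫ x, g2 F x := by
  set K : ℝ := NNReal.toReal (eLpNormLESNormFDerivOfEqInnerConst (volume : Measure R3) ((2:NNReal) : ℝ)) with hK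
  have hK0 : 0 ≤ K := NNReal.coe_nonneg _
  refine ⟨K ^ 2 * 9 + 1, by positivity, fun F hF hc => ?_⟩
  have h1 := eLpNorm_le_eLpNorm_fderiv_of_eq_inner (μ := (volume : Measure R3)) (u := F) (p := 2) (p' := 6)
    (hF.of_le (by simp)) hc (by norm_num) (by simp) (by simp; norm_num)
  have cf : Continuous (fderiv ℝ F) := hF.continuous_fderiv (by simp)
  have hcf : HasCompactSupport (fderiv ℝ F) := hc.fderiv ℝ
  have m1 : MemLp F ((6:NNReal) : ENNReal) volume := hF.continuous.memLp_of_hasCompactSupport hc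
  have m2 : MemLp (fderiv ℝ F) ((2:NNReal) : ENNReal) volume := cf.memLp_of_hasCompactSupport hcf
  rw [m1.eLpNorm_eq_integral_rpow_norm (by simp) (by simp), m2.eLpNorm_eq_integral_rpow_norm (by simp) (by simp)] at h1
  have hg0 : 0 ≤ ∫ x, g2 F x := integral_nonneg fun x => g2_nonneg F x
  have hcg : HasCompactSupport (g2 F) := by
    obtain ⟨r, _, hr⟩ := CC.ball (hF.cc hc)
    refine cs_of_ball (r := r + 1) fun x hx => ?_
    have : ∀ j, dv (ee j) F x = 0 := fun j => by
      have : F =ᶠ[nhds x] fun _ => 0 := by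
        filter_upwards [(continuous_norm.isOpen_preimage _ isOpen_Ioi).mem_nhds (show r < ‖x‖ by linarith)] with y hy
        exact hr y (le_of_lt hy)
      simp [dv, this.fderiv_eq]
    simp [g2, this]
  have hD : ∫ x, ‖fderiv ℝ F x‖ ^ (2:ℝ) ≤ 9 * ∫ x, g2 F x := by
    rw [← integral_const_mul]
    refine integral_mono ?_ ?_ fun x => ?_
    · have : Continuous fun x => ‖fderiv ℝ F x‖ ^ (2:ℝ) := cf.norm.rpow_const fun _ => Or.inr (by norm_num)
      refine this.integrable_of_hasCompactSupport ?_
      exact hcf.comp_left (g := fun L => ‖L‖ ^ (2:ℝ)) (by simp)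
    · exact ((sm_g2 hF).continuous.integrable_of_hasCompactSupport hcg).const_mul _
    · have : ‖fderiv ℝ F x‖ ≤ 3 * √(g2 F x) := fderiv_le F x fun i => by
        refine Real.abs_le_sqrt ?_
        exact Finset.single_le_sum (f := fun j => dv (ee j) F x ^ 2) (fun _ _ => sq_nonneg _) (Finset.mem_univ i)
      simp only [Real.rpow_two]
      calc _ ≤ (3 * √(g2 F x)) ^ 2 := by gcongr
        _ = _ := by rw [mul_pow, Real.sq_sqrt (g2_nonneg F x)]; norm_num
  have hA0 : 0 ≤ ∫ x, |F x| ^ (6:ℝ) := integral_nonneg fun x => by positivity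
  have hD0 : 0 ≤ ∫ x, ‖fderiv ℝ F x‖ ^ (2:ℝ) := integral_nonneg fun x => by positivity
  have h2 : (∫ x, |F x| ^ (6:ℝ)) ^ (1 / 6 : ℝ) ≤ K * (∫ x, ‖fderiv ℝ F x‖ ^ (2:ℝ)) ^ (1 / 2 : ℝ) := by
    have e : ((eLpNormLESNormFDerivOfEqInnerConst (volume : Measure R3) ((2:NNReal) : ℝ) : NNReal) : ENNReal) = ENNReal.ofReal K := by
      rw [hK, ENNReal.ofReal_coe_nnreal]
    rw [e, ← ENNReal.ofReal_mul hK0, ENNReal.ofReal_le_ofReal_iff (by positivity)] at h1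
    simpa using h1
  have h3 := pow_le_pow_left₀ (by positivity) h2 2
  rw [mul_pow, ← Real.rpow_natCast, ← Real.rpow_mul hA0, ← Real.rpow_natCast (_ ^ (1 / 2 : ℝ)), ← Real.rpow_mul hD0] at h3
  rw [show (1 / 6 : ℝ) * ((2:ℕ) : ℝ) = 1 / 3 by norm_num, show (1 / 2 : ℝ) * ((2:ℕ) : ℝ) = 1 by norm_num, Real.rpow_one] at h3
  refine h3.trans ((mul_le_mul_of_nonneg_left hD (sq_nonneg K)).trans ?_)
  linarith

lemma IsCut.sob {C0 : ℝ} (hC0 : 0 < C0) : ∃ C, 0 < C ∧ ∀ {η w : R3 → ℝ} {ρ τ : ℝ}, IsCut η C0 ρ τ → Sm w → ρ < τ →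
    (∫ x in ball 0 ρ, |w x| ^ (6:ℝ)) ^ (1 / 3 : ℝ) ≤ C * ((∫ x, η x * g2 w x) +
      (τ - ρ)⁻¹ ^ 2 * ∫ x in Sh ρ τ, |w x| ^ 2) := by
  obtain ⟨C, hC, h⟩ := sobolev
  refine ⟨C * (2 + 6 * C0 ^ 2), by positivity, fun {η w ρ τ} c sw hρτ => ?_⟩
  have hd : 0 < τ - ρ := by linarith
  have hη := c.sm
  have hcη := c.hc
  have s1 := h (fun x => η x * w x) (hη.mul sw) hcη.mul_right
  have l1 : ∫ x in ball 0 ρ, |w x| ^ (6:ℝ) ≤ ∫ x, |η x * w x| ^ (6:ℝ) := by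
    have e : ∫ x in ball 0 ρ, |w x| ^ (6:ℝ) = ∫ x in ball 0 ρ, |η x * w x| ^ (6:ℝ) := by
      refine setIntegral_congr_fun measurableSet_ball fun x hx => ?_
      have : ‖x‖ ≤ ρ := by simpa using (mem_ball_zero_iff.1 hx).le
      simp [c.e1 x this]
    rw [e]
    exact setIntegral_le_integral (CC.integrable (CC.rpow ⟨hη.continuous.mul sw.continuous, hcη.mul_right⟩ (by norm_num)))
      (Eventually.of_forall fun x => by positivity)
  set P : R3 → ℝ := fun x => 2 * w x ^ 2 * ∑ j, dv (ee j) η x ^ 2 with hP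
  have zP : ∀ x, x ∉ Sh ρ τ → P x = 0 := by
    intro x hx
    have hx' : ‖x‖ < ρ + (τ - ρ) / 4 ∨ ρ + (τ - ρ) / 2 < ‖x‖ := by
      rw [mem_Sh, not_and_or, not_le, not_lt] at hx
      rcases hx with hx | hx
      · left; linarith
      · right; linarith
    simp [hP, c.z1 _ x hx']
  have sP : Continuous P := by
    have : ∀ j, Continuous (dv (ee j) η) := fun j => (hη.dv _).continuous
    have := sw.continuous
    fun_prop
  have cP : HasCompactSupport P := cs_of_ball (r := τ) fun x hx => zP x (by rw [mem_Sh]; simp [hx])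
  have ig : Integrable fun x => η x * g2 w x := CC.integrable ⟨hη.continuous.mul (sm_g2 sw).continuous, hcη.mul_right⟩
  have l2 : ∫ x, g2 (fun x => η x * w x) x ≤ 2 * (∫ x, η x * g2 w x) + ∫ x, P x := by
    rw [← integral_const_mul, ← integral_add (ig.const_mul _) (CC.integrable ⟨sP, cP⟩)]
    refine integral_mono_of_nonneg (Eventually.of_forall fun x => g2_nonneg _ x) ((ig.const_mul _).add (CC.integrable ⟨sP, cP⟩))
      (Eventually.of_forall fun x => ?_)
    have hn := c.n0 x
    have hl := c.l1 x
    have : ∀ j, dv (ee j) (fun x => η x * w x) x ^ 2 ≤ 2 * (η x * dv (ee j) w x ^ 2) + 2 * w x ^ 2 * dv (ee j) η x ^ 2 := by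
      intro j
      rw [dv_fmul hη sw]
      have k : η x ^ 2 * dv (ee j) w x ^ 2 ≤ η x * dv (ee j) w x ^ 2 :=
        mul_le_mul_of_nonneg_right (by nlinarith) (sq_nonneg _)
      simp only
      nlinarith [sq_nonneg (η x * dv (ee j) w x - w x * dv (ee j) η x)]
    refine (Finset.sum_le_sum fun j _ => this j).trans (le_of_eq ?_)
    simp only [hP, g2, Finset.sum_add_distrib, Finset.mul_sum]
  have l3 : ∫ x, P x ≤ 6 * C0 ^ 2 * ((τ - ρ)⁻¹ ^ 2 * ∫ x in Sh ρ τ, |w x| ^ 2) := by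
    rw [int_eq_set zP, ← mul_assoc, ← integral_const_mul]
    refine integral_mono ((BM_Sh ρ τ).int sP) ((BM_Sh ρ τ).int (by have := sw.continuous; fun_prop)) fun x => ?_
    have : ∑ j, dv (ee j) η x ^ 2 ≤ 3 * (C0 / (τ - ρ)) ^ 2 := by
      refine (Finset.sum_le_sum (g := fun _ => (C0 / (τ - ρ)) ^ 2) fun j _ => ?_).trans (le_of_eq (by simp))
      exact sq_le_sq' (by linarith [(abs_le.1 (c.d1 j x)).1]) (abs_le.1 (c.d1 j x)).2
    simp only [hP, sq_abs]
    calc _ ≤ 2 * w x ^ 2 * (3 * (C0 / (τ - ρ)) ^ 2) := by gcongr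
      _ = _ := by field_simp; ring
  have n1 : 0 ≤ ∫ x, η x * g2 w x := integral_nonneg fun x => mul_nonneg (c.n0 x) (g2_nonneg _ _)
  have n2 : 0 ≤ (τ - ρ)⁻¹ ^ 2 * ∫ x in Sh ρ τ, |w x| ^ 2 :=
    mul_nonneg (by positivity) (integral_nonneg fun x => by positivity)
  calc _ ≤ (∫ x, |η x * w x| ^ (6:ℝ)) ^ (1 / 3 : ℝ) :=
        Real.rpow_le_rpow (integral_nonneg fun x => by positivity) l1 (by norm_num)
    _ ≤ _ := s1
    _ ≤ C * (2 * (∫ x, η x * g2 w x) + 6 * C0 ^ 2 * ((τ - ρ)⁻¹ ^ 2 * ∫ x in Sh ρ τ, |w x| ^ 2)) := by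
        gcongr; linarith
    _ ≤ _ := by
        rw [mul_assoc C]
        refine mul_le_mul_of_nonneg_left ?_ hC.le
        nlinarith [sq_nonneg C0, mul_nonneg (sq_nonneg C0) n1]

def N6 (f : R3 → ℝ) (E : Set R3) : ℝ := (∫ x in E, f x ^ (6:ℝ)) ^ (1 / 3 : ℝ)

lemma N6_nonneg {f : R3 → ℝ} (f0 : ∀ x, 0 ≤ f x) (E : Set R3) : 0 ≤ N6 f E :=
  Real.rpow_nonneg (setint_nonneg f0 _) _

lemma N6_vec {u : R3 → R3} (cu : Continuous u) {E : Set R3} (hE : BM E) {T : ℝ} (hT : 0 ≤ T)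
    (h : ∀ i, N6 (fun x => |u x i|) E ≤ T) : N6 (fun x => ‖u x‖) E ≤ 13 * T := by
  have cui : ∀ i, Continuous fun x => |u x i| := fun i => by fun_prop
  have hI : ∀ i, ∫ x in E, |u x i| ^ (6:ℝ) ≤ T ^ (3:ℝ) := by
    intro i
    have h0 : 0 ≤ ∫ x in E, |u x i| ^ (6:ℝ) := setint_nonneg (fun x => abs_nonneg _) _
    have := Real.rpow_le_rpow (N6_nonneg (fun x => abs_nonneg _) E) (h i) (show (0:ℝ) ≤ 3 by norm_num)
    rw [N6, ← Real.rpow_mul h0] at this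
    norm_num at this
    simpa using this
  have h1 : ∫ x in E, ‖u x‖ ^ (6:ℝ) ≤ 729 * ∑ i, ∫ x in E, |u x i| ^ (6:ℝ) := by
    have ii : ∀ i, IntegrableOn (fun x => |u x i| ^ (6:ℝ)) E := fun i => hE.int (cont_rpow (cui i) (by norm_num))
    rw [← integral_finsetSum _ fun i _ => ii i, ← integral_const_mul]
    refine integral_mono (hE.int (cont_rpow cu.norm (by norm_num))) ((integrable_finsetSum _ fun i _ => ii i).const_mul _) fun x => ?_
    obtain ⟨i, -, hi⟩ := Finset.exists_max_image Finset.univ (fun i => |u x i|) Finset.univ_nonempty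
    have hle : ‖u x‖ ≤ 3 * |u x i| := by
      rw [EuclideanSpace.norm_eq]
      refine Real.sqrt_le_iff.2 ⟨by positivity, ?_⟩
      simp only [Fin.sum_univ_three, Real.norm_eq_abs]
      have q : ∀ j, |u x j| ^ 2 ≤ |u x i| ^ 2 := fun j => by have := hi j (Finset.mem_univ j); gcongr
      nlinarith [q 0, q 1, q 2, sq_nonneg |u x i|]
    calc ‖u x‖ ^ (6:ℝ) ≤ (3 * |u x i|) ^ (6:ℝ) := Real.rpow_le_rpow (norm_nonneg _) hle (by norm_num)
      _ = 729 * |u x i| ^ (6:ℝ) := by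
        rw [Real.mul_rpow (by norm_num) (abs_nonneg _)]; norm_num
      _ ≤ _ := by
        refine mul_le_mul_of_nonneg_left ?_ (by norm_num)
        exact Finset.single_le_sum (f := fun j => |u x j| ^ (6:ℝ)) (fun _ _ => by positivity) (Finset.mem_univ i)
  have h2 : ∫ x in E, ‖u x‖ ^ (6:ℝ) ≤ (13 * T) ^ (3:ℝ) := by
    refine h1.trans ((mul_le_mul_of_nonneg_left (Finset.sum_le_sum fun i _ => hI i) (by norm_num)).trans ?_)
    rw [Real.mul_rpow (by norm_num) hT]
    simp only [Finset.sum_const, Finset.card_univ, Fintype.card_fin, nsmul_eq_mul]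
    have : 0 ≤ T ^ (3:ℝ) := by positivity
    norm_num
    norm_num at this
    linarith
  rw [N6]
  calc _ ≤ ((13 * T) ^ (3:ℝ)) ^ (1 / 3 : ℝ) := Real.rpow_le_rpow (setint_nonneg (fun x => norm_nonneg _) _) h2 (by norm_num)
    _ = 13 * T := by rw [← Real.rpow_mul (by positivity)]; norm_num

def GG (a b c : R3 → ℝ) (E : Set R3) : ℝ := N6 a E + N6 b E + N6 c E

lemma KE {p : ℝ} (hp : 3 ≤ p) : ∃ C, 0 < C ∧ ∀ {u v : R3 → R3} {pr θ : R3 → ℝ}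
    (_ : ContDiff ℝ (⊤ : ℕ∞) u) (_ : ContDiff ℝ (⊤ : ℕ∞) v) (_ : ContDiff ℝ (⊤ : ℕ∞) pr)
    (_ : ContDiff ℝ (⊤ : ℕ∞) θ) (_ : TCM u v pr θ) (R ρ τ : ℝ), 0 < R → R ≤ ρ → ρ < τ → τ ≤ 2 * R →
    GG (fun x => ‖u x‖) (fun x => ‖v x‖) (fun x => |θ x|) (ball 0 ρ) ≤ C * ((τ - ρ) / R)⁻¹ ^ 6 *
      TE (fun x => ‖u x‖) (fun x => ‖v x‖) (fun x => |θ x|) p R (Sh ρ τ) := by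
  obtain ⟨κ, φ, m⟩ := exists_moll
  obtain ⟨C0, hC0, hcut⟩ := exists_cut
  obtain ⟨C1, hC1, hen⟩ := Ctx.energy hC0 m hp
  obtain ⟨C2, hC2, hsob⟩ := IsCut.sob hC0
  refine ⟨27 * (C2 * (C1 + 1)), by positivity, fun {u v pr θ} hu hv hpr hθ hsol R ρ τ hR hRρ hρτ hτ => ?_⟩
  have S := Sys.of_tcm hu hv hpr hθ hsol
  obtain ⟨η, cut⟩ := hcut ρ τ (by linarith) hρτ
  have c : Ctx C0 κ φ (fun i x => u x i) (fun i x => v x i) pr θ (fun x => ‖u x‖) (fun x => ‖v x‖) η ρ τ :=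
    ⟨S, m, cut, hu.continuous.norm, hv.continuous.norm, fun i x => PiLp.norm_apply_le (u x) i,
      fun i x => PiLp.norm_apply_le (v x) i, hC0, by linarith, hρτ⟩
  have he := hen c R hR hRρ hτ
  have hd : 0 < τ - ρ := by linarith
  set d := τ - ρ with hdd
  have hs : ∃ t, 1 ≤ t ∧ d⁻¹ = t * R⁻¹ ∧ (d / R)⁻¹ = t := by
    refine ⟨(d / R)⁻¹, ?_, ?_, rfl⟩
    · rw [inv_div, le_div_iff₀ hd]; linarith
    · field_simp
  obtain ⟨t, ht, hdt, ht'⟩ := hs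
  rw [ht'] at he ⊢
  have hE := BM_Sh ρ τ
  have q1 : 0 ≤ ∫ x in Sh ρ τ, ‖u x‖ ^ 2 := integral_nonneg fun x => by positivity
  have q2 : 0 ≤ ∫ x in Sh ρ τ, ‖v x‖ ^ 2 := integral_nonneg fun x => by positivity
  have q3 : 0 ≤ ∫ x in Sh ρ τ, |θ x| ^ 2 := integral_nonneg fun x => by positivity
  have q4 : 0 ≤ ∫ x in Sh ρ τ, ‖u x‖ ^ 3 := integral_nonneg fun x => by positivity
  have q7 : 0 ≤ ∫ x in Sh ρ τ, |θ x| * ‖v x‖ := integral_nonneg fun x => by positivity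
  have q5 : 0 ≤ MX (fun x => ‖u x‖) (fun x => ‖v x‖) p (Sh ρ τ) := MX_nonneg c.a0 c.b0 _ _
  have q6 : 0 ≤ MX (fun x => ‖u x‖) (fun x => |θ x|) p (Sh ρ τ) := MX_nonneg c.a0 (fun x => abs_nonneg _) _ _
  set Tt := TE (fun x => ‖u x‖) (fun x => ‖v x‖) (fun x => |θ x|) p R (Sh ρ τ) with hTt
  have hT : R⁻¹ ^ 2 * ((∫ x in Sh ρ τ, ‖u x‖ ^ 2) + (∫ x in Sh ρ τ, ‖v x‖ ^ 2) + ∫ x in Sh ρ τ, |θ x| ^ 2) ≤ Tt := by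
    rw [hTt, TE]
    refine le_add_of_nonneg_right (by positivity)
  have hT0 : 0 ≤ Tt := le_trans (by positivity) hT
  set T := C2 * (C1 + 1) * t ^ 6 * Tt with hTT
  have key : ∀ w, Sm w → (∀ x, g2 w x ≤ Ed (fun i x => u x i) (fun i x => v x i) θ x) →
      (∫ x in Sh ρ τ, |w x| ^ 2 ≤ (∫ x in Sh ρ τ, ‖u x‖ ^ 2) + (∫ x in Sh ρ τ, ‖v x‖ ^ 2) + ∫ x in Sh ρ τ, |θ x| ^ 2) →
      N6 (fun x => |w x|) (ball 0 ρ) ≤ T := by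
    intro w sw hg hi
    refine (hsob cut sw hρτ).trans ?_
    have e1 : ∫ x, η x * g2 w x ≤ C1 * t ^ 6 * Tt := by
      refine le_trans (integral_mono ?_ ?_ fun x => mul_le_mul_of_nonneg_left (hg x) (cut.n0 x)) he
      · exact CC.integrable ⟨cut.sm.continuous.mul (sm_g2 sw).continuous, cut.hc.mul_right⟩
      · refine CC.integrable ⟨cut.sm.continuous.mul ?_, cut.hc.mul_right⟩
        exact (((sm_sum fun i => sm_g2 (S.sU i)).add (sm_sum fun i => sm_g2 (S.sV i))).add (sm_g2 S.sθ)).continuous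
    have t2 : t ^ 2 ≤ t ^ 6 := pow_le_pow_right₀ ht (by norm_num)
    have e2 : d⁻¹ ^ 2 * ∫ x in Sh ρ τ, |w x| ^ 2 ≤ t ^ 6 * Tt := by
      rw [hdt, mul_pow, mul_assoc]
      refine mul_le_mul t2 ((mul_le_mul_of_nonneg_left hi (by positivity)).trans hT) ?_ (by positivity)
      exact mul_nonneg (by positivity) (integral_nonneg fun x => by positivity)
    rw [hTT]
    calc _ ≤ C2 * (C1 * t ^ 6 * Tt + t ^ 6 * Tt) := mul_le_mul_of_nonneg_left (add_le_add e1 e2) hC2.le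
      _ = _ := by ring
  have gU : ∀ i x, g2 (fun x => u x i) x ≤ ∑ i, g2 (fun x => u x i) x := fun i x =>
    Finset.single_le_sum (f := fun i => g2 (fun x => u x i) x) (fun _ _ => g2_nonneg _ _) (Finset.mem_univ i)
  have gV : ∀ i x, g2 (fun x => v x i) x ≤ ∑ i, g2 (fun x => v x i) x := fun i x =>
    Finset.single_le_sum (f := fun i => g2 (fun x => v x i) x) (fun _ _ => g2_nonneg _ _) (Finset.mem_univ i)
  have gU0 : ∀ x, 0 ≤ ∑ i, g2 (fun x => u x i) x := fun x => Finset.sum_nonneg fun _ _ => g2_nonneg _ _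
  have gV0 : ∀ x, 0 ≤ ∑ i, g2 (fun x => v x i) x := fun x => Finset.sum_nonneg fun _ _ => g2_nonneg _ _
  have hT0' : 0 ≤ T := by positivity
  have cu := hu.continuous
  have cv := hv.continuous
  have cθ := hθ.continuous
  have k1 : N6 (fun x => ‖u x‖) (ball 0 ρ) ≤ 13 * T := N6_vec cu (BM_ball ρ) hT0' fun i => by
    refine key _ (S.sU i) (fun x => ?_) ?_
    · have := gU i x; have := gV0 x; have := g2_nonneg θ x
      rw [Ed]; linarith
    · have : ∫ x in Sh ρ τ, |u x i| ^ 2 ≤ ∫ x in Sh ρ τ, ‖u x‖ ^ 2 :=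
        integral_mono (hE.int (by fun_prop)) (hE.int (by fun_prop)) fun x => by have := c.ha i x; simp only; gcongr
      linarith
  have k2 : N6 (fun x => ‖v x‖) (ball 0 ρ) ≤ 13 * T := N6_vec cv (BM_ball ρ) hT0' fun i => by
    refine key _ (S.sV i) (fun x => ?_) ?_
    · have := gV i x; have := gU0 x; have := g2_nonneg θ x
      rw [Ed]; linarith
    · have : ∫ x in Sh ρ τ, |v x i| ^ 2 ≤ ∫ x in Sh ρ τ, ‖v x‖ ^ 2 :=
        integral_mono (hE.int (by fun_prop)) (hE.int (by fun_prop)) fun x => by have := c.hb i x; simp only; gcongr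
      linarith
  have k3 : N6 (fun x => |θ x|) (ball 0 ρ) ≤ T := by
    refine key _ S.sθ (fun x => ?_) (by linarith)
    have := gV0 x; have := gU0 x
    rw [Ed]; linarith
  rw [GG]
  calc _ ≤ 13 * T + 13 * T + T := by linarith
    _ = _ := by rw [hTT]; ring

lemma L1 {E : Set R3} (hE : BM E) {f : R3 → ℝ} (hf : Continuous f) (f0 : ∀ x, 0 ≤ f x) {CV R Q δ m k e : ℝ}
    (hCV : 1 ≤ CV) (hR : 1 ≤ R) (hv : volume.real E ≤ CV * R ^ 3) (hm : 0 < m) (hmk : m ≤ k) (hQ0 : 0 ≤ Q)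
    (hQ : (∫ x in E, f x ^ k) ^ (1 / k) ≤ R ^ δ * Q) (he : δ * m + 3 * (1 - m / k) ≤ e) :
    ∫ x in E, f x ^ m ≤ CV * R ^ e * Q ^ m := by
  have hR0 : 0 < R := by linarith
  have hk : 0 < k := by linarith
  have hI : 0 ≤ ∫ x in E, f x ^ k := setint_nonneg f0 k
  have h1 : 0 ≤ 1 - m / k := by rw [sub_nonneg, div_le_one hk]; exact hmk
  have h2 : 1 - m / k ≤ 1 := by have : 0 < m / k := by positivity
                                linarith
  refine (hE.lower hf f0 hm hmk).trans ?_
  have s1 : (∫ x in E, f x ^ k) ^ (m / k) ≤ R ^ (δ * m) * Q ^ m := by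
    calc _ = ((∫ x in E, f x ^ k) ^ (1 / k)) ^ m := by rw [← Real.rpow_mul hI]; congr 1; ring
      _ ≤ (R ^ δ * Q) ^ m := Real.rpow_le_rpow (by positivity) hQ hm.le
      _ = _ := by rw [Real.mul_rpow (by positivity) hQ0, ← Real.rpow_mul hR0.le]
  have s2 : volume.real E ^ (1 - m / k) ≤ CV * R ^ (3 * (1 - m / k)) := by
    calc _ ≤ (CV * R ^ 3) ^ (1 - m / k) := Real.rpow_le_rpow measureReal_nonneg hv h1
      _ = CV ^ (1 - m / k) * R ^ (3 * (1 - m / k)) := by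
        rw [Real.mul_rpow (by positivity) (by positivity), ← Real.rpow_natCast, ← Real.rpow_mul hR0.le]; norm_num
      _ ≤ _ := by
        gcongr
        exact (Real.rpow_le_rpow_of_exponent_le hCV h2).trans_eq (Real.rpow_one _)
  calc _ ≤ (R ^ (δ * m) * Q ^ m) * (CV * R ^ (3 * (1 - m / k))) :=
        mul_le_mul s1 s2 (by positivity) (by positivity)
    _ = CV * R ^ (δ * m + 3 * (1 - m / k)) * Q ^ m := by rw [Real.rpow_add hR0]; ring
    _ ≤ _ := by gcongr

lemma L2 {E : Set R3} (hE : BM E) {f : R3 → ℝ} (hf : Continuous f) (f0 : ∀ x, 0 ≤ f x) {R Q δ m k x n g h : ℝ}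
    (hR : 1 ≤ R) (hk : 0 < k) (hx : 0 < x) (hx1 : x < 1) (hm : m = k * x + 6 * (1 - x)) (hn : 0 ≤ n) (hQ0 : 0 ≤ Q)
    (hQ : (∫ x in E, f x ^ k) ^ (1 / k) ≤ R ^ δ * Q) (hg : g = k * x * n) (hh : h = 3 * (1 - x) * n) :
    (∫ x in E, f x ^ m) ^ n ≤ R ^ (δ * g) * Q ^ g * N6 f E ^ h := by
  have hR0 : 0 < R := by linarith
  have hI : 0 ≤ ∫ x in E, f x ^ k := setint_nonneg f0 k
  have hI6 : 0 ≤ ∫ x in E, f x ^ (6:ℝ) := setint_nonneg f0 6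
  have hg0 : 0 ≤ g := by rw [hg]; positivity
  have := Real.rpow_le_rpow (setint_nonneg f0 m) (hE.interp hf f0 hk (by norm_num : (0:ℝ) < 6) hx hx1 hm) hn
  refine this.trans ?_
  rw [Real.mul_rpow (by positivity) (by positivity), ← Real.rpow_mul hI, ← Real.rpow_mul hI6, N6, ← Real.rpow_mul hI6,
    show 1 / 3 * h = (1 - x) * n by rw [hh]; ring]
  refine mul_le_mul_of_nonneg_right ?_ (by positivity)
  calc _ = ((∫ x in E, f x ^ k) ^ (1 / k)) ^ g := by
        rw [← Real.rpow_mul hI]; congr 1; rw [hg]; field_simp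
    _ ≤ (R ^ δ * Q) ^ g := Real.rpow_le_rpow (by positivity) hQ hg0
    _ = _ := by rw [Real.mul_rpow (by positivity) hQ0, ← Real.rpow_mul hR0.le]

/-- the exponents -/
structure Ex (p q r α β γ : ℝ) : Prop where
  hp1 : 3 ≤ p
  hp2 : p ≤ 9 / 2
  hq1 : 2 ≤ q
  hq2 : q < 2 * (p / (p - 1))
  hr1 : 1 ≤ r
  hr2 : r < 2
  hα2 : α ≤ 3 / p - 2 / 3
  hβ2 : β ≤ 3 / q - 1 / 2
  hγ2 : γ ≤ 3 / r - 1 / 2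
  hc1 : α + ((4 * p - 6) * q / ((6 - q) * p)) * β ≤ 1
  hc2 : α + ((4 * p - 6) * r / ((6 - r) * p)) * γ ≤ 1
  hc3 : β + (2 * r / (6 - r)) * γ ≤ (6 - q) / (2 * q)

def eA (r : ℝ) : ℝ := 2 * r / (6 - r)
def eg (p q : ℝ) : ℝ := (4 * p - 6) * q / ((6 - q) * p)
def eh (p q : ℝ) : ℝ := 3 * (1 - (6 - 2 * (p / (p - 1))) / (6 - q)) / (p / (p - 1))

lemma aux_x {P k : ℝ} (h : 6 - k ≠ 0) : 2 * P = k * ((6 - 2 * P) / (6 - k)) + 6 * (1 - (6 - 2 * P) / (6 - k)) := by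
  field_simp; ring

lemma eA_bd {r : ℝ} (hr1 : 1 ≤ r) (hr2 : r < 2) : 0 < eA r ∧ eA r < 1 := by
  rw [eA]; constructor
  · have : 0 < 6 - r := by linarith
    positivity
  · rw [div_lt_one (by linarith)]; linarith

lemma eh_bd {p q : ℝ} (hp1 : 3 ≤ p) (hq1 : 1 ≤ q) (hq2 : q < 2 * (p / (p - 1))) : 0 < eh p q ∧ eh p q < 1 ∧ 0 ≤ eg p q ∧
    0 < (6 - 2 * (p / (p - 1))) / (6 - q) ∧ (6 - 2 * (p / (p - 1))) / (6 - q) < 1 ∧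
    eg p q = q * ((6 - 2 * (p / (p - 1))) / (6 - q)) * (1 / (p / (p - 1))) := by
  have h1 : p / (p - 1) ≤ 3 / 2 := by rw [div_le_div_iff₀ (by linarith) (by norm_num)]; linarith
  have h0 : 1 < p / (p - 1) := by rw [lt_div_iff₀ (by linarith)]; linarith
  have e1 : eg p q = q * ((6 - 2 * (p / (p - 1))) / (6 - q)) * (1 / (p / (p - 1))) := by
    have a1 : p - 1 ≠ 0 := by linarith
    have a2 : p ≠ 0 := by linarith
    have a3 : 6 - q ≠ 0 := by linarith
    rw [eg]; field_simp; ring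
  set P := p / (p - 1)
  have h6 : 0 < 6 - q := by linarith
  have x0 : 0 < (6 - 2 * P) / (6 - q) := div_pos (by linarith) h6
  have x1 : (6 - 2 * P) / (6 - q) < 1 := by rw [div_lt_one h6]; linarith
  refine ⟨?_, ?_, ?_, x0, x1, e1⟩
  · rw [eh]; exact div_pos (by linarith) (by linarith)
  · rw [eh, div_lt_one (by linarith)]
    have : 1 - (6 - 2 * P) / (6 - q) = (2 * P - q) / (6 - q) := by field_simp; ring
    rw [this, ← mul_div_assoc, div_lt_iff₀ h6]
    nlinarith
  · rw [e1]; positivity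

section
variable {p q r α β γ : ℝ}

set_option maxHeartbeats 1600000 in
lemma Ex.te (hx : Ex p q r α β γ) {E : Set R3} (hE : BM E) {a b c : R3 → ℝ} (ca : Continuous a) (cb : Continuous b)
    (cc : Continuous c) (a0 : ∀ x, 0 ≤ a x) (b0 : ∀ x, 0 ≤ b x) (c0 : ∀ x, 0 ≤ c x) {CV R X Y Z : ℝ}
    (hCV : 1 ≤ CV) (hR : 1 ≤ R) (hv : volume.real E ≤ CV * R ^ 3) (X0 : 0 ≤ X) (Y0 : 0 ≤ Y) (Z0 : 0 ≤ Z)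
    (hX : (∫ x in E, a x ^ p) ^ (1 / p) ≤ R ^ α * X) (hY : (∫ x in E, b x ^ q) ^ (1 / q) ≤ R ^ β * Y)
    (hZ : (∫ x in E, c x ^ r) ^ (1 / r) ≤ R ^ γ * Z) :
    TE a b c p R E ≤ CV * (X ^ 2 + X ^ 3) + (R⁻¹ ^ 2 * ∫ x in E, b x ^ 2) + Z ^ (2 * eA r) * N6 c E ^ (1 - eA r)
      + X * (Y ^ (eg p q) * N6 b E ^ (eh p q)) + X * (Z ^ (eg p r) * N6 c E ^ (eh p r))
      + CV * Y * Z ^ (eA r) * N6 c E ^ ((1 - eA r) / 2) ∧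
    R⁻¹ ^ 2 * ∫ x in E, b x ^ 2 ≤ CV * Y ^ 2 ∧ R⁻¹ ^ 2 * ∫ x in E, b x ^ 2 ≤ CV * N6 b E := by
  obtain ⟨hp1, hp2, hq1, hq2, hr1, hr2, hα2, hβ2, hγ2, hc1, hc2, hc3⟩ := hx
  have hR0 : 0 < R := by linarith
  have hp0 : 0 < p := by linarith
  have hq0 : 0 < q := by linarith
  have hr0 : 0 < r := by linarith
  have hP1 : 1 < p / (p - 1) := by rw [lt_div_iff₀ (by linarith)]; linarith
  have hP2 : p / (p - 1) ≤ 3 / 2 := by rw [div_le_div_iff₀ (by linarith) (by norm_num)]; linarith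
  have conv : ∀ {f : R3 → ℝ} (n : ℕ), ∫ x in E, f x ^ n = ∫ x in E, f x ^ (n : ℝ) := fun n => by simp only [Real.rpow_natCast]
  have Rn : ∀ n : ℕ, R⁻¹ ^ n = R ^ (-(n:ℝ)) := fun n => by
    rw [Real.rpow_neg hR0.le, Real.rpow_natCast, inv_pow]
  have R1 : R⁻¹ = R ^ (-(1:ℝ)) := by rw [Real.rpow_neg_one]
  have B0 := N6_nonneg b0 E
  have C0 := N6_nonneg c0 E
  -- a terms
  have ta2 : R⁻¹ ^ 2 * ∫ x in E, a x ^ 2 ≤ CV * X ^ 2 := by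
    have := L1 hE ca a0 hCV hR hv (m := ((2:ℕ):ℝ)) (k := p) (e := 2) (by norm_num) (by norm_num; linarith) X0 hX (by
      have : 3 * ((2:ℕ):ℝ) / p = 2 * (3 / p) := by push_cast; ring
      have e : 3 * (1 - ((2:ℕ):ℝ) / p) = 3 - 2 * (3 / p) := by push_cast; ring
      rw [e]; push_cast; linarith)
    rw [conv, Rn]
    refine (mul_le_mul_of_nonneg_left this (by positivity)).trans (le_of_eq ?_)
    rw [Real.rpow_natCast X, ← mul_assoc, mul_left_comm, ← Real.rpow_add hR0]; norm_num
  have ta3 : R⁻¹ * ∫ x in E, a x ^ 3 ≤ CV * X ^ 3 := by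
    have := L1 hE ca a0 hCV hR hv (m := ((3:ℕ):ℝ)) (k := p) (e := 1) (by norm_num) (by norm_num; linarith) X0 hX (by
      have e : 3 * (1 - ((3:ℕ):ℝ) / p) = 3 - 3 * (3 / p) := by push_cast; ring
      rw [e]; push_cast; linarith)
    rw [conv, R1]
    refine (mul_le_mul_of_nonneg_left this (by positivity)).trans (le_of_eq ?_)
    rw [Real.rpow_natCast X, ← mul_assoc, mul_left_comm, ← Real.rpow_add hR0]; norm_num
  -- b terms
  have lb2 : ∀ e, β * 2 + 3 * (1 - 2 / q) ≤ e → ∫ x in E, b x ^ (2:ℝ) ≤ CV * R ^ e * Y ^ (2:ℝ) := fun e he =>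
    L1 hE cb b0 hCV hR hv (m := 2) (k := q) (e := e) (by norm_num) hq1 Y0 hY he
  have eq2 : 3 * (1 - 2 / q) = 3 - 2 * (3 / q) := by ring
  have tb2 : R⁻¹ ^ 2 * ∫ x in E, b x ^ 2 ≤ CV * Y ^ 2 := by
    have := lb2 2 (by rw [eq2]; linarith)
    rw [conv, Rn]; push_cast
    refine (mul_le_mul_of_nonneg_left this (by positivity)).trans (le_of_eq ?_)
    rw [Real.rpow_two Y, ← mul_assoc, mul_left_comm, ← Real.rpow_add hR0]; norm_num
  have tb6 : R⁻¹ ^ 2 * ∫ x in E, b x ^ 2 ≤ CV * N6 b E := by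
    have := L1 hE cb b0 hCV hR hv (m := 2) (k := 6) (δ := 0) (e := 2) (Q := (∫ x in E, b x ^ (6:ℝ)) ^ (1 / 6 : ℝ)) (by norm_num) (by norm_num)
      (Real.rpow_nonneg (setint_nonneg b0 6) _) (by simp) (by norm_num)
    rw [← Real.rpow_mul (setint_nonneg b0 6)] at this
    rw [conv, Rn, N6]; push_cast
    refine (mul_le_mul_of_nonneg_left this (by positivity)).trans (le_of_eq ?_)
    rw [← mul_assoc, mul_left_comm, ← Real.rpow_add hR0]; norm_num
  -- c terms
  obtain ⟨A0, A1⟩ := eA_bd hr1 hr2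
  have h6r : 0 < 6 - r := by linarith
  have x0 : 0 < 4 / (6 - r) := by positivity
  have x1 : 4 / (6 - r) < 1 := by rw [div_lt_one h6r]; linarith
  have eAr : eA r = r * (4 / (6 - r)) * (1 / 2) := by rw [eA]; ring
  have eAr' : 1 - eA r = 3 * (1 - 4 / (6 - r)) := by rw [eA]; field_simp; ring
  have hAγ : eA r * γ ≤ 1 := by
    have : eA r * (3 / r - 1 / 2) = 1 := by rw [eA]; field_simp; ring
    exact (mul_le_mul_of_nonneg_left hγ2 A0.le).trans_eq this
  have lc2 : ∀ n, 0 ≤ n → (∫ x in E, c x ^ (2:ℝ)) ^ n ≤ R ^ (γ * (2 * eA r * n)) * Z ^ (2 * eA r * n) * N6 c E ^ ((1 - eA r) * n) := fun n hn =>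
    L2 hE cc c0 hR (m := 2) (k := r) (x := 4 / (6 - r)) hr0 x0 x1 (by field_simp; ring) hn Z0 hZ (by rw [eAr]; ring) (by rw [eAr'])
  have tc2 : R⁻¹ ^ 2 * ∫ x in E, c x ^ 2 ≤ Z ^ (2 * eA r) * N6 c E ^ (1 - eA r) := by
    have := lc2 1 zero_le_one
    rw [Real.rpow_one, mul_one, mul_one] at this
    rw [conv, Rn]; push_cast
    refine (mul_le_mul_of_nonneg_left this (by positivity)).trans ?_
    rw [← mul_assoc, ← mul_assoc, ← Real.rpow_add hR0, mul_assoc]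
    refine mul_le_of_le_one_left (by positivity) (Real.rpow_le_one_of_one_le_of_nonpos hR (by linarith))
  -- products
  have mx : ∀ {f : R3 → ℝ} {k δ W : ℝ}, Continuous f → (∀ x, 0 ≤ f x) → 1 ≤ k → k < 2 * (p / (p - 1)) → 0 ≤ W →
      (∫ x in E, f x ^ k) ^ (1 / k) ≤ R ^ δ * W → α + eg p k * δ ≤ 1 →
      R⁻¹ * MX a f p E ≤ X * (W ^ (eg p k) * N6 f E ^ (eh p k)) := by
    intro f k δ W cf f0 hk1 hk2 W0 hW hd
    obtain ⟨e0, e1, e2, e3, e4, e5⟩ := eh_bd hp1 hk1 hk2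
    have F0 := N6_nonneg f0 E
    have := L2 hE cf f0 hR (m := 2 * (p / (p - 1))) (k := k) (n := 1 / (p / (p - 1))) (g := eg p k) (h := eh p k)
      (by linarith) e3 e4 (aux_x (by linarith)) (by positivity) W0 hW e5 (by rw [eh]; ring)
    rw [MX, R1]
    calc _ ≤ R ^ (-(1:ℝ)) * ((R ^ α * X) * (R ^ (δ * eg p k) * W ^ eg p k * N6 f E ^ eh p k)) := by
          refine mul_le_mul_of_nonneg_left (mul_le_mul hX this ?_ (by positivity)) (by positivity)
          exact Real.rpow_nonneg (setint_nonneg f0 _) _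
      _ = R ^ (-1 + α + δ * eg p k) * (X * (W ^ (eg p k) * N6 f E ^ (eh p k))) := by
          rw [Real.rpow_add hR0, Real.rpow_add hR0]; ring
      _ ≤ _ := mul_le_of_le_one_left (by positivity) (Real.rpow_le_one_of_one_le_of_nonpos hR (by linarith))
  have m1 := mx cb b0 (by linarith) hq2 Y0 hY hc1
  have m2 := mx cc c0 hr1 (by linarith) Z0 hZ hc2
  have tcb : R⁻¹ * ∫ x in E, c x * b x ≤ CV * Y * Z ^ (eA r) * N6 c E ^ ((1 - eA r) / 2) := by
    have h1 := hE.hold cc cb c0 b0 (P := 2) (Q := 2) (by norm_num) (by norm_num)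
    have h2 := lc2 (1 / 2) (by norm_num)
    have h3 : (∫ x in E, b x ^ (2:ℝ)) ^ (1 / 2 : ℝ) ≤ CV * R ^ (β + 3 / 2 - 3 / q) * Y := by
      have := Real.rpow_le_rpow (setint_nonneg b0 2) (lb2 _ le_rfl) (show (0:ℝ) ≤ 1 / 2 by norm_num)
      refine this.trans ?_
      rw [Real.mul_rpow (by positivity) (by positivity), Real.mul_rpow (by positivity) (by positivity),
        ← Real.rpow_mul hR0.le, ← Real.rpow_mul Y0, show (2:ℝ) * (1 / 2) = 1 by norm_num, Real.rpow_one,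
        show (β * 2 + 3 * (1 - 2 / q)) * (1 / 2) = β + 3 / 2 - 3 / q by ring]
      gcongr
      exact (Real.rpow_le_rpow_of_exponent_le hCV (by norm_num)).trans_eq (Real.rpow_one _)
    rw [show 2 * eA r * (1 / 2) = eA r by ring, show (1 - eA r) * (1 / 2) = (1 - eA r) / 2 by ring] at h2
    have h3' : 0 ≤ (∫ x in E, b x ^ (2:ℝ)) ^ (1 / 2 : ℝ) := Real.rpow_nonneg (setint_nonneg b0 _) _
    rw [R1]
    have hq3 : (6 - q) / (2 * q) = 3 / q - 1 / 2 := by field_simp; ring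
    calc _ ≤ R ^ (-(1:ℝ)) * ((R ^ (γ * eA r) * Z ^ eA r * N6 c E ^ ((1 - eA r) / 2)) * (CV * R ^ (β + 3 / 2 - 3 / q) * Y)) := by
          refine mul_le_mul_of_nonneg_left (h1.trans (mul_le_mul h2 h3 h3' (by positivity))) (by positivity)
      _ = R ^ (-1 + γ * eA r + (β + 3 / 2 - 3 / q)) * (CV * Y * Z ^ (eA r) * N6 c E ^ ((1 - eA r) / 2)) := by
          rw [Real.rpow_add hR0, Real.rpow_add hR0]; ring
      _ ≤ _ := mul_le_of_le_one_left (by positivity) (Real.rpow_le_one_of_one_le_of_nonpos hR (by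
          rw [hq3] at hc3; rw [eA]; linarith))
  refine ⟨?_, tb2, tb6⟩
  rw [TE]
  linarith
end

lemma iter0 {f K H : ℝ} (f0 : 0 ≤ f) (f1 : f < 1) (hK : 1 ≤ K) {φ : ℕ → ℝ} (h0 : ∀ n, 0 ≤ φ n) (hH : ∀ n, φ n ≤ H)
    (h : ∀ n, φ n ≤ K * φ (n + 1) ^ f) : φ 0 ≤ K ^ (1 / (1 - f)) := by
  have hb : BddAbove (Set.range φ) := ⟨H, by rintro _ ⟨n, rfl⟩; exact hH n⟩
  set S := ⨆ n, φ n with hS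
  have hle : ∀ n, φ n ≤ S := fun n => le_ciSup hb n
  have S0 : 0 ≤ S := (h0 0).trans (hle 0)
  have h1 : S ≤ K * S ^ f := ciSup_le fun n => (h n).trans (by have := hle (n+1); have := h0 (n+1); gcongr)
  rcases S0.eq_or_lt with hz | hp
  · have := hle 0
    rw [← hz] at this
    exact this.trans (by positivity)
  · refine (hle 0).trans ?_
    have h2 : S ^ (1 - f) ≤ K := by
      rw [Real.rpow_sub hp, Real.rpow_one, div_le_iff₀ (by positivity)]; exact h1
    calc S = (S ^ (1 - f)) ^ (1 / (1 - f)) := by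
          rw [← Real.rpow_mul S0, mul_one_div_cancel (by linarith), Real.rpow_one]
      _ ≤ _ := Real.rpow_le_rpow (by positivity) h2 (by have : 0 < 1 - f := by linarith
                                                        positivity)

lemma iter1 {f D : ℝ} (f0 : 0 ≤ f) (f1 : f < 1) (hD : 1 ≤ D) : ∃ K, ∀ {R H : ℝ} {h : ℝ → ℝ}, 0 < R →
    (∀ ρ, 1 ≤ h ρ) → (∀ ρ, ρ ≤ 2 * R → h ρ ≤ H) →
    (∀ ρ τ, R ≤ ρ → ρ < τ → τ ≤ 2 * R → h ρ ≤ D * ((τ - ρ) / R)⁻¹ ^ 6 * h τ ^ f) → h R ≤ K := by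
  have hf : 0 < 1 - f := by linarith
  set k : ℝ := 6 / (1 - f) with hk
  have hk0 : 0 < k := by positivity
  have hkf : 6 + k * f = k := by rw [hk]; field_simp; ring
  refine ⟨(D * 2 ^ k) ^ (1 / (1 - f)), fun {R H h} hR h1 hH hh => ?_⟩
  set ρ : ℕ → ℝ := fun n => 2 * R - R * (2:ℝ) ^ (-(n:ℝ)) with hρ
  set φ : ℕ → ℝ := fun n => (2:ℝ) ^ (-(k * n)) * h (ρ n) with hφ
  have hl : ∀ n : ℕ, (2:ℝ) ^ (-(n:ℝ)) ≤ 1 := fun n => Real.rpow_le_one_of_one_le_of_nonpos (by norm_num) (by simp)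
  have hp : ∀ n : ℕ, 0 < (2:ℝ) ^ (-(n:ℝ)) := fun n => by positivity
  have hle : ∀ n, ρ n ≤ 2 * R := fun n => by have := mul_pos hR (hp n); simp only [hρ]; linarith
  have h0 : ∀ n, 0 ≤ h n := fun n => zero_le_one.trans (h1 n)
  have key := iter0 (φ := φ) (K := D * 2 ^ k) (H := H) f0 f1 (by
      have : (1:ℝ) ≤ 2 ^ k := Real.one_le_rpow (by norm_num) hk0.le
      nlinarith) (fun n => mul_nonneg (by positivity) (h0 _)) (fun n => by
      refine (mul_le_of_le_one_left (h0 _) ?_).trans (hH _ (hle n))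
      exact Real.rpow_le_one_of_one_le_of_nonpos (by norm_num) (by simp; positivity)) (fun n => by
      have e1 : ρ (n + 1) - ρ n = R * (2:ℝ) ^ (-((n:ℝ) + 1)) := by
        simp only [hρ]
        have : (2:ℝ) ^ (-(n:ℝ)) = 2 * (2:ℝ) ^ (-((n:ℝ) + 1)) := by
          rw [show -(n:ℝ) = 1 + -((n:ℝ) + 1) by ring, Real.rpow_add (by norm_num), Real.rpow_one]
        push_cast
        rw [this]; ring
      have g := hh (ρ n) (ρ (n + 1)) (by have := mul_le_mul_of_nonneg_left (hl n) hR.le; simp only [hρ]; linarith)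
        (by have : 0 < ρ (n + 1) - ρ n := by rw [e1]; positivity
            linarith) (hle _)
      have e2 : ((ρ (n + 1) - ρ n) / R)⁻¹ ^ 6 = (2:ℝ) ^ (6 * ((n:ℝ) + 1)) := by
        rw [e1, mul_div_cancel_left₀ _ hR.ne', ← Real.rpow_neg (by norm_num), neg_neg, ← Real.rpow_natCast,
          ← Real.rpow_mul (by norm_num)]
        congr 1; push_cast; ring
      have e3 : h (ρ (n + 1)) ^ f = (2:ℝ) ^ (k * ((n:ℝ) + 1) * f) * φ (n + 1) ^ f := by
        simp only [hφ]
        rw [Real.mul_rpow (by positivity) (h0 _), ← Real.rpow_mul (by norm_num), ← mul_assoc, ← Real.rpow_add (by norm_num)]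
        push_cast
        rw [show k * ((n:ℝ) + 1) * f + -(k * ((n:ℝ) + 1)) * f = 0 by ring]; simp
      rw [e2, e3] at g
      calc φ n ≤ (2:ℝ) ^ (-(k * n)) * (D * (2:ℝ) ^ (6 * ((n:ℝ) + 1)) * ((2:ℝ) ^ (k * ((n:ℝ) + 1) * f) * φ (n + 1) ^ f)) :=
            mul_le_mul_of_nonneg_left g (by positivity)
        _ = D * ((2:ℝ) ^ (-(k * n)) * (2:ℝ) ^ (6 * ((n:ℝ) + 1)) * (2:ℝ) ^ (k * ((n:ℝ) + 1) * f)) * φ (n + 1) ^ f := by ring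
        _ = _ := by
            rw [← Real.rpow_add (by norm_num), ← Real.rpow_add (by norm_num)]
            congr 3
            linear_combination ((n:ℝ) + 1) * hkf)
  have e : φ 0 = h R := by
    simp only [hφ, hρ]; norm_num; congr 1; ring
  rw [← e]; exact key

lemma N6_mono {f : R3 → ℝ} (cf : Continuous f) (f0 : ∀ x, 0 ≤ f x) {E F : Set R3} (hF : BM F) (h : E ⊆ F) : N6 f E ≤ N6 f F := by
  refine Real.rpow_le_rpow (setint_nonneg f0 _) ?_ (by norm_num)
  exact setIntegral_mono_set (hF.int (cont_rpow cf (by norm_num))) (Eventually.of_forall fun x => Real.rpow_nonneg (f0 x) _)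
    (LE.le.eventuallyLE h)

lemma Xn_le {g : R3 → ℝ} (cg : Continuous g) {k δ R ρ τ : ℝ} (hk : 0 < k) (hR : 0 < R) (hρ : R ≤ ρ) (hτ : τ ≤ 2 * R) :
    (∫ x in Sh ρ τ, |g x| ^ k) ^ (1 / k) ≤ R ^ δ * XnS g δ k R ∧ 0 ≤ XnS g δ k R := by
  have n0 : 0 ≤ lpS g k (annulus R) := Real.rpow_nonneg (setint_nonneg (fun x => abs_nonneg _) _) _
  refine ⟨?_, mul_nonneg (by positivity) n0⟩
  rw [XnS, ← mul_assoc, ← Real.rpow_add hR, add_neg_cancel, Real.rpow_zero, one_mul, lpS]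
  refine Real.rpow_le_rpow (setint_nonneg (fun x => abs_nonneg _) _) ?_ (by positivity)
  refine setIntegral_mono_set ((BM_Sh R (2 * R)).int (cont_rpow cg.abs hk.le)) (Eventually.of_forall fun x => by positivity)
    (LE.le.eventuallyLE fun x hx => ?_)
  rw [mem_Sh] at hx
  exact mem_Sh.2 ⟨hρ.trans hx.1, hx.2.trans_le hτ⟩

section
variable {p q r α β γ : ℝ}

set_option maxHeartbeats 1600000 in
lemma Ex.fin (hx : Ex p q r α β γ) {M : ℝ} (hM : 1 ≤ M) : ∃ K, ∀ {u v : R3 → R3} {pr θ : R3 → ℝ}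
    (_ : ContDiff ℝ (⊤ : ℕ∞) u) (_ : ContDiff ℝ (⊤ : ℕ∞) v) (_ : ContDiff ℝ (⊤ : ℕ∞) pr)
    (_ : ContDiff ℝ (⊤ : ℕ∞) θ) (_ : TCM u v pr θ) (R : ℝ), 1 ≤ R →
    XnV u α p R ≤ M → XnV v β q R ≤ M → XnS θ γ r R ≤ M →
    GG (fun x => ‖u x‖) (fun x => ‖v x‖) (fun x => |θ x|) (ball 0 R) ≤ K := by
  obtain ⟨C, hC, hKE⟩ := KE hx.hp1
  obtain ⟨CV, hCV, hvol⟩ := vol_Sh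
  have hp0 : 0 < p := by linarith [hx.hp1]
  have hP1 : 1 < p / (p - 1) := by rw [lt_div_iff₀ (by linarith [hx.hp1])]; linarith
  obtain ⟨A0, A1⟩ := eA_bd hx.hr1 hx.hr2
  obtain ⟨a1, a2, a3, -⟩ := eh_bd hx.hp1 (by linarith [hx.hq1]) hx.hq2
  obtain ⟨b1, b2, b3, -⟩ := eh_bd hx.hp1 hx.hr1 (by linarith [hx.hr2])
  set f := max (max (1 - eA r) (eh p q)) (eh p r) with hf
  have l1 : 1 - eA r ≤ f := (le_max_left _ _).trans (le_max_left _ _)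
  have l2 : eh p q ≤ f := (le_max_right _ _).trans (le_max_left _ _)
  have l3 : eh p r ≤ f := le_max_right _ _
  have l4 : (1 - eA r) / 2 ≤ f := by linarith
  have f0 : 0 ≤ f := by linarith
  have f1 : f < 1 := by
    rw [hf]; exact max_lt (max_lt (by linarith) a2) b2
  have M0 : 0 ≤ M := by linarith
  set D := CV * (M ^ 2 + M ^ 3) + CV * M ^ 2 + M ^ (2 * eA r) + M * M ^ (eg p q) + M * M ^ (eg p r) + CV * M * M ^ (eA r) with hD
  have D0 : 0 ≤ D := by positivity
  obtain ⟨K, hK⟩ := iter1 (D := C * D + 1) f0 f1 (by linarith [mul_nonneg hC.le D0])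
  refine ⟨K, fun {u v pr θ} hu hv hpr hθ hsol R hR hXM hYM hZM => ?_⟩
  have hR0 : 0 < R := by linarith
  set a := fun x => ‖u x‖ with ha
  set b := fun x => ‖v x‖ with hb
  set c := fun x => |θ x| with hc
  have ca : Continuous a := hu.continuous.norm
  have cb : Continuous b := hv.continuous.norm
  have cc : Continuous c := hθ.continuous.abs
  have a0 : ∀ x, 0 ≤ a x := fun x => norm_nonneg _
  have b0 : ∀ x, 0 ≤ b x := fun x => norm_nonneg _
  have c0 : ∀ x, 0 ≤ c x := fun x => abs_nonneg _
  have G0 : ∀ E, 0 ≤ GG a b c E := fun E => add_nonneg (add_nonneg (N6_nonneg a0 E) (N6_nonneg b0 E)) (N6_nonneg c0 E)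
  have Gm : ∀ ρ τ, ρ ≤ τ → GG a b c (ball 0 ρ) ≤ GG a b c (ball 0 τ) := fun ρ τ h =>
    add_le_add (add_le_add (N6_mono ca a0 (BM_ball τ) (ball_subset_ball h)) (N6_mono cb b0 (BM_ball τ) (ball_subset_ball h)))
      (N6_mono cc c0 (BM_ball τ) (ball_subset_ball h))
  have key : 1 + GG a b c (ball 0 R) ≤ K := by
    refine hK (h := fun ρ => 1 + GG a b c (ball 0 ρ)) (H := 1 + GG a b c (ball 0 (2 * R))) hR0
      (fun ρ => by have := G0 (ball 0 ρ); linarith) (fun ρ h => by have := Gm _ _ h; linarith) ?_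
    intro ρ τ h1 h2 h3
    have hE := BM_Sh ρ τ
    obtain ⟨x1, x2⟩ := Xn_le (k := p) (δ := α) ca hp0 hR0 h1 h3
    obtain ⟨y1, y2⟩ := Xn_le (k := q) (δ := β) cb (by linarith [hx.hq1]) hR0 h1 h3
    obtain ⟨z1, z2⟩ := Xn_le (k := r) (δ := γ) hθ.continuous (by linarith [hx.hr1]) hR0 h1 h3
    simp only [abs_of_nonneg (a0 _)] at x1
    simp only [abs_of_nonneg (b0 _)] at y1
    have hsub : Sh ρ τ ⊆ ball 0 τ := Set.sdiff_subset
    set g := 1 + GG a b c (ball 0 τ) with hg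
    have hg1 : 1 ≤ g := by have := G0 (ball 0 τ); linarith
    have B6 : N6 b (Sh ρ τ) ≤ g := by
      have := N6_mono cb b0 (BM_ball τ) hsub
      have := N6_nonneg a0 (ball 0 τ)
      have := N6_nonneg c0 (ball 0 τ)
      rw [hg, GG]; linarith
    have C6 : N6 c (Sh ρ τ) ≤ g := by
      have := N6_mono cc c0 (BM_ball τ) hsub
      have := N6_nonneg a0 (ball 0 τ)
      have := N6_nonneg b0 (ball 0 τ)
      rw [hg, GG]; linarith
    have pw : ∀ {y e : ℝ}, 0 ≤ y → y ≤ g → 0 ≤ e → e ≤ f → y ^ e ≤ g ^ f := fun {y e} hy hyg he hef =>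
      (Real.rpow_le_rpow hy hyg he).trans (Real.rpow_le_rpow_of_exponent_le hg1 hef)
    have B0 := N6_nonneg b0 (Sh ρ τ)
    have C0 := N6_nonneg c0 (Sh ρ τ)
    obtain ⟨t1, t2, -⟩ := hx.te hE ca cb cc a0 b0 c0 hCV hR (hvol R ρ τ hR0 h3) x2 y2 z2 x1 y1 z1
    have g1 : 1 ≤ g ^ f := Real.one_le_rpow hg1 f0
    have hT : TE a b c p R (Sh ρ τ) ≤ D * g ^ f := by
      refine t1.trans ?_
      change XnS a α p R ≤ M at hXM
      change XnS b β q R ≤ M at hYM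
      generalize XnS a α p R = X at *
      generalize XnS b β q R = Y at *
      generalize XnS θ γ r R = Z at *
      have e1 : CV * (X ^ 2 + X ^ 3) ≤ CV * (M ^ 2 + M ^ 3) * g ^ f := by
        refine le_trans ?_ (le_mul_of_one_le_right (by positivity) g1)
        gcongr
      have e2 : CV * Y ^ 2 ≤ CV * M ^ 2 * g ^ f := by
        refine le_trans ?_ (le_mul_of_one_le_right (by positivity) g1)
        gcongr
      have pM : ∀ {y e : ℝ}, 0 ≤ y → y ≤ M → 0 ≤ e → y ^ e ≤ M ^ e := fun hy h he => Real.rpow_le_rpow hy h he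
      have e3 : Z ^ (2 * eA r) * N6 c (Sh ρ τ) ^ (1 - eA r) ≤ M ^ (2 * eA r) * g ^ f :=
        mul_le_mul (pM z2 hZM (by linarith)) (pw C0 C6 (by linarith) l1) (by positivity) (by positivity)
      have e4 : X * (Y ^ (eg p q) * N6 b (Sh ρ τ) ^ (eh p q)) ≤ M * (M ^ (eg p q) * g ^ f) :=
        mul_le_mul hXM (mul_le_mul (pM y2 hYM a3) (pw B0 B6 a1.le l2) (by positivity) (by positivity)) (by positivity) M0
      have e5 : X * (Z ^ (eg p r) * N6 c (Sh ρ τ) ^ (eh p r)) ≤ M * (M ^ (eg p r) * g ^ f) :=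
        mul_le_mul hXM (mul_le_mul (pM z2 hZM b3) (pw C0 C6 b1.le l3) (by positivity) (by positivity)) (by positivity) M0
      have e6 : CV * Y * Z ^ (eA r) * N6 c (Sh ρ τ) ^ ((1 - eA r) / 2) ≤ CV * M * M ^ (eA r) * g ^ f := by
        refine mul_le_mul (mul_le_mul ?_ (pM z2 hZM A0.le) (by positivity) (by positivity))
          (pw C0 C6 (by linarith) l4) (by positivity) (by positivity)
        gcongr
      have e7 : D * g ^ f = CV * (M ^ 2 + M ^ 3) * g ^ f + CV * M ^ 2 * g ^ f + M ^ (2 * eA r) * g ^ f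
          + M * (M ^ (eg p q) * g ^ f) + M * (M ^ (eg p r) * g ^ f) + CV * M * M ^ (eA r) * g ^ f := by
        rw [hD]; ring
      rw [e7]
      linarith
    have hk := hKE hu hv hpr hθ hsol R ρ τ hR0 h1 h2 h3
    have ht : 1 ≤ ((τ - ρ) / R)⁻¹ := by
      rw [inv_div, le_div_iff₀ (by linarith)]; linarith
    set t := ((τ - ρ) / R)⁻¹
    have ht6 : 1 ≤ t ^ 6 := one_le_pow₀ ht
    calc 1 + GG a b c (ball 0 ρ) ≤ t ^ 6 * g ^ f + C * t ^ 6 * (D * g ^ f) := by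
          refine add_le_add (one_le_mul_of_one_le_of_one_le ht6 g1) (hk.trans ?_)
          exact mul_le_mul_of_nonneg_left hT (by positivity)
      _ = _ := by ring
  linarith
end

lemma int6 {f : R3 → ℝ} (cf : Continuous f) (f0 : ∀ x, 0 ≤ f x) {Rs : ℕ → ℝ} (hRs : Tendsto Rs atTop atTop) {K : ℝ}
    (hK : ∀ᶠ j in atTop, N6 f (ball 0 (Rs j)) ≤ K) :
    Tendsto (fun j => N6 f (Sh (Rs j) (2 * Rs j))) atTop (nhds 0) ∧
    (Tendsto (fun j => N6 f (ball 0 (Rs j))) atTop (nhds 0) → ∀ x, f x = 0) := by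
  have c6 : Continuous fun x => f x ^ (6:ℝ) := cont_rpow cf (by norm_num)
  have n6 : ∀ x, 0 ≤ f x ^ (6:ℝ) := fun x => Real.rpow_nonneg (f0 x) _
  have cov : AECover (volume : Measure R3) atTop (fun j => ball (0:R3) (Rs j)) := aecover_ball hRs
  have cov2 : AECover (volume : Measure R3) atTop (fun j => ball (0:R3) (2 * Rs j)) :=
    aecover_ball (hRs.const_mul_atTop (by norm_num))
  have hi : Integrable fun x => f x ^ (6:ℝ) := by
    refine cov.integrable_of_integral_bounded_of_nonneg_ae (K ^ (3:ℝ)) (fun j => (BM_ball _).int c6)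
      (Eventually.of_forall n6) (hK.mono fun j hj => ?_)
    have h0 : 0 ≤ ∫ x in ball 0 (Rs j), f x ^ (6:ℝ) := setint_nonneg f0 _
    have := Real.rpow_le_rpow (N6_nonneg f0 _) hj (show (0:ℝ) ≤ 3 by norm_num)
    rw [N6, ← Real.rpow_mul h0, show (1 / 3 : ℝ) * 3 = 1 by norm_num, Real.rpow_one] at this
    exact this
  have t1 := cov.integral_tendsto_of_countably_generated hi
  have t2 := cov2.integral_tendsto_of_countably_generated hi
  constructor
  · have t3 : Tendsto (fun j => ∫ x in Sh (Rs j) (2 * Rs j), f x ^ (6:ℝ)) atTop (nhds 0) := by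
      have := t2.sub t1
      rw [sub_self] at this
      refine this.congr' ?_
      filter_upwards [hRs.eventually_ge_atTop 0] with j hj
      rw [Sh, setIntegral_sdiff measurableSet_ball hi.integrableOn (ball_subset_ball (by linarith))]
    have := t3.rpow_const (p := 1 / 3) (Or.inr (by norm_num))
    rwa [Real.zero_rpow (by norm_num)] at this
  · intro h
    have e : (∫ x, f x ^ (6:ℝ)) ^ (1 / 3 : ℝ) = 0 :=
      tendsto_nhds_unique (t1.rpow_const (p := 1 / 3) (Or.inr (by norm_num))) h
    have e0 : ∫ x, f x ^ (6:ℝ) = 0 := by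
      rwa [Real.rpow_eq_zero (integral_nonneg n6) (by norm_num)] at e
    rw [integral_eq_zero_iff_of_nonneg n6 hi] at e0
    have e1 := (c6.ae_eq_iff_eq volume continuous_zero).1 e0
    intro x
    have := congrFun e1 x
    simp only [Pi.zero_apply] at this
    rwa [Real.rpow_eq_zero (f0 x) (by norm_num)] at this

theorem liouville_tcm_A4 (u v : R3 → R3) (pr θ : R3 → ℝ)
    (hu : ContDiff ℝ (⊤ : ℕ∞) u) (hv : ContDiff ℝ (⊤ : ℕ∞) v)
    (hpr : ContDiff ℝ (⊤ : ℕ∞) pr) (hθ : ContDiff ℝ (⊤ : ℕ∞) θ)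
    (hsol : TCM u v pr θ)
    (p q r α β γ : ℝ)
    (hp1 : 3 ≤ p) (hp2 : p ≤ 9 / 2)
    (hq1 : 2 ≤ q) (hq2 : q < 2 * (p / (p - 1)))
    (hr1 : 1 ≤ r) (hr2 : r < 2)
    (hα1 : 0 ≤ α) (hα2 : α ≤ 3 / p - 2 / 3)
    (hβ1 : 0 ≤ β) (hβ2 : β ≤ 3 / q - 1 / 2)
    (hγ1 : 0 ≤ γ) (hγ2 : γ ≤ 3 / r - 1 / 2)
    (hc1 : α + ((4 * p - 6) * q / ((6 - q) * p)) * β ≤ 1)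
    (hc2 : α + ((4 * p - 6) * r / ((6 - r) * p)) * γ ≤ 1)
    (hc3 : β + (2 * r / (6 - r)) * γ ≤ (6 - q) / (2 * q))
    (Rs : ℕ → ℝ) (hRs : Tendsto Rs atTop atTop)
    (hX : Tendsto (fun j => XnV u α p (Rs j)) atTop (nhds 0))
    (hY : ∃ L : ℝ, Tendsto (fun j => XnV v β q (Rs j)) atTop (nhds L))
    (hZ : ∃ L : ℝ, Tendsto (fun j => XnS θ γ r (Rs j)) atTop (nhds L)) :
    (∀ x, u x = 0) ∧ (∀ x, v x = 0) ∧ (∀ x, θ x = 0) := by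
  have hx : Ex p q r α β γ := ⟨hp1, hp2, hq1, hq2, hr1, hr2, hα2, hβ2, hγ2, hc1, hc2, hc3⟩
  obtain ⟨LY, hY⟩ := hY
  obtain ⟨LZ, hZ⟩ := hZ
  set M := 1 + |LY| + |LZ| with hM
  have p1 := abs_nonneg LY
  have p2 := abs_nonneg LZ
  have p3 := le_abs_self LY
  have p4 := le_abs_self LZ
  obtain ⟨K, hK⟩ := hx.fin (M := M) (by linarith)
  obtain ⟨C, hC, hKE⟩ := KE hp1
  obtain ⟨CV, hCV, hvol⟩ := vol_Sh
  set a := fun x => ‖u x‖ with ha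
  set b := fun x => ‖v x‖ with hb
  set c := fun x => |θ x| with hc
  have ca : Continuous a := hu.continuous.norm
  have cb : Continuous b := hv.continuous.norm
  have cc : Continuous c := hθ.continuous.abs
  have a0 : ∀ x, 0 ≤ a x := fun x => norm_nonneg _
  have b0 : ∀ x, 0 ≤ b x := fun x => norm_nonneg _
  have c0 : ∀ x, 0 ≤ c x := fun x => abs_nonneg _
  have hG : ∀ᶠ j in atTop, GG a b c (ball 0 (Rs j)) ≤ K := by
    filter_upwards [hRs.eventually_ge_atTop 1, hX.eventually_le_const (show 0 < M by linarith),
      hY.eventually_le_const (show LY < M by linarith), hZ.eventually_le_const (show LZ < M by linarith)] with j h1 h2 h3 h4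
    exact hK hu hv hpr hθ hsol (Rs j) h1 h2 h3 h4
  have gle : ∀ E, N6 a E ≤ GG a b c E ∧ N6 b E ≤ GG a b c E ∧ N6 c E ≤ GG a b c E := fun E => by
    have h1 := N6_nonneg a0 E
    have h2 := N6_nonneg b0 E
    have h3 := N6_nonneg c0 E
    rw [GG]
    refine ⟨?_, ?_, ?_⟩ <;> linarith
  obtain ⟨-, za⟩ := int6 ca a0 hRs (hG.mono fun j h => (gle _).1.trans h)
  obtain ⟨tb, zb⟩ := int6 cb b0 hRs (hG.mono fun j h => (gle _).2.1.trans h)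
  obtain ⟨tc, zc⟩ := int6 cc c0 hRs (hG.mono fun j h => (gle _).2.2.trans h)
  have hP1 : 1 < p / (p - 1) := by rw [lt_div_iff₀ (by linarith)]; linarith
  obtain ⟨A0, A1⟩ := eA_bd hr1 hr2
  obtain ⟨a1, a2, a3, -⟩ := eh_bd hp1 (by linarith) hq2
  obtain ⟨b1, b2, b3, -⟩ := eh_bd hp1 hr1 (by linarith)
  change Tendsto (fun j => XnS a α p (Rs j)) atTop (nhds 0) at hX
  change Tendsto (fun j => XnS b β q (Rs j)) atTop (nhds LY) at hY
  have pz : ∀ {s : ℕ → ℝ} {e : ℝ}, Tendsto s atTop (nhds 0) → 0 < e → Tendsto (fun j => s j ^ e) atTop (nhds 0) := by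
    intro s e hs he
    have := hs.rpow_const (p := e) (Or.inr he.le)
    rwa [Real.zero_rpow he.ne'] at this
  have pl : ∀ {s : ℕ → ℝ} {e L : ℝ}, Tendsto s atTop (nhds L) → 0 ≤ e → Tendsto (fun j => s j ^ e) atTop (nhds (L ^ e)) :=
    fun hs he => hs.rpow_const (Or.inr he)
  have s1 : Tendsto (fun j => CV * (XnS a α p (Rs j) ^ 2 + XnS a α p (Rs j) ^ 3)) atTop (nhds 0) := by
    have := ((hX.pow 2).add (hX.pow 3)).const_mul CV
    simpa using this
  have s2 : Tendsto (fun j => CV * N6 b (Sh (Rs j) (2 * Rs j))) atTop (nhds 0) := by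
    simpa using tb.const_mul CV
  have s3 : Tendsto (fun j => XnS θ γ r (Rs j) ^ (2 * eA r) * N6 c (Sh (Rs j) (2 * Rs j)) ^ (1 - eA r)) atTop (nhds 0) := by
    have := (pl hZ (show 0 ≤ 2 * eA r by linarith)).mul (pz tc (show 0 < 1 - eA r by linarith))
    rwa [mul_zero] at this
  have s4 : Tendsto (fun j => XnS a α p (Rs j) * (XnS b β q (Rs j) ^ (eg p q) * N6 b (Sh (Rs j) (2 * Rs j)) ^ (eh p q))) atTop (nhds 0) := by
    have := hX.mul ((pl hY a3).mul (pz tb a1))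
    rwa [mul_zero, mul_zero] at this
  have s5 : Tendsto (fun j => XnS a α p (Rs j) * (XnS θ γ r (Rs j) ^ (eg p r) * N6 c (Sh (Rs j) (2 * Rs j)) ^ (eh p r))) atTop (nhds 0) := by
    have := hX.mul ((pl hZ b3).mul (pz tc b1))
    rwa [mul_zero, mul_zero] at this
  have s6 : Tendsto (fun j => CV * XnS b β q (Rs j) * XnS θ γ r (Rs j) ^ (eA r) * N6 c (Sh (Rs j) (2 * Rs j)) ^ ((1 - eA r) / 2)) atTop (nhds 0) := by
    have := ((hY.const_mul CV).mul (pl hZ A0.le)).mul (pz tc (show 0 < (1 - eA r) / 2 by linarith))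
    rwa [mul_zero] at this
  have s := (((((s1.add s2).add s3).add s4).add s5).add s6).const_mul C
  simp only [add_zero, mul_zero] at s
  have tG : Tendsto (fun j => GG a b c (ball 0 (Rs j))) atTop (nhds 0) := by
    refine squeeze_zero' (Eventually.of_forall fun j => (N6_nonneg a0 _).trans (gle _).1) ?_ s
    filter_upwards [hRs.eventually_ge_atTop 1] with j h1
    have hR0 : 0 < Rs j := by linarith
    obtain ⟨x1, x2⟩ := Xn_le (k := p) (δ := α) ca (by linarith) hR0 le_rfl le_rfl
    obtain ⟨y1, y2⟩ := Xn_le (k := q) (δ := β) cb (by linarith) hR0 le_rfl le_rfl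
    obtain ⟨z1, z2⟩ := Xn_le (k := r) (δ := γ) hθ.continuous (by linarith) hR0 le_rfl le_rfl
    simp only [abs_of_nonneg (a0 _)] at x1
    simp only [abs_of_nonneg (b0 _)] at y1
    obtain ⟨t1, -, t2⟩ := hx.te (BM_Sh (Rs j) (2 * Rs j)) ca cb cc a0 b0 c0 hCV h1 (hvol (Rs j) (Rs j) (2 * Rs j) hR0 le_rfl) x2 y2 z2 x1 y1 z1
    have hk := hKE hu hv hpr hθ hsol (Rs j) (Rs j) (2 * Rs j) hR0 le_rfl (by linarith) le_rfl
    rw [show (2 * Rs j - Rs j) / Rs j = 1 by field_simp; ring, inv_one, one_pow, mul_one] at hk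
    refine hk.trans (mul_le_mul_of_nonneg_left ?_ hC.le)
    linarith
  have sq : ∀ {f : R3 → ℝ}, (∀ x, 0 ≤ f x) → (∀ E, N6 f E ≤ GG a b c E) → Tendsto (fun j => N6 f (ball 0 (Rs j))) atTop (nhds 0) :=
    fun f0 h => squeeze_zero (fun j => N6_nonneg f0 _) (fun j => h _) tG
  refine ⟨fun x => ?_, fun x => ?_, fun x => ?_⟩
  · exact norm_eq_zero.1 (za (sq a0 fun E => (gle E).1) x)
  · exact norm_eq_zero.1 (zb (sq b0 fun E => (gle E).2.1) x)
  · exact abs_eq_zero.1 (zc (sq c0 fun E => (gle E).2.2) x)
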